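/- Let 0 < R ≤ ∞, let m ≥ 1 be an integer, and let f be a (0,1)-form of class C^m on the ball B(R) ⊆ l¹ which is Lipschitz continuous on every ball B(r) with 0 < r < R. If f is ∂̄-closed, then there exists an m times continuously (real Fréchet) differentiable function u : B(R) → ℂ such that ∂̄u = f on B(R). -/

import Mathlib

open Set
open scoped ENNReal NNReal

noncomputable section

/-- `l¹`: the space of absolutely summable sequences of complex numbers. -/
abbrev L1 : Type := lp (fun _ : ℕ => ℂ) 1

/-- `ℂ^N` equipped with the `l¹` norm. -/
abbrev EN (N : ℕ) : Type := PiLp 1 (fun _ : Fin N => ℂ)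

/-- The `(0,1)`-part of the real Fréchet derivative of `u` at `z`, applied to `ξ`:
`∂̄u(z)(ξ) = (Du(z)(ξ) + i·Du(z)(iξ))/2`. -/
noncomputable def dbar {V : Type*} [NormedAddCommGroup V] [NormedSpace ℂ V]
    (u : V → ℂ) (z ξ : V) : ℂ :=
  (fderiv ℝ u z ξ + Complex.I * fderiv ℝ u z (Complex.I • ξ)) / 2

/-- `f` is a `(0,1)`-form of class `C^m` on `Ω`: each `f z` is (continuous) conjugate-linear
and `(z,ξ) ↦ f z ξ` is `m` times continuously differentiable in the real sense on `Ω × V`. -/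
def IsForm01 {V : Type*} [NormedAddCommGroup V] [NormedSpace ℂ V]
    (m : ℕ) (Ω : Set V) (f : V → V → ℂ) : Prop :=
  (∀ z ∈ Ω, ∀ ξ η : V, f z (ξ + η) = f z ξ + f z η) ∧
  (∀ z ∈ Ω, ∀ (a : ℂ) (ξ : V), f z (a • ξ) = (starRingEnd ℂ) a * f z ξ) ∧
  ContDiffOn ℝ m (fun p : V × V => f p.1 p.2) (Ω ×ˢ (univ : Set V))

/-- A `(0,1)`-form `f` is `∂̄`-closed on `Ω`. -/
def DbarClosed {V : Type*} [NormedAddCommGroup V] [NormedSpace ℂ V]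
    (Ω : Set V) (f : V → V → ℂ) : Prop :=
  ∀ z ∈ Ω, ∀ ξ η : V, dbar (fun w => f w ξ) z η = dbar (fun w => f w η) z ξ

/-- The set of values `‖f z ξ‖`, `z ∈ A`, `‖ξ‖ ≤ 1`; its sup is `|f|_{0,A}`. -/
def formSet0 {V : Type*} [NormedAddCommGroup V]
    (f : V → V → ℂ) (A : Set V) : Set ℝ :=
  {x | ∃ z ∈ A, ∃ ξ : V, ‖ξ‖ ≤ 1 ∧ x = ‖f z ξ‖}

/-- The set of difference quotients `‖f z ξ - f w ξ‖/‖z-w‖`; its sup is `|f|_{1,A}`. -/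
def formSet1 {V : Type*} [NormedAddCommGroup V]
    (f : V → V → ℂ) (A : Set V) : Set ℝ :=
  {x | ∃ z ∈ A, ∃ w ∈ A, z ≠ w ∧ ∃ ξ : V, ‖ξ‖ ≤ 1 ∧ x = ‖f z ξ - f w ξ‖ / ‖z - w‖}

/-- `|f|_{0,A}`. -/
noncomputable def formNorm0 {V : Type*} [NormedAddCommGroup V]
    (f : V → V → ℂ) (A : Set V) : ℝ := sSup (formSet0 f A)

/-- `|f|_{1,A}`. -/
noncomputable def formNorm1 {V : Type*} [NormedAddCommGroup V]
    (f : V → V → ℂ) (A : Set V) : ℝ := sSup (formSet1 f A)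

/-- `f` is Lipschitz continuous on `A`: `|f|_{0,A} < ∞` and `|f|_{1,A} < ∞`. -/
def LipschitzForm {V : Type*} [NormedAddCommGroup V]
    (f : V → V → ℂ) (A : Set V) : Prop :=
  BddAbove (formSet0 f A) ∧ BddAbove (formSet1 f A)

/-- `‖k‖ = ∑_ν k_ν` for a multiindex `k`. -/
def knormN (k : ℕ →₀ ℕ) : ℕ := k.sum fun _ m => m

/-- `k^k = ∏_ν k_ν^{k_ν}` (with `0^0 = 1`). -/
noncomputable def kk (k : ℕ →₀ ℕ) : ℝ := ∏ ν ∈ k.support, (k ν : ℝ) ^ k ν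

/-- `‖k‖^{‖k‖}` (with `0^0 = 1`). -/
noncomputable def nn (k : ℕ →₀ ℕ) : ℝ := ((knormN k : ℝ)) ^ knormN k

/-- The monomial `z^k = ∏_ν z_ν^{k_ν}` (with `0^0 = 1`). -/
noncomputable def monom (k : ℕ →₀ ℕ) (z : ℕ → ℂ) : ℂ := ∏ ν ∈ k.support, z ν ^ k ν

/-- The term of the series defining `Δ(q,z)` corresponding to the multiindex `k`:
`(‖k‖^{‖k‖}/k^k)·|q|^{#k}·|z^k|`. -/
noncomputable def DeltaTerm (q : ℂ) (z : ℕ → ℂ) (k : ℕ →₀ ℕ) : ℝ :=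
  (nn k / kk k) * ‖q‖ ^ k.support.card * ∏ ν ∈ k.support, ‖z ν‖ ^ k ν

/-- `Δ(q,z) = ∑_k (‖k‖^{‖k‖}/k^k)·|q|^{#k}·|z^k|`. -/
noncomputable def Delta (q : ℂ) (z : ℕ → ℂ) : ℝ := ∑' k, DeltaTerm q z k

section PartA
open MeasureTheory Metric Filter Topology

section basics
variable {V : Type*} [NormedAddCommGroup V] [NormedSpace ℂ V]
variable {W : Type*} [NormedAddCommGroup W] [NormedSpace ℂ W]

theorem dbar_of_hasFDerivAt {u : V → ℂ} {z : V} {L : V →L[ℝ] ℂ} (h : HasFDerivAt u L z) (ξ : V) :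
    dbar u z ξ = (L ξ + Complex.I * L (Complex.I • ξ)) / 2 := by
  rw [dbar, h.fderiv]

theorem dbar_add {u v : V → ℂ} {z : V} (hu : DifferentiableAt ℝ u z) (hv : DifferentiableAt ℝ v z)
    (ξ : V) : dbar (fun z => u z + v z) z ξ = dbar u z ξ + dbar v z ξ := by
  rw [dbar_of_hasFDerivAt (u := fun z => u z + v z) (hu.hasFDerivAt.add hv.hasFDerivAt)]
  simp [dbar]; ring

theorem dbar_sub {u v : V → ℂ} {z : V} (hu : DifferentiableAt ℝ u z) (hv : DifferentiableAt ℝ v z)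
    (ξ : V) : dbar (fun z => u z - v z) z ξ = dbar u z ξ - dbar v z ξ := by
  rw [dbar_of_hasFDerivAt (u := fun z => u z - v z) (hu.hasFDerivAt.sub hv.hasFDerivAt)]
  simp [dbar]; ring

theorem dbar_mul {u v : V → ℂ} {z : V} (hu : DifferentiableAt ℝ u z) (hv : DifferentiableAt ℝ v z)
    (ξ : V) : dbar (fun z => u z * v z) z ξ = dbar u z ξ * v z + u z * dbar v z ξ := by
  rw [dbar_of_hasFDerivAt (u := fun z => u z * v z) (hu.hasFDerivAt.mul hv.hasFDerivAt)]
  simp [dbar]; ring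

theorem dbar_congr {u v : V → ℂ} {z : V} (h : u =ᶠ[𝓝 z] v) (ξ : V) : dbar u z ξ = dbar v z ξ := by
  rw [dbar, dbar, h.fderiv_eq]

theorem dbar_const (c : ℂ) (z ξ : V) : dbar (fun _ : V => c) z ξ = 0 := by
  simp [dbar]

theorem dbar_comp_affine {u : V → ℂ} (L : W →L[ℂ] V) (c : V) (z ξ : W)
    (hu : DifferentiableAt ℝ u (L z + c)) :
    dbar (fun w => u (L w + c)) z ξ = dbar u (L z + c) (L ξ) := by
  have h1 : HasFDerivAt (fun w => L w + c) (L.restrictScalars ℝ) z :=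
    ((L.restrictScalars ℝ).hasFDerivAt).add_const c
  have := hu.hasFDerivAt.comp z h1
  rw [dbar_of_hasFDerivAt (u := fun w => u (L w + c)) this]
  simp [dbar]

theorem dbar_eq_zero_of_complex {u : V → ℂ} {z : V} (hu : DifferentiableAt ℂ u z) (ξ : V) :
    dbar u z ξ = 0 := by
  rw [dbar_of_hasFDerivAt (hu.hasFDerivAt.restrictScalars ℝ)]
  simp [← mul_assoc]

theorem dbar_smul_right (u : V → ℂ) (z : V) (a : ℂ) (ξ : V) :
    dbar u z (a • ξ) = (starRingEnd ℂ) a * dbar u z ξ := by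
  obtain ⟨x, y⟩ := a
  have e1 : (⟨x, y⟩ : ℂ) • ξ = x • ξ + y • (Complex.I • ξ) := by
    rw [← Complex.coe_smul, ← Complex.coe_smul, smul_smul, ← add_smul]
    congr 1; apply Complex.ext <;> simp
  have e2 : Complex.I • ((⟨x, y⟩ : ℂ) • ξ) = x • (Complex.I • ξ) - y • ξ := by
    rw [← Complex.coe_smul, ← Complex.coe_smul, smul_smul, smul_smul, ← sub_smul]
    congr 1; apply Complex.ext <;> simp
  have e3 : (starRingEnd ℂ) (⟨x, y⟩ : ℂ) = x - y * Complex.I := by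
    apply Complex.ext <;> simp
  rw [dbar, dbar, e2, e1, e3]
  simp only [map_add, map_sub, map_smul, Complex.real_smul]
  ring_nf
  rw [Complex.I_sq]; ring

theorem dbar_add_right (u : V → ℂ) (z : V) (ξ η : V) :
    dbar u z (ξ + η) = dbar u z ξ + dbar u z η := by
  simp only [dbar, smul_add, map_add]; ring

theorem norm_dbar_le (u : V → ℂ) (z ξ : V) : ‖dbar u z ξ‖ ≤ ‖fderiv ℝ u z‖ * ‖ξ‖ := by
  rw [dbar, norm_div]
  have h1 := (fderiv ℝ u z).le_opNorm ξ
  have h2 := (fderiv ℝ u z).le_opNorm (Complex.I • ξ)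
  have h3 := norm_add_le (fderiv ℝ u z ξ) (Complex.I * fderiv ℝ u z (Complex.I • ξ))
  rw [norm_mul, Complex.norm_I, one_mul] at h3
  rw [norm_smul, Complex.norm_I, one_mul] at h2
  have : ‖(2:ℂ)‖ = 2 := by simp
  rw [this]; linarith

/-- `u` is a `C¹` solution of `∂̄u = f` on `Ω`. -/
def Sol (Ω : Set V) (u : V → ℂ) (f : V → V → ℂ) : Prop :=
  ContDiffOn ℝ 1 u Ω ∧ ∀ z ∈ Ω, ∀ ξ, dbar u z ξ = f z ξ

theorem Sol.diffAt {Ω : Set V} (hΩ : IsOpen Ω) {u : V → ℂ} {f} (h : Sol Ω u f) {z} (hz : z ∈ Ω) :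
    DifferentiableAt ℝ u z := (h.1.contDiffAt (hΩ.mem_nhds hz)).differentiableAt (by norm_num)

theorem Sol.add {Ω : Set V} (hΩ : IsOpen Ω) {u v : V → ℂ} {f g} (h : Sol Ω u f) (h' : Sol Ω v g) :
    Sol Ω (fun z => u z + v z) (fun z ξ => f z ξ + g z ξ) :=
  ⟨h.1.add h'.1, fun z hz ξ => by
    rw [dbar_add (h.diffAt hΩ hz) (h'.diffAt hΩ hz), h.2 z hz, h'.2 z hz]⟩

theorem Sol.sub {Ω : Set V} (hΩ : IsOpen Ω) {u v : V → ℂ} {f g} (h : Sol Ω u f) (h' : Sol Ω v g) :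
    Sol Ω (fun z => u z - v z) (fun z ξ => f z ξ - g z ξ) :=
  ⟨h.1.sub h'.1, fun z hz ξ => by
    rw [dbar_sub (h.diffAt hΩ hz) (h'.diffAt hΩ hz), h.2 z hz, h'.2 z hz]⟩

theorem Sol.mul {Ω : Set V} (hΩ : IsOpen Ω) {u v : V → ℂ} {f g} (h : Sol Ω u f) (h' : Sol Ω v g) :
    Sol Ω (fun z => u z * v z) (fun z ξ => f z ξ * v z + u z * g z ξ) :=
  ⟨h.1.mul h'.1, fun z hz ξ => by
    rw [dbar_mul (h.diffAt hΩ hz) (h'.diffAt hΩ hz), h.2 z hz, h'.2 z hz]⟩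

theorem Sol.mono {Ω Ω' : Set V} {u : V → ℂ} {f} (h : Sol Ω u f) (hs : Ω' ⊆ Ω) : Sol Ω' u f :=
  ⟨h.1.mono hs, fun z hz => h.2 z (hs hz)⟩

theorem Sol.congr {Ω : Set V} (hΩ : IsOpen Ω) {u v : V → ℂ} {f g} (h : Sol Ω u f)
    (huv : ∀ z ∈ Ω, v z = u z) (hfg : ∀ z ∈ Ω, ∀ ξ, g z ξ = f z ξ) : Sol Ω v g :=
  ⟨h.1.congr huv, fun z hz ξ => by
    rw [hfg z hz, ← h.2 z hz]
    exact dbar_congr (Filter.eventually_of_mem (hΩ.mem_nhds hz) huv) ξ⟩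

theorem Sol.of_complex {Ω : Set V} {u : V → ℂ} (hu : ∀ z, DifferentiableAt ℂ u z)
    (hc : ContDiff ℝ 1 u) : Sol Ω u (fun _ _ => 0) :=
  ⟨hc.contDiffOn, fun z _ ξ => dbar_eq_zero_of_complex (hu z) ξ⟩

theorem Sol.const {Ω : Set V} (c : ℂ) : Sol Ω (fun _ => c) (fun _ _ => 0) :=
  ⟨contDiffOn_const, fun z _ ξ => dbar_const c z ξ⟩

theorem Sol.comp_affine {Ω : Set V} (hΩ : IsOpen Ω) {u : V → ℂ} {f} (h : Sol Ω u f)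
    (L : W →L[ℂ] V) (c : V) {Ω' : Set W} (hs : ∀ w ∈ Ω', L w + c ∈ Ω) :
    Sol Ω' (fun w => u (L w + c)) (fun w ξ => f (L w + c) (L ξ)) :=
  ⟨h.1.comp (((L.restrictScalars ℝ).contDiff.add contDiff_const).contDiffOn) hs,
    fun z hz ξ => by rw [dbar_comp_affine L c z ξ (h.diffAt hΩ (hs z hz)), h.2 _ (hs z hz)]⟩

theorem Sol.comp {Ω : Set V} (hΩ : IsOpen Ω) {u : V → ℂ} {f} (h : Sol Ω u f)
    (L : W →L[ℂ] V) {Ω' : Set W} (hs : ∀ w ∈ Ω', L w ∈ Ω) :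
    Sol Ω' (fun w => u (L w)) (fun w ξ => f (L w) (L ξ)) := by
  have := h.comp_affine hΩ L 0 (Ω' := Ω') (by simpa using hs)
  simpa using this

theorem Sol.sum {ι : Type*} {Ω : Set V} (hΩ : IsOpen Ω) (s : Finset ι) {u : ι → V → ℂ} {f : ι → V → V → ℂ}
    (h : ∀ i ∈ s, Sol Ω (u i) (f i)) :
    Sol Ω (fun z => ∑ i ∈ s, u i z) (fun z ξ => ∑ i ∈ s, f i z ξ) := by
  classical
  induction s using Finset.induction_on with
  | empty => simpa using Sol.const (Ω := Ω) 0
  | insert a s ha ih =>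
    simp only [Finset.sum_insert ha]
    exact (h a (by simp)).add hΩ (ih fun i hi => h i (by simp [hi]))

theorem Sol.const_mul {Ω : Set V} (hΩ : IsOpen Ω) {u : V → ℂ} {f} (h : Sol Ω u f) (c : ℂ) :
    Sol Ω (fun z => c * u z) (fun z ξ => c * f z ξ) :=
  ((Sol.const c).mul hΩ h).congr hΩ (fun _ _ => rfl) (fun z _ ξ => by simp)

/-- the one-variable `∂/∂ζ̄`. -/
def db (φ : ℂ → ℂ) (ζ : ℂ) : ℂ := dbar φ ζ 1

theorem continuous_db {φ : ℂ → ℂ} (h : ContDiff ℝ 1 φ) : Continuous (db φ) := by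
  have := h.continuous_fderiv (by norm_num)
  unfold db dbar
  fun_prop

theorem db_zero_of_eventually {φ : ℂ → ℂ} {ζ : ℂ} {c : ℂ} (h : ∀ᶠ w in 𝓝 ζ, φ w = c) :
    db φ ζ = 0 := by
  rw [db, dbar_congr (v := fun _ => c) h, dbar_const]

theorem hasCompactSupport_db {φ : ℂ → ℂ} (hs : HasCompactSupport φ) : HasCompactSupport (db φ) := by
  refine hs.mono' (fun x hx => ?_)
  by_contra hcon
  rw [notMem_tsupport_iff_eventuallyEq] at hcon
  exact hx (db_zero_of_eventually (c := 0) hcon)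
end basics

/-- Cauchy–Pompeiu at the origin. -/
theorem cp_zero {φ : ℂ → ℂ} (h : ContDiff ℝ 1 φ) (hs : HasCompactSupport φ) :
    ∫ ζ, (ζ)⁻¹ * db φ ζ = -(Real.pi : ℂ) * φ 0 := by
  obtain ⟨R, hR⟩ : ∃ R : ℝ, ∀ x, R ≤ ‖x‖ → φ x = 0 := by
    obtain ⟨R, hR⟩ := hs.isCompact.isBounded.subset_ball 0
    exact ⟨R, fun x hx => image_eq_zero_of_notMem_tsupport fun hh => by
      have := hR hh; simp at this; linarith⟩
  have hfd := h.continuous_fderiv (by norm_num)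
  have hfs : ∀ x, R < ‖x‖ → fderiv ℝ φ x = 0 := by
    intro x hx
    have : φ =ᶠ[𝓝 x] fun _ => 0 := by
      filter_upwards [continuous_norm.continuousAt.eventually (lt_mem_nhds hx)] with y hy
      exact hR y hy.le
    rw [this.fderiv_eq]; simp
  set e : ℝ → ℂ := fun θ => Real.cos θ + Real.sin θ * Complex.I with he
  have hec : Continuous e := by
    rw [he]; fun_prop
  have hen : ∀ θ, ‖e θ‖ = 1 := fun θ => by
    simp only [he, Complex.ofReal_cos, Complex.ofReal_sin, ← Complex.exp_mul_I]
    exact Complex.norm_exp_ofReal_mul_I θ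
  have he0 : ∀ θ, e θ ≠ 0 := fun θ hh => by have := hen θ; rw [hh] at this; simp at this
  set g1 : ℝ × ℝ → ℂ := fun p => fderiv ℝ φ (p.1 * e p.2) (e p.2) / 2
  set g2 : ℝ × ℝ → ℂ := fun p => fderiv ℝ φ (p.1 * e p.2) (Complex.I * e p.2) * (Complex.I / 2)
  have hg1c : Continuous g1 := by
    have : Continuous fun p : ℝ × ℝ => (p.1 : ℂ) * e p.2 := by fun_prop
    have := hfd.comp this
    exact (this.clm_apply (by fun_prop)).div_const _
  have hg2c : Continuous g2 := by
    have : Continuous fun p : ℝ × ℝ => (p.1 : ℂ) * e p.2 := by fun_prop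
    have := hfd.comp this
    exact (this.clm_apply (by fun_prop)).mul continuous_const
  have hg1z : ∀ p : ℝ × ℝ, R < p.1 → 0 < p.1 → g1 p = 0 := by
    intro p hp hp0
    simp only [g1]; rw [hfs]; · simp
    simp [hen, abs_of_pos hp0, hp]
  have hg2z : ∀ p : ℝ × ℝ, R < p.1 → 0 < p.1 → g2 p = 0 := by
    intro p hp hp0
    simp only [g2]; rw [hfs]; · simp
    simp [hen, abs_of_pos hp0, hp]
  have hint : ∀ g : ℝ × ℝ → ℂ, Continuous g → (∀ p : ℝ × ℝ, R < p.1 → 0 < p.1 → g p = 0) →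
      IntegrableOn g (Ioi (0:ℝ) ×ˢ Ioo (-Real.pi) Real.pi) := by
    intro g hg hz
    have h1 : IntegrableOn g (Icc (0:ℝ) (max R 0) ×ˢ Icc (-Real.pi) Real.pi) :=
      hg.continuousOn.integrableOn_compact (isCompact_Icc.prod isCompact_Icc)
    refine h1.of_forall_sdiff_eq_zero (measurableSet_Ioi.prod measurableSet_Ioo) ?_
    rintro ⟨r, θ⟩ ⟨⟨h1, h2⟩, h3⟩
    simp only [mem_Ioi, mem_Ioo, mem_prod, mem_Icc, not_and, not_le] at h1 h2 h3
    apply hz _ _ h1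
    by_contra hcon
    have := h3 ⟨h1.le, le_max_of_le_left (not_lt.1 hcon)⟩ h2.1.le
    exact absurd h2.2 (not_lt.2 this.le)
  have hi1 := hint g1 hg1c hg1z
  have hi2 := hint g2 hg2c hg2z
  have key : ∫ ζ, (ζ)⁻¹ * db φ ζ = ∫ p in Ioi (0:ℝ) ×ˢ Ioo (-Real.pi) Real.pi, (g1 p + g2 p) := by
    rw [← Complex.integral_comp_polarCoord_symm]
    refine setIntegral_congr_fun (measurableSet_Ioi.prod measurableSet_Ioo) ?_
    rintro ⟨r, θ⟩ ⟨h1, h2⟩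
    simp only [mem_Ioi] at h1
    have hr : (r : ℂ) ≠ 0 := by exact_mod_cast h1.ne'
    have e1 : dbar φ (r * e θ) (e θ) = (starRingEnd ℂ) (e θ) * db φ (r * e θ) := by
      have := dbar_smul_right φ (r * e θ) (e θ) 1
      simpa [db] using this
    have e2 : (starRingEnd ℂ) (e θ) = (e θ)⁻¹ := by
      rw [Complex.inv_def]
      simp [Complex.normSq_eq_norm_sq, hen]
    have e3 : g1 (r, θ) + g2 (r, θ) = dbar φ (r * e θ) (e θ) := by
      simp only [g1, g2, dbar, smul_eq_mul]; ring
    simp only [Complex.polarCoord_symm_apply]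
    change r • (((r:ℂ) * e θ)⁻¹ * db φ (r * e θ)) = _
    rw [e3, e1, e2, Complex.real_smul]
    field_simp
  rw [key, integral_add hi1 hi2, Measure.volume_eq_prod, setIntegral_prod g2 hi2]
  have z2 : ∀ r ∈ Ioi (0:ℝ), ∫ θ in Ioo (-Real.pi) Real.pi, g2 (r, θ) = 0 := by
    intro r hr
    have hr : (r : ℂ) ≠ 0 := by exact_mod_cast (ne_of_gt hr)
    rw [← integral_Ioc_eq_integral_Ioo,
      ← intervalIntegral.integral_of_le (by linarith [Real.pi_pos])]
    have hd : ∀ θ ∈ uIcc (-Real.pi) Real.pi,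
        HasDerivAt (fun θ => φ (r * e θ) * (Complex.I / 2 / r)) (g2 (r, θ)) θ := by
      intro θ _
      have d1 : HasDerivAt e (Complex.I * e θ) θ := by
        have hc := (Real.hasDerivAt_cos θ).ofReal_comp
        have hsn := (Real.hasDerivAt_sin θ).ofReal_comp
        have := hc.add (hsn.mul_const Complex.I)
        refine this.congr_deriv ?_
        simp only [he]; push_cast
        ring_nf; rw [Complex.I_sq]; ring
      have d2 : HasDerivAt (fun θ => (r:ℂ) * e θ) (r * (Complex.I * e θ)) θ := d1.const_mul _
      have d3 := ((h.differentiable (by norm_num)) (r * e θ)).hasFDerivAt.comp_hasDerivAt θ d2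
      refine (d3.mul_const _).congr_deriv ?_
      have : (r:ℂ) * (Complex.I * e θ) = r • (Complex.I * e θ) := by simp
      rw [this, map_smul, Complex.real_smul]
      simp only [g2]
      field_simp
    rw [intervalIntegral.integral_eq_sub_of_hasDerivAt hd
      ((hg2c.comp (by fun_prop : Continuous fun θ : ℝ => (r, θ))).intervalIntegrable _ _)]
    simp [he]
  rw [setIntegral_congr_fun measurableSet_Ioi z2]
  have hi1' : IntegrableOn g1 (Ioi (0:ℝ) ×ˢ Ioo (-Real.pi) Real.pi) (volume.prod volume) := by
    rwa [← Measure.volume_eq_prod]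
  have sw : ∫ p in Ioi (0:ℝ) ×ˢ Ioo (-Real.pi) Real.pi, g1 p ∂(volume.prod volume) =
      ∫ θ in Ioo (-Real.pi) Real.pi, ∫ r in Ioi (0:ℝ), g1 (r, θ) := by
    rw [IntegrableOn, ← Measure.prod_restrict] at hi1'
    rw [← Measure.prod_restrict, integral_prod_symm _ hi1']
  rw [sw]
  have z1 : ∀ θ ∈ Ioo (-Real.pi) Real.pi, ∫ r in Ioi (0:ℝ), g1 (r, θ) = - φ 0 / 2 := by
    intro θ _
    have hd : ∀ r ∈ Ioi (0:ℝ), HasDerivAt (fun r : ℝ => φ (r * e θ) / 2) (g1 (r, θ)) r := by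
      intro r _
      have d2 : HasDerivAt (fun r : ℝ => (r:ℂ) * e θ) (1 * e θ) r :=
        (Complex.ofRealCLM.hasDerivAt).mul_const _
      have d3 := ((h.differentiable (by norm_num)) (r * e θ)).hasFDerivAt.comp_hasDerivAt r d2
      simpa [g1] using d3.div_const 2
    have hc : ContinuousWithinAt (fun r : ℝ => φ (r * e θ) / 2) (Ici 0) 0 := by
      have := h.continuous
      exact Continuous.continuousWithinAt (by fun_prop)
    have hi : IntegrableOn (fun r => g1 (r, θ)) (Ioi 0) := by
      have h1 : IntegrableOn (fun r => g1 (r, θ)) (Icc (0:ℝ) (max R 0)) :=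
        (hg1c.comp (by fun_prop : Continuous fun r : ℝ => (r, θ))).continuousOn.integrableOn_compact
          isCompact_Icc
      refine h1.of_forall_sdiff_eq_zero measurableSet_Ioi ?_
      rintro r ⟨h1, h3⟩
      simp only [mem_Ioi, mem_Icc, not_and, not_le] at h1 h3
      exact hg1z _ (lt_of_le_of_lt (le_max_left _ _) (h3 h1.le)) h1
    have ht : Tendsto (fun r : ℝ => φ (r * e θ) / 2) atTop (𝓝 0) := by
      apply tendsto_const_nhds.congr'
      filter_upwards [eventually_ge_atTop R, eventually_ge_atTop 0] with r hr hr0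
      rw [hR]; · simp
      simpa [hen, abs_of_nonneg hr0] using hr
    rw [integral_Ioi_of_hasDerivAt_of_tendsto hc hd hi ht]
    simp; ring
  rw [setIntegral_congr_fun measurableSet_Ioo z1]
  simp [Real.pi_pos.le]
  ring

theorem cp {φ : ℂ → ℂ} (h : ContDiff ℝ 1 φ) (hs : HasCompactSupport φ) (t : ℂ) :
    ∫ ζ, (ζ - t)⁻¹ * db φ ζ = -(Real.pi : ℂ) * φ t := by
  have h1 : ContDiff ℝ 1 (fun ζ => φ (ζ + t)) := h.comp (contDiff_id.add contDiff_const)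
  have h2 : HasCompactSupport (fun ζ => φ (ζ + t)) := hs.comp_homeomorph (Homeomorph.addRight t)
  have := cp_zero h1 h2
  rw [zero_add] at this
  rw [← this, ← integral_add_right_eq_self _ t]
  congr 1; ext ζ
  have := dbar_comp_affine (u := φ) (ContinuousLinearMap.id ℂ ℂ) t ζ 1
    (h.differentiable (by norm_num) _)
  simp at this
  simp [db, this]

theorem integral_db {φ : ℂ → ℂ} (h : ContDiff ℝ 1 φ) (hs : HasCompactSupport φ) :
    ∫ ζ, db φ ζ = 0 := by
  have := cp_zero (φ := fun ζ => ζ * φ ζ) (contDiff_id.mul h) (hs.mul_left)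
  simp only [zero_mul, mul_zero] at this
  rw [← this]
  apply integral_congr_ae
  have : ∀ᵐ ζ : ℂ, ζ ≠ 0 := by simp [ae_iff]
  filter_upwards [this] with ζ hζ
  have e : db (fun ζ => ζ * φ ζ) ζ = ζ * db φ ζ := by
    rw [db, dbar_mul (u := fun ζ : ℂ => ζ) differentiableAt_fun_id
      (h.differentiable (by norm_num) _),
      dbar_eq_zero_of_complex (u := fun ζ : ℂ => ζ) differentiableAt_fun_id]
    simp [db]
  rw [e, ← mul_assoc, inv_mul_cancel₀ hζ, one_mul]
end PartA

section PartB
open MeasureTheory Metric Filter Topology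

structure Cut (a b D : ℝ) (χ : ℂ → ℂ) : Prop where
  smooth : ContDiff ℝ 1 χ
  one : ∀ w, ‖w‖ ≤ a → χ w = 1
  zero : ∀ w, b ≤ ‖w‖ → χ w = 0
  le : ∀ w, ‖χ w‖ ≤ 1
  dle : ∀ w, ‖db χ w‖ ≤ D
  d1 : ∀ w, ‖w‖ ≤ a → db χ w = 0
  d0 : ∀ w, b ≤ ‖w‖ → db χ w = 0

theorem Cut.cont {a b D : ℝ} {χ : ℂ → ℂ} (h : Cut a b D χ) : Continuous χ := h.smooth.continuous

theorem Cut.dcont {a b D : ℝ} {χ : ℂ → ℂ} (h : Cut a b D χ) : Continuous (db χ) :=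
  continuous_db h.smooth

theorem Cut.Dnonneg {a b D : ℝ} {χ : ℂ → ℂ} (h : Cut a b D χ) : 0 ≤ D :=
  (norm_nonneg _).trans (h.dle 0)

theorem Cut.compact {a b D : ℝ} {χ : ℂ → ℂ} (h : Cut a b D χ) : HasCompactSupport χ :=
  HasCompactSupport.intro (isCompact_closedBall (0:ℂ) b) fun x hx => h.zero x (by
    simp at hx; exact hx.le)

theorem exists_cut {a b : ℝ} (ha : 0 < a) (hab : a < b) :
    ∃ D χ, Cut a b D χ ∧ ∫ ζ, χ ζ ≠ 0 := by
  obtain ⟨a', h1, h2⟩ := exists_between hab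
  obtain ⟨b', h3, h4⟩ := exists_between h2
  let β : ContDiffBump (0:ℂ) := ⟨a', b', ha.trans h1, h3⟩
  have hβ : ContDiff ℝ 1 β := β.contDiff
  have hsm : ContDiff ℝ 1 (fun w => (β w : ℂ)) := Complex.ofRealCLM.contDiff.comp hβ
  have hcs : HasCompactSupport (fun w => (β w : ℂ)) := by
    apply HasCompactSupport.intro (isCompact_closedBall (0:ℂ) b')
    intro x hx
    rw [β.zero_of_le_dist]; · simp
    simp at hx; simpa using hx.le
  obtain ⟨D, hD⟩ := (hasCompactSupport_db hcs).exists_bound_of_continuous (continuous_db hsm)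
  refine ⟨D, fun w => (β w : ℂ), ⟨hsm, ?_, ?_, ?_, hD, ?_, ?_⟩, ?_⟩
  · intro w hw
    rw [β.one_of_mem_closedBall]; · simp
    simpa using hw.trans h1.le
  · intro w hw
    rw [β.zero_of_le_dist]; · simp
    simpa using h4.le.trans hw
  · intro w
    simp [abs_of_nonneg β.nonneg, β.le_one]
  · intro w hw
    apply db_zero_of_eventually (c := 1)
    filter_upwards [continuous_norm.continuousAt.eventually (gt_mem_nhds (hw.trans_lt h1))] with y hy
    rw [β.one_of_mem_closedBall]; · simp
    simpa using le_of_lt hy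
  · intro w hw
    apply db_zero_of_eventually (c := 0)
    filter_upwards [continuous_norm.continuousAt.eventually (lt_mem_nhds (h4.trans_le hw))] with y hy
    rw [β.zero_of_le_dist]; · simp
    simpa using le_of_lt hy
  · have := β.integral_pos (μ := volume)
    rw [integral_complex_ofReal]
    exact_mod_cast this.ne'

theorem Cut.scale {a b D : ℝ} {χ : ℂ → ℂ} (h : Cut a b D χ) {ρ : ℝ} (hρ : 0 < ρ) :
    Cut (ρ * a) (ρ * b) (D / ρ) (fun w => χ ((ρ⁻¹ : ℝ) * w)) := by
  have hn : ∀ w : ℂ, ‖((ρ⁻¹ : ℝ) : ℂ) * w‖ = ρ⁻¹ * ‖w‖ := fun w => by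
    simp [abs_of_pos hρ]
  have hd : ∀ w : ℂ, db (fun w => χ ((ρ⁻¹ : ℝ) * w)) w = (ρ⁻¹ : ℝ) * db χ ((ρ⁻¹ : ℝ) * w) := by
    intro w
    have := dbar_comp_affine (u := χ) (((ρ⁻¹ : ℝ) : ℂ) • ContinuousLinearMap.id ℂ ℂ) 0 w 1
      (h.smooth.differentiable (by norm_num) _)
    simp at this
    have h2 := dbar_smul_right χ ((ρ⁻¹ : ℝ) * w) ((ρ⁻¹ : ℝ)) 1
    simp at h2
    simp [db, this, h2]
  have hA : ∀ w : ℂ, ‖w‖ ≤ ρ * a → ‖((ρ⁻¹ : ℝ) : ℂ) * w‖ ≤ a := fun w hw => by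
    rw [hn, inv_mul_le_iff₀ hρ]; exact hw
  have hB : ∀ w : ℂ, ρ * b ≤ ‖w‖ → b ≤ ‖((ρ⁻¹ : ℝ) : ℂ) * w‖ := fun w hw => by
    rw [hn, le_inv_mul_iff₀ hρ]; exact hw
  refine ⟨h.smooth.comp (contDiff_const.mul contDiff_id), fun w hw => h.one _ (hA w hw),
    fun w hw => h.zero _ (hB w hw), fun w => h.le _, fun w => ?_, fun w hw => ?_, fun w hw => ?_⟩
  · rw [hd, norm_mul, div_eq_inv_mul]
    have : ‖((ρ⁻¹:ℝ):ℂ)‖ = ρ⁻¹ := by simp [abs_of_pos hρ]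
    rw [this]
    exact mul_le_mul_of_nonneg_left (h.dle _) (by positivity)
  · rw [hd, h.d1 _ (hA w hw), mul_zero]
  · rw [hd, h.d0 _ (hB w hw), mul_zero]

theorem chi0_ex : ∃ Dχ : ℝ × (ℂ → ℂ), Cut (1/2) 1 Dχ.1 Dχ.2 ∧ ∫ ζ, Dχ.2 ζ ≠ 0 := by
  obtain ⟨D, χ, h⟩ := exists_cut (a := 1/2) (b := 1) (by norm_num) (by norm_num)
  exact ⟨(D, χ), h⟩
/-- the absolute constant and the standard cutoff -/
def D0 : ℝ := chi0_ex.choose.1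
def chi0 : ℂ → ℂ := chi0_ex.choose.2
theorem cut0 : Cut (1/2) 1 D0 chi0 := chi0_ex.choose_spec.1
theorem int_chi0 : ∫ ζ, chi0 ζ ≠ 0 := chi0_ex.choose_spec.2
theorem D0_nonneg : 0 ≤ D0 := cut0.Dnonneg
theorem exists_cut_half {ρ : ℝ} (hρ : 0 < ρ) : ∃ χ, Cut (ρ / 2) ρ (D0 / ρ) χ := by
  have := cut0.scale hρ
  rw [mul_one, mul_one_div] at this
  exact ⟨_, this⟩

section cuts
variable {F : Type*} [NormedAddCommGroup F] [NormedSpace ℂ F]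

theorem cut_continuous {k : ℂ → ℂ} {g : ℂ → F} {b : ℝ} (hk : Continuous k)
    (hz : ∀ ζ, b ≤ ‖ζ‖ → k ζ = 0) {U : Set ℂ} (hU : IsOpen U) (hs : ∀ ζ, ‖ζ‖ ≤ b → ζ ∈ U)
    (hg : ContinuousOn g U) : Continuous fun ζ => k ζ • g ζ := by
  rw [continuous_iff_continuousAt]
  intro x
  by_cases hx : x ∈ U
  · exact hk.continuousAt.smul (hg.continuousAt (hU.mem_nhds hx))
  · have : b < ‖x‖ := by by_contra h; exact hx (hs x (not_lt.1 h))
    have : (fun ζ => k ζ • g ζ) =ᶠ[𝓝 x] fun _ => 0 := by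
      filter_upwards [continuous_norm.continuousAt.eventually (lt_mem_nhds this)] with y hy
      rw [hz y (le_of_lt hy), zero_smul]
    exact continuousAt_const.congr this.symm

theorem cut_contDiff {k : ℂ → ℂ} {g : ℂ → ℂ} {b : ℝ} (hk : ContDiff ℝ 1 k)
    (hz : ∀ ζ, b ≤ ‖ζ‖ → k ζ = 0) {U : Set ℂ} (hU : IsOpen U) (hs : ∀ ζ, ‖ζ‖ ≤ b → ζ ∈ U)
    (hg : ContDiffOn ℝ 1 g U) : ContDiff ℝ 1 fun ζ => k ζ * g ζ := by
  rw [contDiff_iff_contDiffAt]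
  intro x
  by_cases hx : x ∈ U
  · exact hk.contDiffAt.mul (hg.contDiffAt (hU.mem_nhds hx))
  · have : b < ‖x‖ := by by_contra h; exact hx (hs x (not_lt.1 h))
    have : (fun ζ => k ζ * g ζ) =ᶠ[𝓝 x] fun _ => 0 := by
      filter_upwards [continuous_norm.continuousAt.eventually (lt_mem_nhds this)] with y hy
      rw [hz y (le_of_lt hy), zero_mul]
    exact contDiffAt_const.congr_of_eventuallyEq this

/-- kernel integrals -/
def Ka (α ρ : ℝ) : ℝ := ∫ ζ in ball (0:ℂ) ρ, ‖ζ‖ ^ (-α)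

theorem ka_int {α : ℝ} (hα : α < 2) (ρ : ℝ) :
    IntegrableOn (fun ζ : ℂ => ‖ζ‖ ^ (-α)) (ball (0:ℂ) ρ) := by
  refine integrableOn_ball_of_norm_le_rpow (C := 1) (α := α) ?_ ?_ ?_ ?_
  · simp [Complex.finrank_real_complex]
  · simpa [Complex.finrank_real_complex] using hα
  · refine Eventually.of_forall fun x => ?_
    rw [Real.norm_of_nonneg (by positivity), one_mul]
  · exact (measurable_norm.pow_const _).aestronglyMeasurable

theorem ka_nonneg (α ρ : ℝ) : 0 ≤ Ka α ρ := integral_nonneg fun _ => by positivity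

theorem ka_shift {α : ℝ} (hα : α < 2) (ρ : ℝ) (t : ℂ) :
    IntegrableOn (fun ζ : ℂ => ‖ζ - t‖ ^ (-α)) (ball (0:ℂ) ρ) ∧
      ∫ ζ in ball (0:ℂ) ρ, ‖ζ - t‖ ^ (-α) ≤ Ka α (ρ + ‖t‖) := by
  have h1 : IntegrableOn (fun ζ : ℂ => ‖ζ - t‖ ^ (-α)) (ball t (ρ + ‖t‖)) := by
    have := (ka_int hα (ρ + ‖t‖))
    rw [← integrable_indicator_iff measurableSet_ball] at this ⊢
    have := this.comp_sub_right t
    refine this.congr (Eventually.of_forall fun x => ?_)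
    simp [indicator, dist_eq_norm]
  have hsub : ball (0:ℂ) ρ ⊆ ball t (ρ + ‖t‖) := by
    intro x hx
    simp only [mem_ball, dist_eq_norm, sub_zero] at *
    linarith [norm_sub_le x t]
  refine ⟨h1.mono_set hsub, (setIntegral_mono_set h1 (Eventually.of_forall fun x => by positivity)
    hsub.eventuallyLE).trans (le_of_eq ?_)⟩
  rw [Ka, ← integral_indicator measurableSet_ball, ← integral_indicator measurableSet_ball]
  symm
  rw [← integral_sub_right_eq_self _ t]
  congr 1; ext x
  simp [indicator, dist_eq_norm]

/-- Basic domination lemma. -/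
theorem kernel_bound [CompleteSpace F] {G : ℂ → F} {κ : ℂ → ℝ} {M ρ : ℝ}
    (hκ : IntegrableOn κ (ball (0:ℂ) ρ)) (hG : AEStronglyMeasurable G volume)
    (hz : ∀ ζ, ρ ≤ ‖ζ‖ → G ζ = 0) (hb : ∀ᵐ ζ : ℂ, ‖ζ‖ < ρ → ‖G ζ‖ ≤ M * κ ζ) :
    Integrable G ∧ ‖∫ ζ, G ζ‖ ≤ M * ∫ ζ in ball (0:ℂ) ρ, κ ζ := by
  have h1 : Integrable ((ball (0:ℂ) ρ).indicator fun ζ => M * κ ζ) :=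
    (integrable_indicator_iff measurableSet_ball).2 (hκ.const_mul M)
  have h2 : ∀ᵐ ζ : ℂ, ‖G ζ‖ ≤ (ball (0:ℂ) ρ).indicator (fun ζ => M * κ ζ) ζ := by
    filter_upwards [hb] with ζ hζ
    by_cases h : ‖ζ‖ < ρ
    · rw [indicator_of_mem (by simpa using h)]; exact hζ h
    · rw [indicator_of_notMem (by simpa using h), hz ζ (not_lt.1 h)]; simp
  refine ⟨h1.mono' hG h2, (norm_integral_le_of_norm_le h1 h2).trans (le_of_eq ?_)⟩
  rw [integral_indicator measurableSet_ball, integral_const_mul]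

theorem meas_inv (t : ℂ) : Measurable fun ζ : ℂ => (ζ - t)⁻¹ :=
  (measurable_id.sub_const t).inv

theorem kernel_one [CompleteSpace F] {Φ : ℂ → F} {M ρ : ℝ} (t : ℂ)
    (hΦ : AEStronglyMeasurable Φ volume)
    (hz : ∀ ζ, ρ ≤ ‖ζ‖ → Φ ζ = 0) (hb : ∀ ζ, ‖Φ ζ‖ ≤ M) :
    Integrable (fun ζ => (ζ - t)⁻¹ • Φ ζ) ∧
      ‖∫ ζ, (ζ - t)⁻¹ • Φ ζ‖ ≤ M * Ka 1 (ρ + ‖t‖) := by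
  have hM : 0 ≤ M := (norm_nonneg _).trans (hb 0)
  obtain ⟨h1, h2⟩ := ka_shift (α := 1) (by norm_num) ρ t
  obtain ⟨h3, h4⟩ := kernel_bound (M := M) (G := fun ζ => (ζ - t)⁻¹ • Φ ζ) h1
    ((meas_inv t).aestronglyMeasurable.smul hΦ)
    (fun ζ hζ => by rw [hz ζ hζ, smul_zero])
    (Eventually.of_forall fun ζ _ => by
      rw [norm_smul, norm_inv, Real.rpow_neg_one, mul_comm]
      exact mul_le_mul_of_nonneg_right (hb ζ) (by positivity))
  exact ⟨h3, h4.trans (mul_le_mul_of_nonneg_left h2 hM)⟩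

theorem kernel_cont_integrable [CompleteSpace F] {Φ : ℂ → F} {ρ : ℝ} (t : ℂ) (hΦ : Continuous Φ)
    (hz : ∀ ζ, ρ ≤ ‖ζ‖ → Φ ζ = 0) : Integrable (fun ζ => (ζ - t)⁻¹ • Φ ζ) := by
  obtain ⟨M, hM⟩ := (HasCompactSupport.intro (isCompact_closedBall (0:ℂ) ρ) (f := Φ) fun x hx =>
    hz x (by simp at hx; exact hx.le)).exists_bound_of_continuous hΦ
  exact (kernel_one t hΦ.aestronglyMeasurable hz hM).1

theorem rpow_three_half {a : ℝ} (ha : 0 < a) : a ^ (-(3/2:ℝ)) = (a * √a)⁻¹ := by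
  rw [Real.rpow_neg ha.le, show (3/2:ℝ) = 1 + 1/2 by norm_num, Real.rpow_add ha, Real.rpow_one,
    ← Real.sqrt_eq_rpow]

theorem kernel_diff (t ζ : ℂ) (h0 : ζ ≠ 0) (ht : ζ - t ≠ 0) :
    ‖(ζ - t)⁻¹ - ζ⁻¹‖ ≤ 2 * √‖t‖ * (‖ζ‖ ^ (-(3/2:ℝ)) + ‖ζ - t‖ ^ (-(3/2:ℝ))) := by
  have e : (ζ - t)⁻¹ - ζ⁻¹ = t * ((ζ - t)⁻¹ * ζ⁻¹) := by field_simp; ring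
  have ha : 0 < ‖ζ‖ := norm_pos_iff.2 h0
  have hb : 0 < ‖ζ - t‖ := norm_pos_iff.2 ht
  have htab : ‖t‖ ≤ ‖ζ‖ + ‖ζ - t‖ := by
    have := norm_sub_le ζ (ζ - t); simpa using this
  rw [e, norm_mul, norm_mul, norm_inv, norm_inv, rpow_three_half ha, rpow_three_half hb]
  generalize ‖ζ‖ = a at *
  generalize ‖ζ - t‖ = b at *
  have hT := norm_nonneg t
  generalize ‖t‖ = T at *
  have key : ∀ a b : ℝ, 0 < a → a ≤ b → T ≤ a + b → T * (b⁻¹ * a⁻¹) ≤ 2 * √T * (a * √a)⁻¹ := by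
    intro a b ha hab hT'
    have hb : 0 < b := ha.trans_le hab
    have h1 : √T ≤ 2 * √b := by
      rw [Real.sqrt_le_left (by positivity)]
      rw [mul_pow, Real.sq_sqrt hb.le]; linarith
    have h2 : √a ≤ √b := Real.sqrt_le_sqrt hab
    have hsa : 0 < √a := Real.sqrt_pos.2 ha
    have hsb : 0 < √b := Real.sqrt_pos.2 hb
    rw [show T * (b⁻¹ * a⁻¹) = √T * (√T / (b * a)) by
      rw [← mul_div_assoc, Real.mul_self_sqrt hT]; field_simp, mul_comm 2, mul_assoc]
    apply mul_le_mul_of_nonneg_left _ (Real.sqrt_nonneg _)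
    rw [← div_eq_mul_inv, div_le_div_iff₀ (by positivity) (by positivity)]
    have hbb : b = √b * √b := (Real.mul_self_sqrt hb.le).symm
    calc √T * (a * √a) ≤ (2 * √b) * (a * √b) := by gcongr
      _ = 2 * (√b * √b * a) := by ring
      _ = 2 * (b * a) := by rw [← hbb]
  have p1 : 0 ≤ 2 * √T * (a * √a)⁻¹ := by positivity
  have p2 : 0 ≤ 2 * √T * (b * √b)⁻¹ := by positivity
  rcases le_total a b with hab | hab
  · have := key a b ha hab htab
    linarith
  · have := key b a hb hab (by linarith)
    rw [mul_comm a⁻¹] at this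
    linarith
end cuts
end PartB

section PartC
open MeasureTheory Metric Filter Topology

section wp
variable {V : Type*} [NormedAddCommGroup V] [NormedSpace ℂ V]
variable {F : Type*} [NormedAddCommGroup F] [NormedSpace ℂ F]

def Phi (u : V → F) (f : V → V → F) (z ξ : V) (ζ : ℂ) : F :=
  db chi0 ζ • u (z + ζ • ξ) + chi0 ζ • f (z + ζ • ξ) ξ

def WP (u : V → F) (f : V → V → F) (a : V) (δ : ℝ) : Prop :=
  ∀ z ∈ ball a δ, ∀ ξ : V, ‖ξ‖ ≤ δ → ∀ t : ℂ, ‖t‖ ≤ 1/4 →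
    u (z + t • ξ) = (-(Real.pi : ℂ)⁻¹) • ∫ ζ, (ζ - t)⁻¹ • Phi u f z ξ ζ

theorem WP.mono {u : V → F} {f a δ δ'} (h : WP u f a δ) (hd : δ' ≤ δ) : WP u f a δ' :=
  fun z hz ξ hξ t ht => h z (ball_subset_ball hd hz) ξ (hξ.trans hd) t ht

theorem mem_two {a z ξ : V} {δ : ℝ} (hz : z ∈ ball a δ) (hξ : ‖ξ‖ ≤ δ) {ζ : ℂ} (hζ : ‖ζ‖ ≤ 1) :
    z + ζ • ξ ∈ ball a (2 * δ) := by
  rw [mem_ball, dist_eq_norm] at *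
  have h1 : ‖ζ • ξ‖ ≤ δ := by
    rw [norm_smul]
    nlinarith [norm_nonneg ζ, norm_nonneg ξ]
  calc ‖z + ζ • ξ - a‖ = ‖(z - a) + ζ • ξ‖ := by congr 1; abel
    _ ≤ ‖z - a‖ + ‖ζ • ξ‖ := norm_add_le _ _
    _ < 2 * δ := by linarith

theorem line_cont (z ξ : V) : Continuous fun ζ : ℂ => z + ζ • ξ := by fun_prop

theorem Phi_cont {u : V → F} {f : V → V → F} {a z ξ : V} {δ : ℝ}
    (hu : ContinuousOn u (ball a (2 * δ)))
    (hf : ∀ ξ, ContinuousOn (fun z => f z ξ) (ball a (2 * δ)))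
    (hz : z ∈ ball a δ) (hξ : ‖ξ‖ ≤ δ) : Continuous (Phi u f z ξ) := by
  have hU : IsOpen ((fun ζ : ℂ => z + ζ • ξ) ⁻¹' ball a (2 * δ)) :=
    isOpen_ball.preimage (line_cont z ξ)
  refine (cut_continuous cut0.dcont cut0.d0 hU (fun ζ h => mem_two hz hξ h) ?_).add
    (cut_continuous cut0.cont cut0.zero hU (fun ζ h => mem_two hz hξ h) ?_)
  · exact hu.comp (line_cont z ξ).continuousOn (fun _ h => h)
  · exact (hf ξ).comp (line_cont z ξ).continuousOn (fun _ h => h)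

theorem Phi_zero (u : V → F) (f : V → V → F) (z ξ : V) (ζ : ℂ) (h : 1 ≤ ‖ζ‖) :
    Phi u f z ξ ζ = 0 := by
  rw [Phi, cut0.d0 ζ h, cut0.zero ζ h]; simp

theorem Phi_le {u : V → F} {f : V → V → F} {a z ξ : V} {δ M0 M1 : ℝ}
    (hu : ∀ z ∈ ball a (2 * δ), ‖u z‖ ≤ M0)
    (hf : ∀ z ∈ ball a (2 * δ), ∀ ξ, ‖f z ξ‖ ≤ M1 * ‖ξ‖)
    (hM0 : 0 ≤ M0) (hM1 : 0 ≤ M1) (hδ : 0 ≤ δ)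
    (hz : z ∈ ball a δ) (hξ : ‖ξ‖ ≤ δ) (ζ : ℂ) : ‖Phi u f z ξ ζ‖ ≤ D0 * M0 + M1 * δ := by
  by_cases h : 1 ≤ ‖ζ‖
  · rw [Phi_zero u f z ξ ζ h, norm_zero]; have := D0_nonneg; positivity
  · have hm := mem_two hz hξ (not_le.1 h).le
    refine (norm_add_le _ _).trans ?_
    rw [norm_smul, norm_smul]
    have h1 := cut0.dle ζ
    have h2 := cut0.le ζ
    have h3 := (hf _ hm ξ).trans (mul_le_mul_of_nonneg_left hξ hM1)
    have h4 := hu _ hm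
    have := D0_nonneg
    have := mul_le_mul h1 h4 (norm_nonneg _) this
    have := mul_le_mul h2 h3 (norm_nonneg _) zero_le_one
    linarith

theorem dir_ex {k : V} {δ : ℝ} (hδ : 0 < δ) (hk : ‖k‖ ≤ δ / 4) :
    ∃ (t : ℝ) (ξ : V), 0 ≤ t ∧ t ≤ 1/4 ∧ ‖ξ‖ ≤ δ ∧ (t : ℂ) • ξ = k ∧ t = ‖k‖ / δ := by
  by_cases h : k = 0
  · exact ⟨0, 0, le_rfl, by norm_num, by simpa using hδ.le, by simp [h], by simp [h]⟩
  · have hk0 : 0 < ‖k‖ := norm_pos_iff.2 h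
    refine ⟨‖k‖ / δ, ((δ / ‖k‖ : ℝ) : ℂ) • k, by positivity, by rw [div_le_iff₀ hδ]; linarith, ?_, ?_,
      rfl⟩
    · rw [norm_smul, Complex.norm_real, Real.norm_of_nonneg (by positivity)]
      rw [div_mul_cancel₀ _ hk0.ne']
    · rw [smul_smul, ← Complex.ofReal_mul, div_mul_div_comm, mul_comm, div_self (by positivity)]
      simp

/-- the Hölder constant -/
def CH : ℝ := Real.pi⁻¹ * (2 * (Ka (3/2) 1 + Ka (3/2) 2))

theorem CH_nonneg : 0 ≤ CH := by
  have := ka_nonneg (3/2) 1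
  have := ka_nonneg (3/2) 2
  have := Real.pi_pos
  unfold CH; positivity

theorem ka_mono {α ρ ρ' : ℝ} (hα : α < 2) (h : ρ ≤ ρ') : Ka α ρ ≤ Ka α ρ' :=
  setIntegral_mono_set (ka_int hα ρ') (Eventually.of_forall fun x => by positivity)
    (ball_subset_ball h).eventuallyLE

theorem ae_ne (t : ℂ) : ∀ᵐ ζ : ℂ, ζ - t ≠ 0 := by
  have : ∀ᵐ ζ : ℂ, ζ ≠ t := by simp [ae_iff]
  filter_upwards [this] with ζ h
  exact sub_ne_zero.2 h

variable [CompleteSpace F]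

theorem wp_holder {u : V → F} {f : V → V → F} {a : V} {δ M0 M1 : ℝ} (hδ : 0 < δ)
    (hw : WP u f a δ) (hu : ContinuousOn u (ball a (2 * δ)))
    (hf : ∀ ξ, ContinuousOn (fun z => f z ξ) (ball a (2 * δ)))
    (hM0 : 0 ≤ M0) (hM1 : 0 ≤ M1)
    (hub : ∀ z ∈ ball a (2 * δ), ‖u z‖ ≤ M0)
    (hfb : ∀ z ∈ ball a (2 * δ), ∀ ξ, ‖f z ξ‖ ≤ M1 * ‖ξ‖)
    {z : V} (hz : z ∈ ball a δ) {k : V} (hk : ‖k‖ ≤ δ / 4) :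
    ‖u (z + k) - u z‖ ≤ CH * (D0 * M0 + M1 * δ) * √(‖k‖ / δ) := by
  obtain ⟨t, ξ, ht0, ht1, hξ, htk, hteq⟩ := dir_ex hδ hk
  have hnt : ‖(t:ℂ)‖ = t := by rw [Complex.norm_real, Real.norm_of_nonneg ht0]
  have e1 := hw z hz ξ hξ t (by rw [hnt]; exact ht1)
  have e2 := hw z hz ξ hξ 0 (by norm_num)
  rw [zero_smul, add_zero] at e2
  have hPc := Phi_cont hu hf hz hξ
  have i1 := kernel_cont_integrable (t:ℂ) hPc (Phi_zero u f z ξ)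
  have i2 := kernel_cont_integrable 0 hPc (Phi_zero u f z ξ)
  rw [← htk, e1, e2, ← smul_sub, ← integral_sub i1 i2, norm_smul]
  have hM : 0 ≤ D0 * M0 + M1 * δ := by have := D0_nonneg; positivity
  obtain ⟨hi, hle⟩ := ka_shift (α := 3/2) (by norm_num) 1 (t:ℂ)
  have hi0 := ka_int (α := 3/2) (by norm_num) 1
  have kb := (kernel_bound (F := F) (M := (D0 * M0 + M1 * δ) * (2 * √t)) (ρ := 1)
    (G := fun ζ => (ζ - (t:ℂ))⁻¹ • Phi u f z ξ ζ - (ζ - 0)⁻¹ • Phi u f z ξ ζ)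
    (hi0.add hi) (i1.sub i2).1 (fun ζ hζ => by rw [Phi_zero u f z ξ ζ hζ]; simp) (by
      filter_upwards [ae_ne 0, ae_ne (t:ℂ)] with ζ h0 h1 _
      rw [← sub_smul, norm_smul, sub_zero]
      rw [sub_zero] at h0
      have := kernel_diff (t:ℂ) ζ h0 h1
      rw [hnt] at this
      refine (mul_le_mul this (Phi_le hub hfb hM0 hM1 hδ.le hz hξ ζ) (norm_nonneg _)
        (by positivity)).trans (le_of_eq ?_)
      simp only [Pi.add_apply]; ring)).2
  simp only [Pi.add_apply] at kb
  rw [integral_add hi0 hi] at kb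
  have hnp : ‖-(Real.pi:ℂ)⁻¹‖ = Real.pi⁻¹ := by
    rw [norm_neg, norm_inv, Complex.norm_real, Real.norm_of_nonneg Real.pi_pos.le]
  rw [hnp, htk, ← hteq]
  have hK2 : ∫ ζ in ball (0:ℂ) 1, ‖ζ - (t:ℂ)‖ ^ (-(3/2:ℝ)) ≤ Ka (3/2) 2 :=
    hle.trans (ka_mono (by norm_num) (by rw [hnt]; linarith))
  have hpi := Real.pi_pos
  calc _ ≤ Real.pi⁻¹ * ((D0 * M0 + M1 * δ) * (2 * √t) * (Ka (3/2) 1 + Ka (3/2) 2)) := by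
        apply mul_le_mul_of_nonneg_left _ (by positivity)
        refine kb.trans ?_
        apply mul_le_mul_of_nonneg_left _ (by positivity)
        rw [Ka]; exact add_le_add le_rfl hK2
    _ = _ := by rw [CH]; ring

/-- Lipschitz estimate -/
theorem wp_lip {u : V → F} {f : V → V → F} {a : V} {δ M0 M1 L : ℝ} (hδ : 0 < δ)
    (hw : WP u f a δ) (hu : ContinuousOn u (ball a (2 * δ)))
    (hM0 : 0 ≤ M0) (hM1 : 0 ≤ M1) (hL : 0 ≤ L)
    (hub : ∀ z ∈ ball a (2 * δ), ‖u z‖ ≤ M0)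
    (hfb : ∀ z ∈ ball a (2 * δ), ∀ ξ, ‖f z ξ‖ ≤ M1 * ‖ξ‖)
    (hfl : ∀ z ∈ ball a (2 * δ), ∀ w ∈ ball a (2 * δ), ∀ ξ, ‖f z ξ - f w ξ‖ ≤ L * ‖z - w‖ * ‖ξ‖) :
    ∃ C, 0 ≤ C ∧ ∀ z ∈ ball a δ, ∀ k, ‖k‖ ≤ δ / 4 → ‖u (z + k) - u z‖ ≤ C * ‖k‖ := by
  obtain ⟨K, hK⟩ : ∃ K, LipschitzWith K chi0 := cut0.smooth.lipschitzWith_of_hasCompactSupport cut0.compact (by norm_num)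
  have hf : ∀ ξ, ContinuousOn (fun z => f z ξ) (ball a (2 * δ)) := by
    intro ξ
    refine LipschitzOnWith.continuousOn (K := (L * ‖ξ‖).toNNReal) ?_
    refine LipschitzOnWith.of_dist_le_mul fun x hx y hy => ?_
    rw [dist_eq_norm, dist_eq_norm, Real.coe_toNNReal _ (by positivity)]
    exact (hfl x hx y hy ξ).trans (le_of_eq (by ring))
  set N : ℝ := K * (M1 * δ) + L * δ * δ with hN
  set C1 : ℝ := Real.pi⁻¹ * (8 * D0 * M0 * Ka 0 1 + N * Ka 1 2)
  have hD := D0_nonneg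
  have hpi := Real.pi_pos
  have hk0 := ka_nonneg 0 1
  have hk1 := ka_nonneg 1 2
  have hN0 : 0 ≤ N := by positivity
  refine ⟨C1 / δ, by positivity, fun z hz k hk => ?_⟩
  obtain ⟨t, ξ, ht0, ht1, hξ, htk, hteq⟩ := dir_ex hδ hk
  have hnt : ‖(t:ℂ)‖ = t := by rw [Complex.norm_real, Real.norm_of_nonneg ht0]
  have e1 := hw z hz ξ hξ t (by rw [hnt]; exact ht1)
  have e2 := hw z hz ξ hξ 0 (by norm_num)
  rw [zero_smul, add_zero] at e2
  set Φ1 : ℂ → F := fun ζ => db chi0 ζ • u (z + ζ • ξ)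
  set Φ2 : ℂ → F := fun ζ => chi0 ζ • f (z + ζ • ξ) ξ
  have hU : IsOpen ((fun ζ : ℂ => z + ζ • ξ) ⁻¹' ball a (2 * δ)) :=
    isOpen_ball.preimage (line_cont z ξ)
  have c1 : Continuous Φ1 := cut_continuous cut0.dcont cut0.d0 hU (fun ζ h => mem_two hz hξ h)
    (hu.comp (line_cont z ξ).continuousOn (fun _ h => h))
  have c2 : Continuous Φ2 := cut_continuous cut0.cont cut0.zero hU (fun ζ h => mem_two hz hξ h)
    ((hf ξ).comp (line_cont z ξ).continuousOn (fun _ h => h))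
  have z1 : ∀ ζ, 1 ≤ ‖ζ‖ → Φ1 ζ = 0 := fun ζ h => by simp only [Φ1]; rw [cut0.d0 ζ h, zero_smul]
  have z2 : ∀ ζ, 1 ≤ ‖ζ‖ → Φ2 ζ = 0 := fun ζ h => by simp only [Φ2]; rw [cut0.zero ζ h, zero_smul]
  have hfbd : ∀ ζ : ℂ, ‖ζ‖ ≤ 1 → ‖f (z + ζ • ξ) ξ‖ ≤ M1 * δ := fun ζ h =>
    (hfb _ (mem_two hz hξ h) ξ).trans (mul_le_mul_of_nonneg_left hξ hM1)
  have hχ : ∀ ζ w : ℂ, ‖chi0 ζ - chi0 w‖ ≤ K * ‖ζ - w‖ := fun ζ w => by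
    have := hK.dist_le_mul ζ w; rwa [dist_eq_norm, dist_eq_norm] at this
  have lip1 : ∀ ζ w : ℂ, ‖ζ‖ ≤ 1 → ‖Φ2 ζ - Φ2 w‖ ≤ N * ‖ζ - w‖ := by
    intro ζ w hζ
    by_cases hw1 : ‖w‖ ≤ 1
    · have e : Φ2 ζ - Φ2 w = (chi0 ζ - chi0 w) • f (z + ζ • ξ) ξ +
          chi0 w • (f (z + ζ • ξ) ξ - f (z + w • ξ) ξ) := by
        simp only [Φ2, sub_smul, smul_sub]; abel
      rw [e]
      refine (norm_add_le _ _).trans ?_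
      rw [norm_smul, norm_smul]
      have h1 := mul_le_mul (hχ ζ w) (hfbd ζ hζ) (norm_nonneg _) (by positivity)
      have h2 := hfl _ (mem_two hz hξ hζ) _ (mem_two hz hξ hw1) ξ
      rw [add_sub_add_left_eq_sub, ← sub_smul, norm_smul] at h2
      have h3 : L * (‖ζ - w‖ * ‖ξ‖) * ‖ξ‖ ≤ L * (‖ζ - w‖ * δ) * δ := by gcongr
      have h4 := mul_le_mul (cut0.le w) (h2.trans h3) (norm_nonneg _) zero_le_one
      rw [hN]
      linarith
    · have : Φ2 w = 0 := z2 w (not_le.1 hw1).le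
      rw [this, sub_zero]
      simp only [Φ2]
      rw [norm_smul]
      have h0 : chi0 w = 0 := cut0.zero w (not_le.1 hw1).le
      have h1 := hχ ζ w
      rw [h0, sub_zero] at h1
      have h1 := mul_le_mul h1 (hfbd ζ hζ) (norm_nonneg _) (by positivity)
      rw [hN]
      have : 0 ≤ L * δ * δ * ‖ζ - w‖ := by positivity
      linarith
  have lip : ∀ ζ w : ℂ, ‖Φ2 ζ - Φ2 w‖ ≤ N * ‖ζ - w‖ := by
    intro ζ w
    by_cases hζ : ‖ζ‖ ≤ 1
    · exact lip1 ζ w hζ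
    · by_cases hw1 : ‖w‖ ≤ 1
      · rw [norm_sub_rev, norm_sub_rev ζ]; exact lip1 w ζ hw1
      · rw [z2 ζ (not_le.1 hζ).le, z2 w (not_le.1 hw1).le, sub_self, norm_zero]; positivity
  have hs : ∀ s : ℂ, ∫ ζ, (ζ - s)⁻¹ • Phi u f z ξ ζ =
      (∫ ζ, (ζ - s)⁻¹ • Φ1 ζ) + ∫ ζ, (ζ)⁻¹ • Φ2 (ζ + s) := by
    intro s
    have : ∫ ζ, (ζ)⁻¹ • Φ2 (ζ + s) = ∫ ζ, (ζ - s)⁻¹ • Φ2 ζ := by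
      rw [← integral_add_right_eq_self (fun ζ => (ζ - s)⁻¹ • Φ2 ζ) s]
      simp
    rw [this, ← integral_add (kernel_cont_integrable s c1 z1) (kernel_cont_integrable s c2 z2)]
    congr 1; ext ζ; rw [← smul_add]; rfl
  have i1 := kernel_cont_integrable (t:ℂ) c1 z1
  have i2 := kernel_cont_integrable 0 c1 z1
  have z2' : ∀ ζ : ℂ, 2 ≤ ‖ζ‖ → Φ2 (ζ + t) = 0 := fun ζ h => z2 _ (by
    have := norm_sub_le (ζ + t) t; rw [add_sub_cancel_right, hnt] at this; linarith)
  have i3 : Integrable fun ζ : ℂ => ζ⁻¹ • Φ2 (ζ + t) := by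
    have := kernel_cont_integrable (ρ := 2) 0 (c2.comp (continuous_add_const (t:ℂ))) z2'
    simpa using this
  have i4 : Integrable fun ζ : ℂ => ζ⁻¹ • Φ2 (ζ + 0) := by
    have := kernel_cont_integrable (ρ := 1) 0 c2 z2
    simpa using this
  rw [← htk, e1, e2, hs, hs, ← smul_sub, norm_smul, add_sub_add_comm, ← integral_sub i1 i2,
    ← integral_sub i3 i4]
  have hnp : ‖-(Real.pi:ℂ)⁻¹‖ = Real.pi⁻¹ := by
    rw [norm_neg, norm_inv, Complex.norm_real, Real.norm_of_nonneg Real.pi_pos.le]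
  have b1 := (kernel_bound (F := F) (M := D0 * M0 * (8 * t)) (ρ := 1)
    (ka_int (α := 0) (by norm_num) 1) (i1.sub i2).1
    (fun ζ hζ => by simp only [Pi.sub_apply]; rw [z1 ζ hζ]; simp) (by
      refine Eventually.of_forall fun ζ hζ1 => ?_
      simp only [Pi.sub_apply]
      rw [neg_zero, Real.rpow_zero, mul_one, ← sub_smul, norm_smul, sub_zero]
      by_cases h : ‖ζ‖ ≤ 1/2
      · simp only [Φ1]; rw [cut0.d1 ζ h, zero_smul, norm_zero, mul_zero]; positivity
      · push Not at h
        have h1 : ‖Φ1 ζ‖ ≤ D0 * M0 := by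
          simp only [Φ1]; rw [norm_smul]
          exact mul_le_mul (cut0.dle ζ) (hub _ (mem_two hz hξ hζ1.le)) (norm_nonneg _) hD
        have h2 : 1/4 ≤ ‖ζ - t‖ := by
          have := norm_sub_norm_le ζ t; rw [hnt] at this; linarith
        have hz0 : ζ ≠ 0 := norm_pos_iff.1 (by linarith)
        have hz1 : ζ - t ≠ 0 := norm_pos_iff.1 (by linarith)
        have h3 : ‖(ζ - (t:ℂ))⁻¹ - ζ⁻¹‖ ≤ 8 * t := by
          have e : (ζ - (t:ℂ))⁻¹ - ζ⁻¹ = t * ((ζ - t)⁻¹ * ζ⁻¹) := by field_simp; ring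
          rw [e, norm_mul, norm_mul, norm_inv, norm_inv, hnt, mul_comm]
          have : ‖ζ - t‖⁻¹ ≤ 4 := by rw [inv_le_comm₀ (by linarith) (by norm_num)]; linarith
          have : ‖ζ‖⁻¹ ≤ 2 := by rw [inv_le_comm₀ (by linarith) (by norm_num)]; linarith
          have : ‖ζ - t‖⁻¹ * ‖ζ‖⁻¹ ≤ 4 * 2 := by gcongr
          nlinarith
        rw [mul_comm]
        exact mul_le_mul h1 h3 (norm_nonneg _) (by positivity))).2
  have b2 := (kernel_bound (F := F) (M := N * t) (ρ := 2)
    (ka_int (α := 1) (by norm_num) 2) (i3.sub i4).1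
    (fun ζ hζ => by simp only [Pi.sub_apply]; rw [z2' ζ hζ, add_zero, z2 ζ (by linarith)]; simp) (by
      refine Eventually.of_forall fun ζ _ => ?_
      simp only [Pi.sub_apply]
      rw [← smul_sub, norm_smul, norm_inv, Real.rpow_neg_one, mul_comm]
      apply mul_le_mul_of_nonneg_right _ (by positivity)
      have := lip (ζ + t) (ζ + 0)
      rwa [add_sub_add_left_eq_sub, sub_zero, hnt] at this)).2
  rw [hnp]
  refine (mul_le_mul_of_nonneg_left ((norm_add_le _ _).trans (add_le_add b1 b2)) (by positivity)).trans ?_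
  have : C1 / δ * ‖k‖ = C1 * t := by rw [hteq]; ring
  rw [htk, this]
  apply le_of_eq
  simp only [C1, Ka]; ring
end wp
end PartC

section PartD
open MeasureTheory Metric Filter Topology

section rl
variable {V : Type*} [NormedAddCommGroup V] [NormedSpace ℝ V]
variable {F : Type*} [NormedAddCommGroup F] [NormedSpace ℝ F] [CompleteSpace F]

theorem half_pow_tendsto (c : ℝ) : Tendsto (fun n : ℕ => ((1/2:ℝ)^n) * c) atTop (𝓝 0) := by
  have := (tendsto_pow_atTop_nhds_zero_of_lt_one (r := (1/2:ℝ)) (by norm_num) (by norm_num)).mul_const c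
  simpa using this

theorem small_ev {η : ℝ} (hη : 0 < η) (h : V) : ∀ᶠ n : ℕ in atTop, ‖((1/2:ℝ)^n) • h‖ ≤ η := by
  filter_upwards [(half_pow_tendsto ‖h‖).eventually (gt_mem_nhds hη)] with n hn
  rw [norm_smul, Real.norm_of_nonneg (by positivity)]; exact le_of_lt hn

/-- second differences estimate implies `C¹`. -/
theorem rl {u : V → F} {a : V} {r η C L : ℝ} (hη : 0 < η) (hC : 0 ≤ C)
    (hL : ∀ z ∈ ball a r, ∀ h : V, ‖h‖ ≤ η → ‖u (z + h) - u z‖ ≤ L * ‖h‖)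
    (h2 : ∀ z ∈ ball a r, ∀ h k : V, ‖h‖ ≤ η → ‖k‖ ≤ η →
      ‖u (z + k + h) - u (z + k) - (u (z + h) - u z)‖ ≤ C * ‖h‖ * √‖k‖) :
    ContDiffOn ℝ 1 u (ball a r) := by
  set A : V → V → ℕ → F := fun z h n => (2:ℝ)^n • (u (z + ((1/2:ℝ)^n) • h) - u z) with hA
  set q : ℝ := √(1/2) with hq
  have hq0 : 0 ≤ q := Real.sqrt_nonneg _
  have hq1 : q < 1 := by rw [hq, Real.sqrt_lt' one_pos]; norm_num
  have hpow : ∀ n : ℕ, (2:ℝ)^n * (1/2)^n = 1 := fun n => by rw [← mul_pow]; norm_num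
  have hpos : ∀ n : ℕ, (0:ℝ) < 2^n := fun n => by positivity
  have step : ∀ z ∈ ball a r, ∀ h : V, ‖h‖ ≤ η → ∀ n,
      dist (A z h n) (A z h (n+1)) ≤ (C * (‖h‖ * √‖h‖)) * q^n := by
    intro z hz h hh n
    set k : V := ((1/2:ℝ)^(n+1)) • h with hk
    have hkn : ‖k‖ = (1/2)^(n+1) * ‖h‖ := by
      rw [hk, norm_smul, Real.norm_of_nonneg (by positivity)]
    have hp1 : ((1/2:ℝ))^(n+1) ≤ 1 := pow_le_one₀ (by norm_num) (by norm_num)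
    have hkη : ‖k‖ ≤ η := by rw [hkn]; nlinarith [norm_nonneg h]
    have e : ((1/2:ℝ)^n) • h = k + k := by
      rw [hk, ← add_smul, pow_succ]; congr 1; ring
    have hd : A z h n - A z h (n+1) = (2:ℝ)^n • (u (z + k + k) - u (z + k) - (u (z + k) - u z)) := by
      simp only [hA]
      rw [e, ← hk, pow_succ (2:ℝ) n, mul_comm ((2:ℝ)^n) 2, mul_smul, two_smul,
        ← smul_add ((2:ℝ)^n) (u (z + k) - u z), ← smul_sub, ← add_assoc]
      congr 1; abel
    rw [dist_eq_norm, hd, norm_smul, Real.norm_of_nonneg (hpos n).le]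
    have h3 := h2 z hz k k hkη hkη
    have h4 : √‖k‖ ≤ q^n * √‖h‖ := by
      rw [hkn, Real.sqrt_mul (by positivity), pow_succ, Real.sqrt_mul (by positivity), hq]
      have : √((1/2:ℝ)^n) = √(1/2)^n := by
        rw [Real.sqrt_eq_iff_mul_self_eq (by positivity) (by positivity), ← mul_pow]
        rw [Real.mul_self_sqrt (by norm_num)]
      rw [this]
      apply mul_le_mul_of_nonneg_right _ (Real.sqrt_nonneg _)
      apply mul_le_of_le_one_right (by positivity) hq1.le
    calc (2:ℝ)^n * _ ≤ 2^n * (C * ‖k‖ * (q^n * √‖h‖)) := by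
          apply mul_le_mul_of_nonneg_left _ (hpos n).le
          exact h3.trans (mul_le_mul_of_nonneg_left h4 (by positivity))
      _ = (2^n * (1/2)^n) * (1/2) * (C * (‖h‖ * √‖h‖) * q^n) := by rw [hkn, pow_succ]; ring
      _ ≤ _ := by
          rw [hpow]
          have : 0 ≤ C * (‖h‖ * √‖h‖) * q^n := by positivity
          linarith
  have lim1 : ∀ z ∈ ball a r, ∀ h : V, ‖h‖ ≤ η → ∃ l, Tendsto (A z h) atTop (𝓝 l) := by
    intro z hz h hh
    exact cauchySeq_tendsto_of_complete (cauchySeq_of_le_geometric q _ hq1 (step z hz h hh))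
  have lim : ∀ z ∈ ball a r, ∀ h : V, ∃ l, Tendsto (A z h) atTop (𝓝 l) := by
    intro z hz h
    obtain ⟨N, hN⟩ := (small_ev hη h).exists
    obtain ⟨l, hl⟩ := lim1 z hz _ hN
    refine ⟨(2:ℝ)^N • l, ?_⟩
    rw [← tendsto_add_atTop_iff_nat N]
    refine (hl.const_smul ((2:ℝ)^N)).congr fun n => ?_
    simp only [hA]
    rw [smul_smul, smul_smul, ← pow_add, ← pow_add, add_comm N]
  choose! D hD using lim
  have hDle : ∀ z ∈ ball a r, ∀ h, ‖D z h‖ ≤ L * ‖h‖ := by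
    intro z hz h
    refine le_of_tendsto (hD z hz h).norm ?_
    filter_upwards [small_ev hη h] with n hn
    simp only [hA]
    rw [norm_smul, Real.norm_of_nonneg (hpos n).le]
    refine (mul_le_mul_of_nonneg_left (hL z hz _ hn) (hpos n).le).trans (le_of_eq ?_)
    rw [norm_smul, Real.norm_of_nonneg (by positivity)]
    linear_combination (L*‖h‖) * hpow n
  have hDadd : ∀ z ∈ ball a r, ∀ h k, D z (h + k) = D z h + D z k := by
    intro z hz h k
    have t1 := (hD z hz (h + k)).sub ((hD z hz h).add (hD z hz k))
    have t2 : Tendsto (fun n => A z (h + k) n - (A z h n + A z k n)) atTop (𝓝 0) := by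
      have hb : Tendsto (fun n : ℕ => C * ‖h‖ * √((1/2)^n * ‖k‖)) atTop (𝓝 0) := by
        have := ((half_pow_tendsto ‖k‖).sqrt).const_mul (C * ‖h‖)
        simpa using this
      refine squeeze_zero_norm' ?_ hb
      filter_upwards [small_ev hη h, small_ev hη k] with n hn hm
      have e : A z (h + k) n - (A z h n + A z k n) = (2:ℝ)^n • (u (z + ((1/2:ℝ)^n) • k + ((1/2:ℝ)^n) • h)
          - u (z + ((1/2:ℝ)^n) • k) - (u (z + ((1/2:ℝ)^n) • h) - u z)) := by
        simp only [hA]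
        rw [← smul_add, ← smul_sub, smul_add, add_comm (((1/2:ℝ)^n) • h), add_assoc z]
        congr 1; abel
      rw [e, norm_smul, Real.norm_of_nonneg (hpos n).le]
      refine (mul_le_mul_of_nonneg_left (h2 z hz _ _ hn hm) (hpos n).le).trans (le_of_eq ?_)
      rw [norm_smul, norm_smul, Real.norm_of_nonneg (by positivity)]
      linear_combination (C*‖h‖*√((1/2)^n*‖k‖)) * hpow n
    have := tendsto_nhds_unique t1 t2
    exact sub_eq_zero.1 this
  have hDlin : ∀ z ∈ ball a r, ∃ T : V →L[ℝ] F, ∀ h, T h = D z h := by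
    intro z hz
    let g : V →+ F := AddMonoidHom.mk' (D z) (hDadd z hz)
    have hg : Continuous g := by
      refine AddMonoidHomClass.continuous_of_bound g L (hDle z hz)
    exact ⟨g.toRealLinearMap hg, fun h => rfl⟩
  choose! T hT using hDlin
  have hderiv : ∀ z ∈ ball a r, HasFDerivAt u (T z) z := by
    intro z hz
    rw [hasFDerivAt_iff_isLittleO_nhds_zero]
    have hO : (fun h => u (z + h) - u z - T z h) =O[𝓝 0] fun h : V => √‖h‖ * ‖h‖ := by
      apply Asymptotics.IsBigO.of_bound (C * (1 - q)⁻¹)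
      filter_upwards [closedBall_mem_nhds (0:V) hη] with h hh
      have hh : ‖h‖ ≤ η := by simpa using hh
      have := dist_le_of_le_geometric_of_tendsto₀ q _ hq1 (step z hz h hh) (hD z hz h)
      rw [dist_eq_norm] at this
      simp only [hA, pow_zero, one_smul] at this
      rw [hT z hz, Real.norm_of_nonneg (by positivity)]
      refine this.trans (le_of_eq ?_)
      rw [div_eq_mul_inv]; ring
    refine hO.trans_isLittleO ?_
    have h1 : (fun h : V => √‖h‖) =o[𝓝 0] fun _ => (1:ℝ) := by
      rw [Asymptotics.isLittleO_one_iff]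
      have : Continuous fun h : V => √‖h‖ := by fun_prop
      simpa using this.tendsto 0
    have := h1.mul_isBigO (Asymptotics.isBigO_refl (fun h : V => ‖h‖) (𝓝 0))
    simp only [one_mul] at this
    exact this.trans_isBigO (Asymptotics.isBigO_norm_left.2 (Asymptotics.isBigO_refl _ _))
  have hcont : ContinuousOn T (ball a r) := by
    intro z hz
    refine ContinuousAt.continuousWithinAt ?_
    rw [ContinuousAt, tendsto_iff_norm_sub_tendsto_zero]
    have hb : Tendsto (fun w : V => C * √‖w - z‖) (𝓝 z) (𝓝 0) := by
      have : Continuous fun w : V => C * √‖w - z‖ := by fun_prop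
      simpa using this.tendsto z
    refine squeeze_zero' (Eventually.of_forall fun _ => norm_nonneg _) ?_ hb
    filter_upwards [isOpen_ball.mem_nhds hz, closedBall_mem_nhds z hη] with w hw hwz
    refine ContinuousLinearMap.opNorm_le_bound _ (by positivity) fun h => ?_
    rw [sub_apply, hT z hz, hT w hw]
    refine le_of_tendsto ((hD w hw h).sub (hD z hz h)).norm ?_
    filter_upwards [small_ev hη h] with n hn
    simp only [hA]
    rw [← smul_sub, norm_smul, Real.norm_of_nonneg (hpos n).le]
    have := h2 z hz _ (w - z) hn (by rw [← dist_eq_norm]; exact hwz)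
    rw [add_sub_cancel] at this
    refine (mul_le_mul_of_nonneg_left this (hpos n).le).trans (le_of_eq ?_)
    rw [norm_smul, Real.norm_of_nonneg (by positivity)]
    linear_combination (C*√‖w - z‖*‖h‖) * hpow n
  have h0 : ContDiffOn ℝ (0 + 1) u (ball a r) := by
    rw [contDiffOn_succ_iff_fderiv_of_isOpen isOpen_ball]
    refine ⟨fun z hz => (hderiv z hz).differentiableAt.differentiableWithinAt, by simp, ?_⟩
    rw [contDiffOn_zero]
    exact hcont.congr fun z hz => (hderiv z hz).fderiv
  simpa using h0
end rl

section reg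
variable {V : Type*} [NormedAddCommGroup V] [NormedSpace ℂ V]

/-- the local data needed for regularity -/
theorem reg_one {F : Type*} [NormedAddCommGroup F] [NormedSpace ℂ F] [CompleteSpace F]
    {u : V → F} {f : V → V → F} {a : V} {δ M0 M1 L : ℝ} (hδ : 0 < δ)
    (hw : WP u f a δ) (hu : ContinuousOn u (ball a (2 * δ)))
    (hM0 : 0 ≤ M0) (hM1 : 0 ≤ M1) (hL : 0 ≤ L)
    (hub : ∀ z ∈ ball a (2 * δ), ‖u z‖ ≤ M0)
    (hfb : ∀ z ∈ ball a (2 * δ), ∀ ξ, ‖f z ξ‖ ≤ M1 * ‖ξ‖)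
    (hfl : ∀ z ∈ ball a (2 * δ), ∀ w ∈ ball a (2 * δ), ∀ ξ, ‖f z ξ - f w ξ‖ ≤ L * ‖z - w‖ * ‖ξ‖) :
    ContDiffOn ℝ 1 u (ball a (δ / 2)) := by
  obtain ⟨C, hC, hlip⟩ := wp_lip hδ hw hu hM0 hM1 hL hub hfb hfl
  have hf : ∀ ξ, ContinuousOn (fun z => f z ξ) (ball a (2 * δ)) := by
    intro ξ
    refine LipschitzOnWith.continuousOn (K := (L * ‖ξ‖).toNNReal) ?_
    refine LipschitzOnWith.of_dist_le_mul fun x hx y hy => ?_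
    rw [dist_eq_norm, dist_eq_norm, Real.coe_toNNReal _ (by positivity)]
    exact (hfl x hx y hy ξ).trans (le_of_eq (by ring))
  have hD := D0_nonneg
  have hCH := CH_nonneg
  refine rl (η := δ / 8) (L := C) (C := CH * (D0 * C + L * (δ/2)) * (√(δ/2))⁻¹) (by positivity)
    (by positivity) ?_ ?_
  · intro z hz h hh
    exact hlip z (ball_subset_ball (by linarith) hz) h (by linarith)
  · intro z hz h k hh hk
    have hsh : ∀ z ∈ ball a δ, z + h ∈ ball a (2 * δ) := by
      intro z hz
      rw [mem_ball, dist_eq_norm] at *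
      calc ‖z + h - a‖ = ‖(z - a) + h‖ := by congr 1; abel
        _ ≤ ‖z - a‖ + ‖h‖ := norm_add_le _ _
        _ < 2 * δ := by linarith
    have hsub : ball a δ ⊆ ball a (2 * δ) := ball_subset_ball (by linarith)
    have e2 : 2 * (δ / 2) = δ := by ring
    have hcu : ContinuousOn (fun z => u (z + h) - u z) (ball a (2 * (δ/2))) := by
      rw [e2]
      exact (hu.comp (continuous_add_const h).continuousOn hsh).sub (hu.mono hsub)
    have hcf : ∀ ξ, ContinuousOn (fun z => f (z + h) ξ - f z ξ) (ball a (2 * (δ/2))) := by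
      rw [e2]
      intro ξ
      exact ((hf ξ).comp (continuous_add_const h).continuousOn hsh).sub ((hf ξ).mono hsub)
    have wph : WP (fun z => u (z + h) - u z) (fun z ξ => f (z + h) ξ - f z ξ) a (δ / 2) := by
      intro y hy ξ hξ t ht
      have hy1 : y ∈ ball a δ := ball_subset_ball (by linarith) hy
      have hy2 : y + h ∈ ball a δ := by
        rw [mem_ball, dist_eq_norm] at *
        calc ‖y + h - a‖ = ‖(y - a) + h‖ := by congr 1; abel
          _ ≤ ‖y - a‖ + ‖h‖ := norm_add_le _ _
          _ < δ := by linarith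
      have hξ' : ‖ξ‖ ≤ δ := by linarith
      have a1 := hw y hy1 ξ hξ' t ht
      have a2 := hw (y + h) hy2 ξ hξ' t ht
      simp only
      rw [show y + t • ξ + h = y + h + t • ξ by abel, a1, a2, ← smul_sub, ← integral_sub
        (kernel_cont_integrable t (Phi_cont hu hf hy2 hξ') (Phi_zero u f _ ξ))
        (kernel_cont_integrable t (Phi_cont hu hf hy1 hξ') (Phi_zero u f _ ξ))]
      congr 2; ext ζ
      rw [← smul_sub]; congr 1
      simp only [Phi, smul_sub]
      rw [show y + ζ • ξ + h = y + h + ζ • ξ by abel]; abel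
    have := wp_holder (M0 := C * ‖h‖) (M1 := L * ‖h‖) (k := k) (by positivity : 0 < δ/2) wph hcu hcf
      (by positivity) (by positivity)
      (by rw [e2]; exact fun z hz => hlip z hz h (by linarith))
      (by
        rw [e2]; intro z hz ξ
        have := hfl (z + h) (hsh z hz) z (hsub hz) ξ
        rwa [add_sub_cancel_left] at this) hz (by linarith)
    refine this.trans (le_of_eq ?_)
    rw [Real.sqrt_div' _ (by positivity)]
    ring
end reg
end PartD

section PartE
open MeasureTheory Metric Filter Topology

section jf
variable {V : Type} [NormedAddCommGroup V] [NormedSpace ℂ V]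

structure JF {F : Type} [NormedAddCommGroup F] [NormedSpace ℂ F] (n : ℕ) (Ω : Set V)
    (f : V → V → F) : Prop where
  add : ∀ z ∈ Ω, ∀ ξ η, f z (ξ + η) = f z ξ + f z η
  smul : ∀ z ∈ Ω, ∀ (c : ℝ) (ξ : V), f z (c • ξ) = c • f z ξ
  smooth : ContDiffOn ℝ n (fun p : V × V => f p.1 p.2) (Ω ×ˢ (univ : Set V))

section F
variable {F : Type} [NormedAddCommGroup F] [NormedSpace ℂ F] {Ω : Set V} {f : V → V → F} {n : ℕ}

theorem JF.bound (hΩ : IsOpen Ω) (h : JF n Ω f) {a : V} (ha : a ∈ Ω) :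
    ∃ r > 0, ∃ K, 0 ≤ K ∧ ball a r ⊆ Ω ∧ ∀ z ∈ ball a r, ∀ ξ, ‖f z ξ‖ ≤ K * ‖ξ‖ := by
  have hc : ContinuousAt (fun p : V × V => f p.1 p.2) (a, 0) :=
    h.smooth.continuousOn.continuousAt ((hΩ.prod isOpen_univ).mem_nhds ⟨ha, mem_univ _⟩)
  have h0 : f a 0 = 0 := by simpa using h.smul a ha 0 0
  have h1 : ∀ᶠ p : V × V in 𝓝 (a, 0), ‖f p.1 p.2‖ < 1 := by
    have := hc.norm
    apply this.eventually (gt_mem_nhds _)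
    simp [h0]
  obtain ⟨ε, hε, hb⟩ := Metric.eventually_nhds_iff_ball.1 h1
  obtain ⟨r, hr, hs⟩ := Metric.isOpen_iff.1 hΩ a ha
  refine ⟨min ε r, lt_min hε hr, 2 / ε, by positivity, (ball_subset_ball (min_le_right _ _)).trans hs,
    fun z hz ξ => ?_⟩
  have hzΩ : z ∈ Ω := hs (ball_subset_ball (min_le_right _ _) hz)
  by_cases hξ : ξ = 0
  · have : f z 0 = 0 := by simpa using h.smul z hzΩ 0 0
    simp [hξ, this]
  have hn : 0 < ‖ξ‖ := norm_pos_iff.2 hξ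
  have := hb (z, (ε / (2 * ‖ξ‖)) • ξ) (by
    rw [← ball_prod_same]
    refine ⟨ball_subset_ball (min_le_left _ _) hz, ?_⟩
    rw [mem_ball_zero_iff, norm_smul, Real.norm_of_nonneg (by positivity)]
    field_simp; norm_num)
  simp only [h.smul z hzΩ] at this
  rw [norm_smul, Real.norm_of_nonneg (by positivity)] at this
  rw [div_mul_eq_mul_div, div_lt_one (by positivity)] at this
  rw [div_mul_eq_mul_div, le_div_iff₀ hε]
  linarith

def GD (f : V → V → F) (z ξ : V) : V →L[ℝ] F :=
  (fderiv ℝ (fun p : V × V => f p.1 p.2) (z, ξ)).comp (ContinuousLinearMap.inl ℝ V V)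

theorem JF.hasFDerivAt (hΩ : IsOpen Ω) (h : JF (n+1) Ω f) {z : V} (hz : z ∈ Ω) (ξ : V) :
    HasFDerivAt (fun w => f w ξ) (GD f z ξ) z := by
  have h1 : DifferentiableAt ℝ (fun p : V × V => f p.1 p.2) (z, ξ) :=
    (h.smooth.contDiffAt ((hΩ.prod isOpen_univ).mem_nhds ⟨hz, mem_univ _⟩)).differentiableAt (by simp)
  exact HasFDerivAt.comp (f := fun w => (w, ξ)) z h1.hasFDerivAt (hasFDerivAt_prodMk_left z ξ)

theorem JF.gd (hΩ : IsOpen Ω) (h : JF (n+1) Ω f) : JF n Ω (GD f) where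
  add z hz ξ η := by
    refine (h.hasFDerivAt hΩ hz (ξ + η)).unique ?_
    refine ((h.hasFDerivAt hΩ hz ξ).add (h.hasFDerivAt hΩ hz η)).congr_of_eventuallyEq ?_
    filter_upwards [hΩ.mem_nhds hz] with w hw
    exact h.add w hw ξ η
  smul z hz c ξ := by
    refine (h.hasFDerivAt hΩ hz (c • ξ)).unique ?_
    refine ((h.hasFDerivAt hΩ hz ξ).const_smul c).congr_of_eventuallyEq ?_
    filter_upwards [hΩ.mem_nhds hz] with w hw
    exact h.smul w hw c ξ
  smooth := by
    have h1 := h.smooth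
    push_cast at h1
    rw [contDiffOn_succ_iff_fderiv_of_isOpen (hΩ.prod isOpen_univ)] at h1
    exact h1.2.2.clm_comp contDiffOn_const

theorem JF.contOn (h : JF n Ω f) (ξ : V) : ContinuousOn (fun z => f z ξ) Ω :=
  h.smooth.continuousOn.comp (f := fun z => (z, ξ)) (by fun_prop) (fun z hz => ⟨hz, mem_univ _⟩)

theorem JF.lip (hΩ : IsOpen Ω) (h : JF (n+1) Ω f) {a : V} (ha : a ∈ Ω) :
    ∃ r > 0, ∃ K, 0 ≤ K ∧ ball a r ⊆ Ω ∧ (∀ z ∈ ball a r, ∀ ξ, ‖f z ξ‖ ≤ K * ‖ξ‖) ∧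
      (∀ z ∈ ball a r, ∀ ξ, ‖GD f z ξ‖ ≤ K * ‖ξ‖) ∧
      ∀ z ∈ ball a r, ∀ w ∈ ball a r, ∀ ξ, ‖f z ξ - f w ξ‖ ≤ K * ‖z - w‖ * ‖ξ‖ := by
  obtain ⟨r, hr, K, hK, hs, hb⟩ := h.bound hΩ ha
  obtain ⟨r', hr', K', hK', hs', hb'⟩ := (h.gd hΩ).bound hΩ ha
  have i1 : ball a (min r r') ⊆ ball a r := ball_subset_ball (min_le_left _ _)
  have i2 : ball a (min r r') ⊆ ball a r' := ball_subset_ball (min_le_right _ _)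
  have hG : ∀ z ∈ ball a (min r r'), ∀ ξ, ‖GD f z ξ‖ ≤ max K K' * ‖ξ‖ := fun z hz ξ =>
    (hb' z (i2 hz) ξ).trans (mul_le_mul_of_nonneg_right (le_max_right _ _) (norm_nonneg _))
  refine ⟨min r r', lt_min hr hr', max K K', hK.trans (le_max_left _ _), i1.trans hs, fun z hz ξ =>
    (hb z (i1 hz) ξ).trans (mul_le_mul_of_nonneg_right (le_max_left _ _) (norm_nonneg _)), hG, ?_⟩
  intro z hz w hw ξ
  have := (convex_ball a (min r r')).norm_image_sub_le_of_norm_hasFDerivWithin_le (f := fun w => f w ξ)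
    (fun x hx => (h.hasFDerivAt hΩ (hs (i1 hx)) ξ).hasFDerivWithinAt) (fun x hx => hG x hx ξ) hw hz
  exact this.trans (le_of_eq (by ring))

variable [CompleteSpace F]

theorem wp_fderiv {u : V → F} {a : V} {δ M : ℝ} (hΩ : IsOpen Ω) (hf : JF (n+1) Ω f)
    (hu : ContDiffOn ℝ 1 u Ω) (hs : ball a (2 * δ) ⊆ Ω) (hw : WP u f a δ)
    (hM0 : 0 ≤ M) (hδ : 0 < δ)
    (hub : ∀ z ∈ ball a (2 * δ), ‖fderiv ℝ u z‖ ≤ M)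
    (hfb : ∀ z ∈ ball a (2 * δ), ∀ ξ, ‖GD f z ξ‖ ≤ M * ‖ξ‖) :
    WP (fderiv ℝ u) (GD f) a δ := by
  intro z hz ξ hξ t ht
  have hdiff : ∀ w ∈ Ω, HasFDerivAt u (fderiv ℝ u w) w := fun w hw =>
    ((hu.contDiffAt (hΩ.mem_nhds hw)).differentiableAt (by simp)).hasFDerivAt
  have hu' : ContinuousOn (fderiv ℝ u) (ball a (2*δ)) :=
    (hu.continuousOn_fderiv_of_isOpen hΩ (by simp)).mono hs
  have hft : ∀ (w : V) (ζ : ℂ), HasFDerivAt (fun w : V => w + ζ • ξ) (ContinuousLinearMap.id ℝ V) w :=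
    fun w ζ => (hasFDerivAt_id w).add_const _
  have hc1 : ∀ w ∈ ball a δ, Continuous (Phi u f w ξ) := fun w hw =>
    Phi_cont (hu.continuousOn.mono hs) (fun ξ => (hf.contOn ξ).mono hs) hw hξ
  have hc2 : Continuous (Phi (fderiv ℝ u) (GD f) z ξ) :=
    Phi_cont hu' (fun ξ => ((hf.gd hΩ).contOn ξ).mono hs) hz hξ
  have key : HasFDerivAt (fun w => ∫ ζ, (ζ - t)⁻¹ • Phi u f w ξ ζ)
      (∫ ζ, (ζ - t)⁻¹ • Phi (fderiv ℝ u) (GD f) z ξ ζ) z := by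
    have hbi : Integrable fun ζ : ℂ => (ball (0:ℂ) 1).indicator (fun ζ => ‖(ζ - t)⁻¹‖ * (D0 * M + M * δ)) ζ := by
      rw [integrable_indicator_iff measurableSet_ball]
      refine (((ka_shift (α := 1) (by norm_num) 1 t).1).congr ?_).mul_const _
      refine Eventually.of_forall fun ζ => ?_
      simp [Real.rpow_neg_one]
    refine hasFDerivAt_integral_of_dominated_of_fderiv_le (isOpen_ball.mem_nhds hz)
      (F' := fun w ζ => (ζ - t)⁻¹ • Phi (fderiv ℝ u) (GD f) w ξ ζ) ?_ ?_ ?_ ?_ hbi ?_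
    · filter_upwards [isOpen_ball.mem_nhds hz] with w hw
      exact (kernel_cont_integrable t (hc1 w hw) (Phi_zero u f _ ξ)).aestronglyMeasurable
    · exact kernel_cont_integrable t (hc1 z hz) (Phi_zero u f _ ξ)
    · exact (kernel_cont_integrable t hc2 (Phi_zero _ _ _ ξ)).aestronglyMeasurable
    · refine Eventually.of_forall fun ζ w hw => ?_
      by_cases h1 : ‖ζ‖ < 1
      · rw [indicator_of_mem (by simpa using h1), norm_smul]
        exact mul_le_mul_of_nonneg_left (Phi_le hub hfb hM0 hM0 hδ.le hw hξ ζ) (norm_nonneg _)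
      · rw [indicator_of_notMem (by simpa using h1), Phi_zero _ _ _ _ _ (not_lt.1 h1)]; simp
    · refine Eventually.of_forall fun ζ w hw => ?_
      by_cases h1 : ‖ζ‖ < 1
      · have hm := hs (mem_two hw hξ h1.le)
        have e1 := HasFDerivAt.comp w (hdiff _ hm) (hft w ζ)
        have e2 := HasFDerivAt.comp w (hf.hasFDerivAt hΩ hm ξ) (hft w ζ)
        exact ((e1.const_smul (db chi0 ζ)).add (e2.const_smul (chi0 ζ))).const_smul ((ζ - t)⁻¹)
      · have e : ∀ w, Phi u f w ξ ζ = 0 := fun w => Phi_zero _ _ _ _ _ (not_lt.1 h1)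
        simp only [e, Phi_zero (fderiv ℝ u) (GD f) w ξ ζ (not_lt.1 h1), smul_zero]
        exact hasFDerivAt_const _ _
  have k1 := key.const_smul (-(Real.pi : ℂ)⁻¹)
  have k2 : HasFDerivAt (fun w => u (w + t • ξ)) (fderiv ℝ u (z + t • ξ)) z :=
    HasFDerivAt.comp z (hdiff _ (hs (mem_two hz hξ (by linarith)))) (hft z t)
  refine k2.unique (k1.congr_of_eventuallyEq ?_)
  filter_upwards [isOpen_ball.mem_nhds hz] with w hw'
  exact hw w hw' ξ hξ t ht

theorem reg_zero {u : V → F} (hΩ : IsOpen Ω) (hf : JF (n+1) Ω f) (hu : ContinuousOn u Ω)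
    (hw : ∀ a ∈ Ω, ∃ δ > 0, ball a (2*δ) ⊆ Ω ∧ WP u f a δ) : ContDiffOn ℝ 1 u Ω := by
  intro a ha
  refine ContDiffAt.contDiffWithinAt ?_
  obtain ⟨δ, hδ, hs, hwp⟩ := hw a ha
  obtain ⟨r, hr, K, hK, hs', hb, -, hl⟩ := hf.lip hΩ ha
  have hc : ∀ᶠ z in 𝓝 a, ‖u z‖ < ‖u a‖ + 1 :=
    (hu.continuousAt (hΩ.mem_nhds ha)).norm.eventually (gt_mem_nhds (by linarith))
  obtain ⟨ε, hε, hub⟩ := Metric.eventually_nhds_iff_ball.1 hc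
  set d := min δ (min (r/2) (ε/2))
  have hd : 0 < d := by positivity
  have d1 : d ≤ δ := min_le_left _ _
  have d2 : 2 * d ≤ r := by have : d ≤ r/2 := (min_le_right _ _).trans (min_le_left _ _); linarith
  have d3 : 2 * d ≤ ε := by have : d ≤ ε/2 := (min_le_right _ _).trans (min_le_right _ _); linarith
  have i2 := ball_subset_ball (x := a) d2
  have := reg_one (L := K) (M0 := ‖u a‖ + 1) (M1 := K) hd (hwp.mono d1) (hu.mono (i2.trans hs')) (by positivity) hK hK
    (fun z hz => (hub z (ball_subset_ball d3 hz)).le) (fun z hz => hb z (i2 hz))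
    (fun z hz w hw => hl z (i2 hz) w (i2 hw))
  exact this.contDiffAt (ball_mem_nhds _ (by positivity))
end F

theorem reg (n : ℕ) : ∀ {F : Type} [NormedAddCommGroup F] [NormedSpace ℂ F] [CompleteSpace F]
    {Ω : Set V} {f : V → V → F} {u : V → F} (_ : IsOpen Ω) (_ : JF (n+1) Ω f) (_ : ContinuousOn u Ω)
    (_ : ∀ a ∈ Ω, ∃ δ > 0, ball a (2*δ) ⊆ Ω ∧ WP u f a δ), ContDiffOn ℝ (n+1) u Ω := by
  induction n with
  | zero =>
    intro F _ _ _ Ω f u hΩ hf hu hw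
    simpa using reg_zero hΩ hf hu hw
  | succ n ih =>
    intro F _ _ _ Ω f u hΩ hf hu hw
    have h1 := reg_zero hΩ hf hu hw
    have hc := h1.continuousOn_fderiv_of_isOpen hΩ (by simp)
    push_cast
    rw [contDiffOn_succ_iff_fderiv_of_isOpen hΩ]
    refine ⟨h1.differentiableOn (by simp), by simp, ?_⟩
    refine ih hΩ (hf.gd hΩ) hc ?_
    intro a ha
    obtain ⟨δ, hδ, hs, hwp⟩ := hw a ha
    obtain ⟨r, hr, K, hK, hs', -, hb, -⟩ := hf.lip hΩ ha
    have hc : ∀ᶠ z in 𝓝 a, ‖fderiv ℝ u z‖ < ‖fderiv ℝ u a‖ + 1 :=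
      (hc.continuousAt (hΩ.mem_nhds ha)).norm.eventually (gt_mem_nhds (by linarith))
    obtain ⟨ε, hε, hub⟩ := Metric.eventually_nhds_iff_ball.1 hc
    set d := min δ (min (r/2) (ε/2))
    have hd : 0 < d := by positivity
    have d1 : d ≤ δ := min_le_left _ _
    have d2 : 2 * d ≤ r := by have : d ≤ r/2 := (min_le_right _ _).trans (min_le_left _ _); linarith
    have d3 : 2 * d ≤ ε := by have : d ≤ ε/2 := (min_le_right _ _).trans (min_le_right _ _); linarith
    have i2 := ball_subset_ball (x := a) d2
    refine ⟨d, hd, i2.trans hs', ?_⟩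
    refine wp_fderiv (M := max (‖fderiv ℝ u a‖ + 1) K) hΩ hf h1 (i2.trans hs') (hwp.mono d1)
      (hK.trans (le_max_right _ _)) hd ?_ ?_
    · exact fun z hz => (hub z (ball_subset_ball d3 hz)).le.trans (le_max_left _ _)
    · exact fun z hz ξ => (hb z (i2 hz) ξ).trans
        (mul_le_mul_of_nonneg_right (le_max_right _ _) (norm_nonneg _))
end jf
end PartE

section PartF
open MeasureTheory Metric Filter Topology

section cps
variable {V : Type} [NormedAddCommGroup V] [NormedSpace ℂ V] {Ω : Set V} {u : V → ℂ} {f : V → V → ℂ}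

theorem db_mul_line (hΩ : IsOpen Ω) (h : Sol Ω u f) {k : ℂ → ℂ} {b : ℝ} (hk : ContDiff ℝ 1 k)
    (hz : ∀ ζ, b ≤ ‖ζ‖ → k ζ = 0) {z ξ : V} (hs : ∀ ζ : ℂ, ‖ζ‖ ≤ b → z + ζ • ξ ∈ Ω) :
    ContDiff ℝ 1 (fun ζ => k ζ * u (z + ζ • ξ)) ∧ HasCompactSupport (fun ζ => k ζ * u (z + ζ • ξ)) ∧
    ∀ ζ, db (fun ζ => k ζ * u (z + ζ • ξ)) ζ = db k ζ * u (z + ζ • ξ) + k ζ * f (z + ζ • ξ) ξ := by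
  have hU : IsOpen ((fun ζ : ℂ => z + ζ • ξ) ⁻¹' Ω) := hΩ.preimage (line_cont z ξ)
  have hsol : Sol ((fun ζ : ℂ => z + ζ • ξ) ⁻¹' Ω) (fun ζ : ℂ => u (z + ζ • ξ))
      (fun ζ η => f (z + ζ • ξ) (η • ξ)) := by
    have := h.comp_affine hΩ (ContinuousLinearMap.toSpanSingleton ℂ ξ) z
      (Ω' := (fun ζ : ℂ => z + ζ • ξ) ⁻¹' Ω) (fun w hw => by simpa [add_comm] using hw)
    simpa [add_comm] using this
  have hcd := cut_contDiff hk hz hU hs hsol.1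
  have hks : HasCompactSupport k := HasCompactSupport.intro (isCompact_closedBall (0:ℂ) b) fun x hx =>
    hz x (by simp at hx; exact hx.le)
  refine ⟨hcd, hks.mul_right, fun ζ => ?_⟩
  by_cases hζ : ‖ζ‖ ≤ b
  · rw [db, dbar_mul (hk.differentiable (by simp) _) (hsol.diffAt hU (hs ζ hζ)), hsol.2 ζ (hs ζ hζ)]
    simp [db]
  · have hev : ∀ᶠ w in 𝓝 ζ, k w = 0 := by
      filter_upwards [continuous_norm.continuousAt.eventually (lt_mem_nhds (not_le.1 hζ))] with w hw
      exact hz w (le_of_lt hw)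
    have e1 : db k ζ = 0 := db_zero_of_eventually hev
    have e2 : db (fun ζ => k ζ * u (z + ζ • ξ)) ζ = 0 := db_zero_of_eventually (c := 0) (by
      filter_upwards [hev] with w hw; rw [hw, zero_mul])
    rw [e1, e2, hz ζ (not_le.1 hζ).le]; ring

theorem cps (hΩ : IsOpen Ω) (h : Sol Ω u f) {k : ℂ → ℂ} {b : ℝ} (hk : ContDiff ℝ 1 k)
    (hz : ∀ ζ, b ≤ ‖ζ‖ → k ζ = 0) {z ξ : V} (hs : ∀ ζ : ℂ, ‖ζ‖ ≤ b → z + ζ • ξ ∈ Ω) (t : ℂ) :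
    ∫ ζ, (ζ - t)⁻¹ * (db k ζ * u (z + ζ • ξ) + k ζ * f (z + ζ • ξ) ξ) =
      -(Real.pi : ℂ) * (k t * u (z + t • ξ)) := by
  obtain ⟨h1, h2, h3⟩ := db_mul_line hΩ h hk hz hs
  rw [← cp h1 h2 t]; simp only [h3]

theorem cps_zero (hΩ : IsOpen Ω) (h : Sol Ω u f) {k : ℂ → ℂ} {b : ℝ} (hk : ContDiff ℝ 1 k)
    (hz : ∀ ζ, b ≤ ‖ζ‖ → k ζ = 0) {z ξ : V} (hs : ∀ ζ : ℂ, ‖ζ‖ ≤ b → z + ζ • ξ ∈ Ω) :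
    ∫ ζ, (db k ζ * u (z + ζ • ξ) + k ζ * f (z + ζ • ξ) ξ) = 0 := by
  obtain ⟨h1, h2, h3⟩ := db_mul_line hΩ h hk hz hs
  rw [← integral_db h1 h2]; simp only [h3]

theorem Sol.wp (hΩ : IsOpen Ω) (h : Sol Ω u f) {a : V} {δ : ℝ} (hs : ball a (2*δ) ⊆ Ω) : WP u f a δ := by
  intro z hz ξ hξ t ht
  have := cps hΩ h cut0.smooth cut0.zero (fun ζ hζ => hs (mem_two hz hξ hζ)) t
  simp only [Phi, smul_eq_mul]
  rw [this, cut0.one t (by linarith)]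
  have : (Real.pi : ℂ) ≠ 0 := by exact_mod_cast Real.pi_ne_zero
  field_simp

theorem dbar_contOn (hΩ : IsOpen Ω) (h : ContDiffOn ℝ 1 u Ω) (ξ : V) :
    ContinuousOn (fun z => dbar u z ξ) Ω := by
  have hc := h.continuousOn_fderiv_of_isOpen hΩ (by simp)
  unfold dbar
  fun_prop

theorem Sol.contOn (hΩ : IsOpen Ω) (h : Sol Ω u f) (ξ : V) : ContinuousOn (fun z => f z ξ) Ω :=
  (dbar_contOn hΩ h.1 ξ).congr fun z hz => (h.2 z hz ξ).symm

theorem Sol.holder (hΩ : IsOpen Ω) (h : Sol Ω u f) {a : V} {δ M : ℝ} (hδ : 0 < δ) (hM : 0 ≤ M)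
    (hs : ball a (2*δ) ⊆ Ω) (hub : ∀ z ∈ ball a (2*δ), ‖u z‖ ≤ M)
    (hfb : ∀ z ∈ ball a (2*δ), ∀ ξ, ‖f z ξ‖ ≤ M * ‖ξ‖) {z : V} (hz : z ∈ ball a δ) {k : V} (hk : ‖k‖ ≤ δ / 4) :
    ‖u (z + k) - u z‖ ≤ CH * (D0 * M + M * δ) * √(‖k‖ / δ) :=
  wp_holder hδ (h.wp hΩ hs) (h.1.continuousOn.mono hs) (fun ξ => (h.contOn hΩ ξ).mono hs) hM hM hub hfb hz hk

theorem holder_tendsto (C δ : ℝ) (z : V) : Tendsto (fun w : V => C * √(‖w - z‖ / δ)) (𝓝 z) (𝓝 0) := by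
  have : Continuous fun w : V => C * √(‖w - z‖ / δ) := by fun_prop
  simpa using this.tendsto z

theorem IsForm01.jf {n : ℕ} (h : IsForm01 n Ω f) : JF n Ω f where
  add := h.1
  smul z hz c ξ := by
    have := h.2.1 z hz (c : ℂ) ξ
    simpa using this
  smooth := h.2.2

theorem lim_sol {un : ℕ → V → ℂ} {fn : ℕ → V → V → ℂ} (hΩ : IsOpen Ω)
    (h : ∀ n, Sol Ω (un n) (fn n))
    (hb : ∀ a ∈ Ω, ∃ r > 0, ∃ M, ∀ z ∈ ball a r, z ∈ Ω → ∀ n, ‖un n z‖ ≤ M ∧ ∀ ξ, ‖fn n z ξ‖ ≤ M * ‖ξ‖)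
    (hu : ∀ z ∈ Ω, Tendsto (fun n => un n z) atTop (𝓝 (u z)))
    (hf : ∀ z ∈ Ω, ∀ ξ, Tendsto (fun n => fn n z ξ) atTop (𝓝 (f z ξ)))
    (hF : IsForm01 1 Ω f) : Sol Ω u f := by
  have loc : ∀ a ∈ Ω, ∃ δ > 0, ∃ M, 0 ≤ M ∧ ball a (2*δ) ⊆ Ω ∧ (∀ z ∈ ball a (2*δ), ∀ n, ‖un n z‖ ≤ M) ∧
      ∀ z ∈ ball a (2*δ), ∀ n, ∀ ξ, ‖fn n z ξ‖ ≤ M * ‖ξ‖ := by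
    intro a ha
    obtain ⟨r, hr, M, hM⟩ := hb a ha
    obtain ⟨r', hr', hs⟩ := Metric.isOpen_iff.1 hΩ a ha
    have e : 2 * (min r r' / 2) = min r r' := by ring
    have i1 := ball_subset_ball (x := a) (min_le_left r r')
    have i2 := ball_subset_ball (x := a) (min_le_right r r')
    refine ⟨min r r' / 2, by positivity, M, ?_, ?_⟩
    · exact (norm_nonneg _).trans (hM a (mem_ball_self hr) ha 0).1
    · rw [e]
      exact ⟨i2.trans hs, fun z hz n => (hM z (i1 hz) (hs (i2 hz)) n).1,
        fun z hz n => (hM z (i1 hz) (hs (i2 hz)) n).2⟩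
  have phi_lim : ∀ {a : V} {δ : ℝ}, ball a (2*δ) ⊆ Ω → ∀ z ∈ ball a δ, ∀ ξ, ‖ξ‖ ≤ δ → ∀ ζ,
      Tendsto (fun n => Phi (un n) (fn n) z ξ ζ) atTop (𝓝 (Phi u f z ξ ζ)) := by
    intro a δ hs z hz ξ hξ ζ
    by_cases hζ : ‖ζ‖ ≤ 1
    · have hm := hs (mem_two hz hξ hζ)
      exact ((hu _ hm).const_smul _).add ((hf _ hm ξ).const_smul _)
    · simp only [Phi_zero _ _ _ _ _ (not_le.1 hζ).le]
      exact tendsto_const_nhds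
  have hwp : ∀ a ∈ Ω, ∃ δ > 0, ball a (2*δ) ⊆ Ω ∧ WP u f a δ := by
    intro a ha
    obtain ⟨δ, hδ, M, hM, hs, hub, hfb⟩ := loc a ha
    refine ⟨δ, hδ, hs, fun z hz ξ hξ t ht => ?_⟩
    refine tendsto_nhds_unique (hu _ (hs (mem_two hz hξ (by linarith)))) ?_
    have : ∀ n, un n (z + t • ξ) = _ := fun n => ((h n).wp hΩ hs) z hz ξ hξ t ht
    simp only [this]
    refine Tendsto.const_smul ?_ _
    have hc : ∀ n, Continuous (Phi (un n) (fn n) z ξ) := fun n =>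
      Phi_cont ((h n).1.continuousOn.mono hs) (fun ξ => ((h n).contOn hΩ ξ).mono hs) hz hξ
    have hbi : Integrable fun ζ : ℂ => (ball (0:ℂ) 1).indicator (fun ζ => ‖(ζ - t)⁻¹‖ * (D0 * M + M * δ)) ζ := by
      rw [integrable_indicator_iff measurableSet_ball]
      refine (((ka_shift (α := 1) (by norm_num) 1 t).1).congr ?_).mul_const _
      refine Eventually.of_forall fun ζ => ?_
      simp [Real.rpow_neg_one]
    refine tendsto_integral_of_dominated_convergence _ (fun n =>
      (kernel_cont_integrable t (hc n) (Phi_zero _ _ _ ξ)).aestronglyMeasurable) hbi ?_ ?_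
    · refine fun n => Eventually.of_forall fun ζ => ?_
      by_cases h1 : ‖ζ‖ < 1
      · rw [indicator_of_mem (by simpa using h1), norm_smul]
        exact mul_le_mul_of_nonneg_left (Phi_le (fun z hz => hub z hz n) (fun z hz => hfb z hz n) hM hM hδ.le hz hξ ζ)
          (norm_nonneg _)
      · rw [indicator_of_notMem (by simpa using h1), Phi_zero _ _ _ _ _ (not_lt.1 h1)]; simp
    · exact Eventually.of_forall fun ζ => (phi_lim hs z hz ξ hξ ζ).const_smul _
  have hcont : ContinuousOn u Ω := by
    intro a ha
    refine ContinuousAt.continuousWithinAt ?_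
    obtain ⟨δ, hδ, M, hM, hs, hub, hfb⟩ := loc a ha
    rw [ContinuousAt, tendsto_iff_norm_sub_tendsto_zero]
    refine squeeze_zero' (Eventually.of_forall fun _ => norm_nonneg _) ?_
      (holder_tendsto (CH * (D0 * M + M * δ)) δ a)
    filter_upwards [closedBall_mem_nhds a (show 0 < δ/4 by positivity), hΩ.mem_nhds ha] with w hw hwΩ
    refine le_of_tendsto ((hu w hwΩ).sub (hu a ha)).norm (Eventually.of_forall fun n => ?_)
    have := (h n).holder hΩ hδ hM hs (fun z hz => hub z hz n) (fun z hz => hfb z hz n) (mem_ball_self hδ)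
      (k := w - a) (by rw [← dist_eq_norm]; exact hw)
    rwa [add_sub_cancel] at this
  have hC1 : ContDiffOn ℝ 1 u Ω := reg_zero (n := 0) hΩ hF.jf hcont hwp
  refine ⟨hC1, fun z hz ξ => ?_⟩
  have hsolu : Sol Ω u (fun z ξ => dbar u z ξ) := ⟨hC1, fun _ _ _ => rfl⟩
  obtain ⟨δ, hδ, M, hM, hs, hub, hfb⟩ := loc z hz
  have wg : ∀ ξ, ‖ξ‖ ≤ δ → ∫ ζ, chi0 ζ * (dbar u (z + ζ • ξ) ξ - f (z + ζ • ξ) ξ) = 0 := by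
    intro ξ hξ
    have hzz := mem_ball_self (x := z) hδ
    have hci : ∀ {v : V → ℂ} {g}, ContinuousOn v Ω → (∀ ξ, ContinuousOn (fun z => g z ξ) Ω) →
        Integrable (Phi v g z ξ) := fun hv hg =>
      (Phi_cont (hv.mono hs) (fun ξ => (hg ξ).mono hs) hzz hξ).integrable_of_hasCompactSupport
        (HasCompactSupport.intro (isCompact_closedBall (0:ℂ) 1) fun x hx =>
          Phi_zero _ _ _ _ x (by simp at hx; exact hx.le))
    have e1 : ∫ ζ, Phi u f z ξ ζ = 0 := by
      have e0 : ∀ n, ∫ ζ, Phi (un n) (fn n) z ξ ζ = 0 := fun n => by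
        have := cps_zero hΩ (h n) cut0.smooth cut0.zero (fun ζ hζ => hs (mem_two hzz hξ hζ))
        simpa only [Phi, smul_eq_mul] using this
      refine tendsto_nhds_unique ?_ (tendsto_const_nhds (x := (0:ℂ)) (f := atTop (α := ℕ)))
      have : (fun _ : ℕ => (0:ℂ)) = fun n => ∫ ζ, Phi (un n) (fn n) z ξ ζ := by ext n; rw [e0]
      rw [this]
      refine tendsto_integral_of_dominated_convergence
        ((ball (0:ℂ) 1).indicator fun _ => D0 * M + M * δ) (fun n =>
        (hci (h n).1.continuousOn ((h n).contOn hΩ)).aestronglyMeasurable) ?_ ?_ ?_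
      · rw [integrable_indicator_iff measurableSet_ball]
        exact integrableOn_const (measure_ball_lt_top).ne
      · refine fun n => Eventually.of_forall fun ζ => ?_
        by_cases h1 : ‖ζ‖ < 1
        · rw [indicator_of_mem (by simpa using h1)]
          exact Phi_le (fun z hz => hub z hz n) (fun z hz => hfb z hz n) hM hM hδ.le hzz hξ ζ
        · rw [indicator_of_notMem (by simpa using h1), Phi_zero _ _ _ _ _ (not_lt.1 h1)]; simp
      · exact Eventually.of_forall fun ζ => phi_lim hs z hzz ξ hξ ζ
    have e2 : ∫ ζ, Phi u (fun z ξ => dbar u z ξ) z ξ ζ = 0 := by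
      have := cps_zero hΩ hsolu cut0.smooth cut0.zero (fun ζ hζ => hs (mem_two hzz hξ hζ))
      simpa only [Phi, smul_eq_mul] using this
    have e3 := integral_sub (hci (g := fun z ξ => dbar u z ξ) hC1.continuousOn (dbar_contOn hΩ hC1))
      (hci hcont hF.jf.contOn)
    rw [e1, e2, sub_zero] at e3
    rw [← e3]; congr 1; ext ζ
    simp only [Phi, smul_eq_mul]; ring
  -- scaling
  set g : V → ℂ := fun w => dbar u w ξ - f w ξ with hg
  have hgc : ContinuousOn g Ω := (dbar_contOn hΩ hC1 ξ).sub (hF.jf.contOn ξ)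
  have hgz := hgc.continuousAt (hΩ.mem_nhds hz)
  have hgb : ∀ᶠ w in 𝓝 z, ‖g w‖ < ‖g z‖ + 1 := hgz.norm.eventually (gt_mem_nhds (by linarith))
  obtain ⟨ρ, hρ, hgb⟩ := Metric.eventually_nhds_iff_ball.1 hgb
  have hlim : Tendsto (fun n : ℕ => ((1:ℝ) / (n + 1))) atTop (𝓝 0) := tendsto_one_div_add_atTop_nhds_zero_nat
  have hlimξ : Tendsto (fun n : ℕ => ((1:ℝ) / (n + 1)) * ‖ξ‖) atTop (𝓝 0) := by
    simpa using hlim.mul_const ‖ξ‖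
  have hsm : ∀ᶠ n : ℕ in atTop, ((1:ℝ) / (n + 1)) * ‖ξ‖ < min ρ δ :=
    hlimξ.eventually (gt_mem_nhds (lt_min hρ hδ))
  have hin : ∀ (n : ℕ) (ζ : ℂ), ((1:ℝ) / (n + 1)) * ‖ξ‖ < min ρ δ → ‖ζ‖ ≤ 1 →
      z + ζ • (((1:ℝ) / (n + 1) : ℝ) • ξ) ∈ ball z (min ρ δ) := by
    intro n ζ hn hζ
    rw [mem_ball, dist_eq_norm, add_sub_cancel_left, norm_smul, norm_smul,
      Real.norm_of_nonneg (by positivity)]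
    refine lt_of_le_of_lt (mul_le_of_le_one_left (by positivity) hζ) hn
  have hball : ball z (min ρ δ) ⊆ Ω := (ball_subset_ball ((min_le_right _ _).trans (by linarith))).trans hs
  have t0 : ∀ᶠ n : ℕ in atTop, ∫ ζ, chi0 ζ * g (z + ζ • (((1:ℝ) / (n + 1) : ℝ) • ξ)) = 0 := by
    filter_upwards [hsm] with n hn
    have hp : (0:ℝ) < 1 / (n + 1) := by positivity
    have := wg (((1:ℝ) / (n + 1) : ℝ) • ξ) (by
      rw [norm_smul, Real.norm_of_nonneg hp.le]; exact (hn.trans_le (min_le_right _ _)).le)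
    have e : ∀ ζ : ℂ, chi0 ζ * (dbar u (z + ζ • (((1:ℝ) / (n + 1) : ℝ) • ξ)) (((1:ℝ) / (n + 1) : ℝ) • ξ) -
        f (z + ζ • (((1:ℝ) / (n + 1) : ℝ) • ξ)) (((1:ℝ) / (n + 1) : ℝ) • ξ)) =
        (((1:ℝ) / (n + 1) : ℝ) : ℂ) * (chi0 ζ * g (z + ζ • (((1:ℝ) / (n + 1) : ℝ) • ξ))) := by
      intro ζ
      by_cases hζ : ‖ζ‖ ≤ 1
      · rw [hF.jf.smul _ (hball (hin n ζ hn hζ))]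
        have := dbar_smul_right u (z + ζ • (((1:ℝ) / (n + 1) : ℝ) • ξ)) (((1:ℝ) / (n + 1) : ℝ) : ℂ) ξ
        rw [Complex.conj_ofReal, Complex.coe_smul] at this
        rw [this, hg, Complex.real_smul]; ring
      · rw [cut0.zero ζ (not_le.1 hζ).le]; simp
    simp only [e] at this
    rw [integral_const_mul] at this
    refine (mul_eq_zero.1 this).resolve_left ?_
    exact_mod_cast hp.ne'
  have t1 : Tendsto (fun n : ℕ => ∫ ζ, chi0 ζ * g (z + ζ • (((1:ℝ) / (n + 1) : ℝ) • ξ))) atTop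
      (𝓝 (∫ ζ, chi0 ζ * g z)) := by
    refine tendsto_integral_filter_of_dominated_convergence
      ((ball (0:ℂ) 1).indicator fun _ => ‖g z‖ + 1) ?_ ?_ ?_ ?_
    · filter_upwards [hsm] with n hn
      have := cut_continuous (g := fun ζ => g (z + ζ • (((1:ℝ) / (n + 1) : ℝ) • ξ))) cut0.cont cut0.zero
        (isOpen_ball.preimage (line_cont z (((1:ℝ) / (n + 1) : ℝ) • ξ))) (fun ζ hζ => hin n ζ hn hζ)
        ((hgc.mono hball).comp (line_cont _ _).continuousOn (fun _ h => h))
      exact this.aestronglyMeasurable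
    · filter_upwards [hsm] with n hn
      refine Eventually.of_forall fun ζ => ?_
      by_cases h1 : ‖ζ‖ < 1
      · rw [indicator_of_mem (by simpa using h1), norm_mul]
        refine (mul_le_of_le_one_left (norm_nonneg _) (cut0.le ζ)).trans ?_
        exact (hgb _ (ball_subset_ball (min_le_left _ _) (hin n ζ hn h1.le))).le
      · rw [indicator_of_notMem (by simpa using h1), cut0.zero _ (not_lt.1 h1)]; simp
    · rw [integrable_indicator_iff measurableSet_ball]
      exact integrableOn_const (measure_ball_lt_top).ne
    · refine Eventually.of_forall fun ζ => ?_
      refine Tendsto.const_mul _ (hgz.tendsto.comp ?_)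
      have : Tendsto (fun n : ℕ => z + ζ • (((1:ℝ) / (n + 1) : ℝ) • ξ)) atTop (𝓝 (z + ζ • ((0:ℝ) • ξ))) :=
        ((hlim.smul_const ξ).const_smul ζ).const_add z
      simpa using this
  have t2 := tendsto_nhds_unique t1 (tendsto_const_nhds.congr' (t0.mono fun n hn => hn.symm))
  rw [integral_mul_const] at t2
  exact sub_eq_zero.1 ((mul_eq_zero.1 t2).resolve_left int_chi0)

theorem comp_sol [TopologicalSpace.SeparableSpace V] {un : ℕ → V → ℂ} {fn : ℕ → V → V → ℂ} {M : ℝ}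
    (hΩ : IsOpen Ω) (hM : 0 ≤ M)
    (h : ∀ n, Sol Ω (un n) (fn n))
    (hub : ∀ n, ∀ z ∈ Ω, ‖un n z‖ ≤ M) (hfb : ∀ n, ∀ z ∈ Ω, ∀ ξ, ‖fn n z ξ‖ ≤ M * ‖ξ‖)
    (hf : ∀ z ∈ Ω, ∀ ξ, Tendsto (fun n => fn n z ξ) atTop (𝓝 (f z ξ)))
    (hF : IsForm01 1 Ω f) : ∃ u, Sol Ω u f ∧ ∀ z ∈ Ω, ‖u z‖ ≤ M := by
  classical
  set d := TopologicalSpace.denseSeq V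
  have hd : DenseRange d := TopologicalSpace.denseRange_denseSeq V
  set x : ℕ → ℕ → ℂ := fun n k => if d k ∈ Ω then un n (d k) else 0 with hx
  have hxm : ∀ n, x n ∈ Set.pi univ fun _ : ℕ => closedBall (0:ℂ) M := by
    intro n k _
    simp only [hx]; split_ifs with hk
    · simpa using hub n _ hk
    · simpa using hM
  obtain ⟨l, -, φ, hφ, hl⟩ := (isCompact_univ_pi fun _ => isCompact_closedBall (0:ℂ) M).tendsto_subseq hxm
  have hlim : ∀ z ∈ Ω, ∃ v, Tendsto (fun n => un (φ n) z) atTop (𝓝 v) := by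
    intro z hz
    apply cauchySeq_tendsto_of_complete
    obtain ⟨r, hr, hs⟩ := Metric.isOpen_iff.1 hΩ z hz
    have e : 2 * (r / 2) = r := by ring
    rw [Metric.cauchySeq_iff']
    intro ε hε
    have ev : ∀ᶠ w in 𝓝 z, w ∈ Ω ∧ ‖w - z‖ ≤ (r/2)/4 ∧ CH * (D0 * M + M * (r/2)) * √(‖w - z‖ / (r/2)) < ε/3 := by
      refine Filter.Eventually.and (hΩ.mem_nhds hz) (Filter.Eventually.and ?_ ((holder_tendsto _ _ z).eventually (gt_mem_nhds (by positivity))))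
      filter_upwards [closedBall_mem_nhds z (show 0 < (r/2)/4 by positivity)] with w hw
      rw [← dist_eq_norm]; exact hw
    obtain ⟨k, hw, hwr, hwe⟩ := hd.mem_nhds ev
    have hho : ∀ n, ‖un n (d k) - un n z‖ < ε/3 := fun n => by
      have := (h n).holder hΩ (δ := r/2) (by positivity) hM (by rw [e]; exact hs) (fun z hz => hub n z (hs (e ▸ hz)))
        (fun z hz => hfb n z (hs (e ▸ hz))) (mem_ball_self (by positivity)) hwr
      rw [add_sub_cancel] at this
      exact this.trans_lt hwe
    have hk : Tendsto (fun n => un (φ n) (d k)) atTop (𝓝 (l k)) := by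
      have := (tendsto_pi_nhds.1 hl) k
      simpa [hx, hw] using this
    obtain ⟨N, hN⟩ := Metric.cauchySeq_iff'.1 hk.cauchySeq (ε/3) (by positivity)
    refine ⟨N, fun n hn => ?_⟩
    have h1 := hN n hn
    have h2 := hho (φ n)
    have h3 := hho (φ N)
    rw [dist_eq_norm] at *
    calc ‖un (φ n) z - un (φ N) z‖ = ‖-(un (φ n) (d k) - un (φ n) z) + (un (φ n) (d k) - un (φ N) (d k))
          + (un (φ N) (d k) - un (φ N) z)‖ := by congr 1; ring
      _ ≤ _ := norm_add₃_le
      _ < ε := by rw [norm_neg]; linarith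
  choose! u hu using hlim
  refine ⟨u, lim_sol hΩ (fun n => h (φ n)) ?_ hu (fun z hz ξ => (hf z hz ξ).comp hφ.tendsto_atTop) hF, ?_⟩
  · exact fun a _ => ⟨1, one_pos, M, fun z _ hz n => ⟨hub _ z hz, hfb _ z hz⟩⟩
  · exact fun z hz => le_of_tendsto (hu z hz).norm (Eventually.of_forall fun n => hub _ z hz)
end cps
end PartF

section PartG
open MeasureTheory Metric Filter Topology

section taylor
variable {V : Type} [NormedAddCommGroup V] [NormedSpace ℂ V] {Ω Ω₀ : Set V} {u : V → ℂ} {f : V → V → ℂ}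

theorem Sol.of_local (h : ∀ a ∈ Ω, ∃ r > 0, Sol (ball a r) u f) : Sol Ω u f := by
  constructor
  · intro a ha
    obtain ⟨r, hr, hs⟩ := h a ha
    exact (hs.1.contDiffAt (ball_mem_nhds a hr)).contDiffWithinAt
  · intro a ha
    obtain ⟨r, hr, hs⟩ := h a ha
    exact hs.2 a (mem_ball_self hr)

abbrev zf : V → V → ℂ := fun _ _ => 0

theorem form_zero (n : ℕ) : IsForm01 n Ω (zf : V → V → ℂ) :=
  ⟨fun _ _ _ _ => by simp, fun _ _ _ _ => by simp, contDiffOn_const⟩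

theorem taylor_hol (hΩ : IsOpen Ω) (hΩ₀ : IsOpen Ω₀) {D : V → ℂ} {g : V → V → ℂ} (hD : Sol Ω₀ D g)
    (A : ℝ → V →L[ℂ] V) (c : ℕ → V → ℂ) (s : ℕ)
    (hloc : ∀ a ∈ Ω, ∃ r > 0, ∃ t₀ > 0, ∃ M, ∀ z ∈ ball a r, z ∈ Ω → ∀ t : ℝ, 0 < t → t ≤ t₀ →
      A t z ∈ Ω₀ ∧ (∀ l ≤ s, ‖D (A t z) - ∑ i ∈ Finset.range l, (t:ℂ)^i * c i z‖ ≤ M * t^l) ∧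
      ∀ ξ, ‖g (A t z) (A t ξ)‖ ≤ M * t^s * ‖ξ‖) :
    ∀ l < s, Sol Ω (c l) zf := by
  intro l
  induction l using Nat.strong_induction_on with
  | _ l ih =>
  intro hl
  refine Sol.of_local fun a ha => ?_
  obtain ⟨r₁, hr₁, t₀, ht₀, M, hM⟩ := hloc a ha
  obtain ⟨r₂, hr₂, hs₂⟩ := Metric.isOpen_iff.1 hΩ a ha
  set r := min r₁ r₂
  have hr : 0 < r := lt_min hr₁ hr₂
  have hs : ball a r ⊆ Ω := (ball_subset_ball (min_le_right _ _)).trans hs₂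
  have hM : ∀ z ∈ ball a r, _ := fun z hz => hM z (ball_subset_ball (min_le_left _ _) hz) (hs hz)
  refine ⟨r, hr, ?_⟩
  set t : ℕ → ℝ := fun n => min t₀ 1 / (n + 1) with ht
  have hm : 0 < min t₀ 1 := lt_min ht₀ one_pos
  have htp : ∀ n, 0 < t n := fun n => by simp only [ht]; positivity
  have htm : ∀ n, t n ≤ min t₀ 1 := fun n => by
    simp only [ht]
    exact div_le_self hm.le (by linarith [n.cast_nonneg (α := ℝ)])
  have ht1 : ∀ n, t n ≤ 1 := fun n => (htm n).trans (min_le_right _ _)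
  have ht2 : ∀ n, t n ≤ t₀ := fun n => (htm n).trans (min_le_left _ _)
  have htl : Tendsto t atTop (𝓝 0) := by
    have := (tendsto_one_div_add_atTop_nhds_zero_nat (𝕜 := ℝ)).const_mul (min t₀ 1)
    simpa [ht, div_eq_mul_inv] using this
  have hM0 : 0 ≤ M := by
    have := (hM a (mem_ball_self hr) (t 0) (htp 0) (ht2 0)).2.1 0 (by omega)
    simp only [pow_zero, mul_one] at this
    exact (norm_nonneg _).trans this
  have htn : ∀ n k, ‖(((t n)^k : ℝ) : ℂ)⁻¹‖ = ((t n)^k)⁻¹ := fun n k => by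
    rw [norm_inv, Complex.norm_real, Real.norm_of_nonneg (pow_nonneg (htp n).le k)]
  refine lim_sol (un := fun n z => (((t n)^l : ℝ) : ℂ)⁻¹ * (D (A (t n) z) - ∑ i ∈ Finset.range l, (t n:ℂ)^i * c i z))
    (fn := fun n z ξ => (((t n)^l : ℝ) : ℂ)⁻¹ * g (A (t n) z) (A (t n) ξ)) isOpen_ball ?_ ?_ ?_ ?_ (form_zero 1)
  · intro n
    have h1 : Sol (ball a r) (fun z => D (A (t n) z)) (fun z ξ => g (A (t n) z) (A (t n) ξ)) :=
      hD.comp hΩ₀ (A (t n)) fun z hz => (hM z hz (t n) (htp n) (ht2 n)).1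
    have h2 : Sol (ball a r) (fun z => ∑ i ∈ Finset.range l, (t n:ℂ)^i * c i z)
        (fun z ξ => ∑ i ∈ Finset.range l, (t n:ℂ)^i * zf z ξ) :=
      Sol.sum isOpen_ball _ fun i hi => ((ih i (Finset.mem_range.1 hi)
        ((Finset.mem_range.1 hi).trans hl)).mono hs).const_mul isOpen_ball _
    refine ((h1.sub isOpen_ball h2).const_mul isOpen_ball _).congr isOpen_ball (fun _ _ => rfl) ?_
    intro z hz ξ; simp
  · intro b hb
    refine ⟨r, hr, M, fun z _ hz n => ⟨?_, fun ξ => ?_⟩⟩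
    · have := (hM z hz (t n) (htp n) (ht2 n)).2.1 l hl.le
      rw [norm_mul, htn, inv_mul_le_iff₀ (pow_pos (htp n) l), mul_comm]; exact this
    · have := (hM z hz (t n) (htp n) (ht2 n)).2.2 ξ
      rw [norm_mul, htn, inv_mul_le_iff₀ (pow_pos (htp n) l)]
      refine this.trans ?_
      have : t n ^ s ≤ t n ^ l := pow_le_pow_of_le_one (htp n).le (ht1 n) hl.le
      nlinarith [mul_nonneg hM0 (norm_nonneg ξ)]
  · intro z hz
    rw [tendsto_iff_norm_sub_tendsto_zero]
    refine squeeze_zero (fun _ => norm_nonneg _) (fun n => ?_) (by simpa using htl.const_mul M)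
    have := (hM z hz (t n) (htp n) (ht2 n)).2.1 (l+1) hl
    rw [Finset.sum_range_succ] at this
    have hne : ((t n : ℝ) : ℂ) ≠ 0 := by exact_mod_cast (htp n).ne'
    have e : (((t n)^l : ℝ) : ℂ)⁻¹ * (D (A (t n) z) - ∑ i ∈ Finset.range l, (t n:ℂ)^i * c i z) - c l z =
      (((t n)^l : ℝ) : ℂ)⁻¹ * (D (A (t n) z) - (∑ i ∈ Finset.range l, (t n:ℂ)^i * c i z + (t n:ℂ)^l * c l z)) := by
      push_cast; field_simp; ring
    rw [e, norm_mul, htn, inv_mul_le_iff₀ (pow_pos (htp n) l)]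
    refine this.trans (le_of_eq (by ring))
  · intro z hz ξ
    rw [tendsto_zero_iff_norm_tendsto_zero]
    refine squeeze_zero (fun _ => norm_nonneg _) (fun n => ?_) (by simpa using htl.const_mul (M * ‖ξ‖))
    have := (hM z hz (t n) (htp n) (ht2 n)).2.2 ξ
    rw [norm_mul, htn, inv_mul_le_iff₀ (pow_pos (htp n) l)]
    refine this.trans ?_
    have : t n ^ s ≤ t n ^ (l+1) := pow_le_pow_of_le_one (htp n).le (ht1 n) hl
    rw [pow_succ] at this
    nlinarith [mul_nonneg hM0 (norm_nonneg ξ)]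

/-! ### the Q lemma -/

def cq (Λ : ℝ) : ℝ := Real.pi⁻¹ * ((D0 / Λ + 1) * Ka 1 (Λ + 1))

theorem q_lemma {D : V → ℂ} {g : V → V → ℂ} {b M H Λ : ℝ} {s : ℕ} (hb : 0 < b) (hΛ : 2 ≤ Λ)
    (hD : Sol (ball 0 b) D g) (hM : 0 ≤ M) (hH : 0 ≤ H)
    (hDb : ∀ z ∈ ball (0:V) b, ‖D z‖ ≤ M)
    (hgb : ∀ z ∈ ball (0:V) b, ∀ ξ, ‖g z ξ‖ ≤ H * ‖z‖^s * ‖ξ‖) :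
    ∃ Q : V → ℂ, Sol (ball 0 (b / Λ)) Q zf ∧
      ∀ z ∈ ball (0:V) (b / Λ), ‖D z - Q z‖ ≤ cq Λ * (M * (2/Λ)^s + H * ‖z‖^(s+1)) := by
  have hΛ0 : 0 < Λ := by linarith
  have hD0 := D0_nonneg
  have hpi := Real.pi_pos
  obtain ⟨χ, hχ⟩ := exists_cut_half hΛ0
  have hin : ∀ z ∈ ball (0:V) (b / Λ), ∀ ζ : ℂ, ‖ζ‖ ≤ Λ → 0 + ζ • z ∈ ball (0:V) b := by
    intro z hz ζ hζ
    rw [mem_ball_zero_iff, lt_div_iff₀ hΛ0] at hz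
    rw [zero_add, mem_ball_zero_iff, norm_smul]
    nlinarith [norm_nonneg z, norm_nonneg ζ]
  set P : V → ℂ → ℂ := fun z ζ => db χ ζ * D (0 + ζ • z) + χ ζ * g (0 + ζ • z) z with hP
  set Φ : V → ℕ → ℂ → ℂ := fun z l ζ => (ζ^l)⁻¹ * P z ζ with hΦ
  have hPc : ∀ z ∈ ball (0:V) (b / Λ), Continuous (P z) := by
    intro z hz
    have hU := (isOpen_ball (x := (0:V)) (ε := b)).preimage (line_cont 0 z)
    refine (cut_continuous hχ.dcont hχ.d0 hU (hin z hz) ?_).add (cut_continuous hχ.cont hχ.zero hU (hin z hz) ?_)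
    · exact hD.1.continuousOn.comp (line_cont _ _).continuousOn fun _ h => h
    · exact (hD.contOn isOpen_ball z).comp (line_cont _ _).continuousOn fun _ h => h
  have hPz : ∀ z ζ, Λ ≤ ‖ζ‖ → P z ζ = 0 := fun z ζ h => by simp [hP, hχ.d0 ζ h, hχ.zero ζ h]
  have hΦm : ∀ z ∈ ball (0:V) (b / Λ), ∀ l, AEStronglyMeasurable (Φ z l) volume := fun z hz l =>
    ((measurable_id.pow_const l).inv.aestronglyMeasurable).mul (hPc z hz).aestronglyMeasurable
  have hΦz : ∀ z l ζ, Λ ≤ ‖ζ‖ → Φ z l ζ = 0 := fun z l ζ h => by simp [hΦ, hPz z ζ h]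
  have hΦb : ∀ z ∈ ball (0:V) (b / Λ), ∀ l ≤ s, ∀ ζ,
      ‖Φ z l ζ‖ ≤ D0 / Λ * (M * (2/Λ)^l) + H * Λ^(s-l) * ‖z‖^(s+1) := by
    intro z hz l hl ζ
    by_cases hζ : Λ ≤ ‖ζ‖
    · rw [hΦz z l ζ hζ, norm_zero]; positivity
    rw [not_le] at hζ
    have hm := hin z hz ζ hζ.le
    simp only [hΦ, hP, mul_add]
    refine (norm_add_le _ _).trans (add_le_add ?_ ?_)
    · by_cases h1 : ‖ζ‖ ≤ Λ/2
      · rw [hχ.d1 ζ h1]; simp; positivity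
      · rw [not_le] at h1
        rw [norm_mul, norm_mul, norm_inv, norm_pow]
        have h2 : (‖ζ‖^l)⁻¹ ≤ (2/Λ)^l := by
          rw [← inv_pow]
          apply pow_le_pow_left₀ (by positivity)
          rw [show 2/Λ = (Λ/2)⁻¹ by rw [inv_div]]
          exact inv_anti₀ (by positivity) h1.le
        calc _ ≤ (2/Λ)^l * (D0/Λ * M) := by
              gcongr
              · exact hχ.dle ζ
              · exact hDb _ hm
          _ = _ := by ring
    · rw [norm_mul, norm_mul, norm_inv, norm_pow]
      have h1 := hgb _ hm z
      rw [zero_add, norm_smul] at h1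
      have h2 : (‖ζ‖^l)⁻¹ * ‖ζ‖^s ≤ Λ^(s-l) := by
        by_cases h0 : ζ = 0
        · by_cases hl0 : l = 0
          · subst hl0; simp [h0]; by_cases hs0 : s = 0
            · simp [hs0]
            · simp [hs0]; positivity
          · simp [h0, hl0]; positivity
        · have : 0 < ‖ζ‖ := norm_pos_iff.2 h0
          rw [← Nat.sub_add_cancel hl, pow_add, mul_comm, mul_assoc, mul_inv_cancel₀ (by positivity), mul_one,
            Nat.add_sub_cancel]
          exact pow_le_pow_left₀ this.le hζ.le _
      have h3 := hχ.le ζ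
      rw [zero_add]
      calc _ ≤ (‖ζ‖^l)⁻¹ * (1 * (H * (‖ζ‖ * ‖z‖)^s * ‖z‖)) := by gcongr
        _ = ((‖ζ‖^l)⁻¹ * ‖ζ‖^s) * (H * ‖z‖^(s+1)) := by rw [mul_pow]; ring
        _ ≤ Λ^(s-l) * (H * ‖z‖^(s+1)) := by gcongr
        _ = _ := by ring
  set R : V → ℕ → ℂ → ℂ := fun z l t => -(Real.pi:ℂ)⁻¹ * ∫ ζ, (ζ - t)⁻¹ • Φ z l ζ with hR
  set c : ℕ → V → ℂ := fun l z => R z l 0 with hc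
  have hpi' : (Real.pi : ℂ) ≠ 0 := by exact_mod_cast Real.pi_ne_zero
  have hR0 : ∀ z ∈ ball (0:V) (b / Λ), ∀ t : ℂ, ‖t‖ ≤ 1 → D (t • z) = R z 0 t := by
    intro z hz t ht
    have := cps isOpen_ball hD hχ.smooth hχ.zero (hin z hz) t
    rw [hχ.one t (by linarith), one_mul] at this
    simp only [hR, hΦ, hP, pow_zero, inv_one, one_mul, smul_eq_mul]
    rw [this, zero_add]; field_simp
  have hRs : ∀ z ∈ ball (0:V) (b / Λ), ∀ l < s, ∀ t : ℂ, R z l t = c l z + t * R z (l+1) t := by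
    intro z hz l hl t
    have i1 := (kernel_one 0 (hΦm z hz l) (hΦz z l) (hΦb z hz l hl.le)).1
    have i2 := (kernel_one t (hΦm z hz (l+1)) (hΦz z (l+1)) (hΦb z hz (l+1) hl)).1
    simp only [hc, hR]
    rw [mul_left_comm t, ← mul_add, ← integral_const_mul t, ← integral_add i1 (i2.const_mul t)]
    congr 1
    apply integral_congr_ae
    filter_upwards [ae_ne t, ae_ne 0] with ζ h1 h2
    rw [sub_zero] at h2
    simp only [hΦ, smul_eq_mul, sub_zero, pow_succ]
    field_simp; ring
  have hexp : ∀ z ∈ ball (0:V) (b / Λ), ∀ t : ℂ, ‖t‖ ≤ 1 → ∀ l ≤ s,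
      D (t • z) = ∑ i ∈ Finset.range l, t^i * c i z + t^l * R z l t := by
    intro z hz t ht l
    induction l with
    | zero => intro _; simpa using hR0 z hz t ht
    | succ l ih =>
      intro hl
      rw [ih (by omega), Finset.sum_range_succ, hRs z hz l hl t]; ring
  have hRb : ∀ z ∈ ball (0:V) (b / Λ), ∀ l ≤ s, ∀ t : ℂ, ‖t‖ ≤ 1 → ‖R z l t‖ ≤ Real.pi⁻¹ *
      ((D0 / Λ * (M * (2/Λ)^l) + H * Λ^(s-l) * ‖z‖^(s+1)) * Ka 1 (Λ + 1)) := by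
    intro z hz l hl t ht
    simp only [hR]
    rw [norm_mul, norm_neg, norm_inv, Complex.norm_real, Real.norm_of_nonneg hpi.le]
    refine mul_le_mul_of_nonneg_left ?_ (by positivity)
    refine (kernel_one t (hΦm z hz l) (hΦz z l) (hΦb z hz l hl)).2.trans ?_
    exact mul_le_mul_of_nonneg_left (ka_mono (by norm_num) (by linarith)) (by positivity)
  have hka := ka_nonneg 1 (Λ+1)
  have hhol : ∀ l < s, Sol (ball 0 (b / Λ)) (c l) zf := by
    refine taylor_hol isOpen_ball isOpen_ball hD (fun t => (t:ℂ) • ContinuousLinearMap.id ℂ V) c s ?_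
    intro a ha
    have hbd : ∃ M', ∀ l ≤ s, ∀ z ∈ ball (0:V) (b / Λ), Real.pi⁻¹ *
      ((D0 / Λ * (M * (2/Λ)^l) + H * Λ^(s-l) * ‖z‖^(s+1)) * Ka 1 (Λ + 1)) ≤ M' := by
      refine ⟨Real.pi⁻¹ * ((D0 / Λ * (M * 1) + H * Λ^s * (b/Λ)^(s+1)) * Ka 1 (Λ + 1)), fun l hl z hz => ?_⟩
      rw [mem_ball_zero_iff] at hz
      gcongr
      · exact pow_le_one₀ (by positivity) (by rw [div_le_one hΛ0]; exact hΛ)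
      · linarith
      · omega
    obtain ⟨M', hM'⟩ := hbd
    refine ⟨1, one_pos, 1, one_pos, max M' (H * (b/Λ)^s), fun z _ hz t ht0 ht1 => ⟨?_, ?_, ?_⟩⟩
    · have := hin z hz (t:ℂ) (by rw [Complex.norm_real, Real.norm_of_nonneg ht0.le]; linarith)
      simpa using this
    · intro l hl
      have hn : ‖(t:ℂ)‖ = t := by rw [Complex.norm_real, Real.norm_of_nonneg ht0.le]
      simp only [ContinuousLinearMap.smul_apply, ContinuousLinearMap.id_apply]
      rw [hexp z hz t (by rw [hn]; exact ht1) l hl, add_sub_cancel_left, norm_mul, norm_pow, hn, mul_comm]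
      gcongr
      exact ((hRb z hz l hl t (by rw [hn]; exact ht1)).trans (hM' l hl z hz)).trans (le_max_left _ _)
    · intro ξ
      have hn : ‖(t:ℂ)‖ = t := by rw [Complex.norm_real, Real.norm_of_nonneg ht0.le]
      have h1 := hin z hz (t:ℂ) (by rw [hn]; linarith)
      rw [zero_add] at h1
      have h2 := hgb _ h1 ((t:ℂ) • ξ)
      simp only [ContinuousLinearMap.smul_apply, ContinuousLinearMap.id_apply]
      refine h2.trans ?_
      rw [norm_smul, norm_smul, hn]
      rw [mem_ball_zero_iff] at hz
      calc H * (t * ‖z‖)^s * (t * ‖ξ‖) ≤ H * (t * (b/Λ))^s * (1 * ‖ξ‖) := by gcongr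
        _ = (H * (b/Λ)^s) * t^s * ‖ξ‖ := by rw [mul_pow]; ring
        _ ≤ _ := by gcongr; exact le_max_right _ _
  refine ⟨fun z => ∑ i ∈ Finset.range s, c i z, ?_, ?_⟩
  · have := Sol.sum isOpen_ball (Finset.range s) fun i hi => hhol i (Finset.mem_range.1 hi)
    exact this.congr isOpen_ball (fun _ _ => rfl) (fun _ _ _ => by simp)
  · intro z hz
    have h1 := hexp z hz 1 (by simp) s le_rfl
    simp only [one_smul, one_pow, one_mul] at h1
    rw [h1, add_sub_cancel_left]
    refine (hRb z hz s le_rfl 1 (by simp)).trans ?_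
    simp only [cq, Nat.sub_self, pow_zero, mul_one]
    rw [mul_assoc]
    refine mul_le_mul_of_nonneg_left ?_ (by positivity)
    have e1 : 0 ≤ M * (2/Λ)^s := by positivity
    have e2 : 0 ≤ H * ‖z‖^(s+1) := by positivity
    have e3 : 0 ≤ D0 / Λ := by positivity
    rw [mul_right_comm]
    refine mul_le_mul_of_nonneg_right ?_ hka
    nlinarith [mul_nonneg e3 e2]

/-! ### Taylor coefficients of holomorphic functions -/

def tc (h : V → ℂ) (α β : V →L[ℂ] V) (l : ℕ) (z : V) : ℂ :=
  iteratedDeriv l (fun ζ : ℂ => h (α z + ζ • β z)) 0 / l.factorial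

section
variable {h : V → ℂ} {α β : V →L[ℂ] V} {z : V} {r M : ℝ}

theorem line_diff (hΩ₀ : IsOpen Ω₀) (hh : Sol Ω₀ h zf) (hr : ∀ ζ : ℂ, ‖ζ‖ ≤ r → α z + ζ • β z ∈ Ω₀) :
    DifferentiableOn ℂ (fun ζ : ℂ => h (α z + ζ • β z)) (closedBall 0 r) := by
  intro ζ hζ
  refine DifferentiableAt.differentiableWithinAt ?_
  have hm := hr ζ (by simpa using hζ)
  have hU : IsOpen ((fun ζ : ℂ => α z + ζ • β z) ⁻¹' Ω₀) := hΩ₀.preimage (line_cont _ _)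
  have hsol : Sol ((fun ζ : ℂ => α z + ζ • β z) ⁻¹' Ω₀) (fun ζ : ℂ => h (α z + ζ • β z)) zf := by
    have := hh.comp_affine hΩ₀ (ContinuousLinearMap.toSpanSingleton ℂ (β z)) (α z)
      (Ω' := (fun ζ : ℂ => α z + ζ • β z) ⁻¹' Ω₀) (fun w hw => by simpa [add_comm] using hw)
    simpa [add_comm] using this
  rw [differentiableAt_complex_iff_differentiableAt_real]
  refine ⟨hsol.diffAt hU hm, ?_⟩
  have := hsol.2 ζ hm 1
  simp only [dbar, smul_eq_mul, mul_one] at this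
  have h2 : fderiv ℝ (fun ζ : ℂ => h (α z + ζ • β z)) ζ 1 +
    Complex.I * fderiv ℝ (fun ζ : ℂ => h (α z + ζ • β z)) ζ Complex.I = 0 := by
    simpa using this
  rw [smul_eq_mul]
  linear_combination (-Complex.I) * h2 + fderiv ℝ (fun ζ : ℂ => h (α z + ζ • β z)) ζ Complex.I * Complex.I_mul_I

variable (hΩ₀ : IsOpen Ω₀) (hh : Sol Ω₀ h zf) (h0 : 0 < r)
    (hr : ∀ ζ : ℂ, ‖ζ‖ ≤ r → α z + ζ • β z ∈ Ω₀)

include hΩ₀ hh h0 hr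

theorem tc_le (hM : ∀ ζ : ℂ, ‖ζ‖ ≤ r → ‖h (α z + ζ • β z)‖ ≤ M) (l : ℕ) : ‖tc h α β l z‖ ≤ M / r^l := by
  have h1 := line_diff hΩ₀ hh hr
  have h2 := Complex.norm_iteratedDeriv_le_of_forall_mem_sphere_norm_le l h0
    (h1.mono closure_ball_subset_closedBall).diffContOnCl (fun ζ hζ => hM ζ (by simpa using hζ.le))
  rw [tc, norm_div, Complex.norm_natCast, div_le_iff₀ (by positivity)]
  refine h2.trans (le_of_eq (by ring))

theorem tc_hasSum {t : ℂ} (ht : ‖t‖ < r) : HasSum (fun l => t^l * tc h α β l z) (h (α z + t • β z)) := by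
  have h1 := (line_diff hΩ₀ hh hr).mono ball_subset_closedBall
  have := Complex.hasSum_taylorSeries_on_ball h1 (z := t) (by simpa using ht)
  refine this.congr_fun ?_ 
  intro l
  simp only [tc, sub_zero, smul_eq_mul]; ring

theorem tc_rem (hM : ∀ ζ : ℂ, ‖ζ‖ ≤ r → ‖h (α z + ζ • β z)‖ ≤ M) {t : ℂ} (ht : ‖t‖ < r) (l : ℕ) :
    ‖h (α z + t • β z) - ∑ i ∈ Finset.range l, t^i * tc h α β i z‖ ≤ M * (‖t‖/r)^l * (1 - ‖t‖/r)⁻¹ := by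
  have h1 := (hasSum_nat_add_iff' l).2 (tc_hasSum hΩ₀ hh h0 hr ht)
  have hq : ‖t‖/r < 1 := by rw [div_lt_one h0]; exact ht
  have h2 := (hasSum_geometric_of_lt_one (by positivity) hq).mul_left (M * (‖t‖/r)^l)
  refine h1.norm_le_of_bounded h2 fun i => ?_
  have := tc_le hΩ₀ hh h0 hr hM (i + l)
  rw [norm_mul, norm_pow]
  calc _ ≤ ‖t‖^(i+l) * (M / r^(i+l)) := by gcongr
    _ = _ := by rw [pow_add, pow_add, div_pow, div_pow]; field_simp
end

theorem tc_hol {h : V → ℂ} {α β : V →L[ℂ] V} (hΩ : IsOpen Ω) (hΩ₀ : IsOpen Ω₀) (hh : Sol Ω₀ h zf)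
    (hloc : ∀ a ∈ Ω, ∃ r > 0, ∃ ρ > 0, ∃ M, ∀ z ∈ ball a r, z ∈ Ω → ∀ ζ : ℂ, ‖ζ‖ ≤ ρ →
      α z + ζ • β z ∈ Ω₀ ∧ ‖h (α z + ζ • β z)‖ ≤ M) (l : ℕ) : Sol Ω (tc h α β l) zf := by
  refine taylor_hol hΩ hΩ₀ hh (fun t => α + (t:ℂ) • β) (tc h α β) (l+1) ?_ l (by omega)
  intro a ha
  obtain ⟨r, hr, ρ, hρ, M, hM⟩ := hloc a ha
  have hM0 : 0 ≤ M := (norm_nonneg _).trans (hM a (mem_ball_self hr) ha 0 (by simpa using hρ.le)).2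
  have hbd : ∃ M', ∀ i ≤ l+1, 2 * M / ρ^i ≤ M' := by
    refine ⟨∑ i ∈ Finset.range (l+2), 2 * M / ρ^i, fun i hi => ?_⟩
    exact Finset.single_le_sum (f := fun i => 2 * M / ρ^i) (fun i _ => by positivity) (Finset.mem_range.2 (by omega))
  obtain ⟨M', hM'⟩ := hbd
  have hM'0 : 0 ≤ M' := (by positivity : 0 ≤ 2 * M / ρ^0).trans (hM' 0 (by omega))
  refine ⟨r, hr, ρ/2, by positivity, M', fun z hz hzΩ t ht0 ht1 => ?_⟩
  have hn : ‖(t:ℂ)‖ = t := by rw [Complex.norm_real, Real.norm_of_nonneg ht0.le]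
  refine ⟨?_, fun i hi => ?_, fun ξ => ?_⟩
  · simpa using (hM z hz hzΩ t (by rw [hn]; linarith)).1
  · have := tc_rem hΩ₀ hh hρ (fun ζ hζ => (hM z hz hzΩ ζ hζ).1) (fun ζ hζ => (hM z hz hzΩ ζ hζ).2)
      (t := t) (by rw [hn]; linarith) i
    simp only [add_apply, smul_apply]
    refine this.trans ?_
    rw [hn]
    have hq : t/ρ ≤ 1/2 := by rw [div_le_iff₀ hρ]; linarith
    have : (1 - t/ρ)⁻¹ ≤ 2 := by
      rw [inv_le_comm₀ (by linarith) (by norm_num)]; linarith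
    calc M * (t/ρ)^i * (1 - t/ρ)⁻¹ ≤ M * (t/ρ)^i * 2 := by gcongr
      _ = 2 * M / ρ^i * t^i := by rw [div_pow]; ring
      _ ≤ _ := by gcongr; exact hM' i hi
  · simp; positivity
end taylor
end PartG

section PartH
open MeasureTheory Metric Filter Topology

theorem pint {V : Type} [NormedAddCommGroup V] [NormedSpace ℂ V] {s : Set V} {U : Set (V × ℂ)}
    {G : V → ℂ → ℂ} {κ : ℂ → ℂ} {L B ρ : ℝ} (hs : IsOpen s) (hU : IsOpen U)
    (hsU : ∀ p ∈ s, ∀ ζ : ℂ, ‖ζ‖ < ρ → (p, ζ) ∈ U)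
    (hG : ContDiffOn ℝ 1 (fun p : V × ℂ => G p.1 p.2) U) (hL0 : 0 ≤ L)
    (hL : ∀ p ∈ s, ∀ q ∈ s, ∀ ζ : ℂ, ‖ζ‖ < ρ → ‖G p ζ - G q ζ‖ ≤ L * ‖p - q‖)
    (hB : ∀ p ∈ s, ∀ ζ : ℂ, ‖ζ‖ < ρ → ‖G p ζ‖ ≤ B)
    (hκ : IntegrableOn κ (ball 0 ρ)) :
    Sol s (fun p => ∫ ζ in ball 0 ρ, κ ζ * G p ζ)
      (fun p ξ => ∫ ζ in ball 0 ρ, κ ζ * dbar (fun q => G q ζ) p ξ) := by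
  have hmem : ∀ᵐ ζ ∂(volume.restrict (ball (0:ℂ) ρ)), ‖ζ‖ < ρ := by
    filter_upwards [ae_restrict_mem measurableSet_ball] with ζ h using by simpa using h
  set F' : V → ℂ → (V →L[ℝ] ℂ) := fun p ζ =>
    (fderiv ℝ (fun p : V × ℂ => G p.1 p.2) (p, ζ)).comp (ContinuousLinearMap.inl ℝ V ℂ) with hF'
  have hd : ∀ p ∈ s, ∀ ζ : ℂ, ‖ζ‖ < ρ → HasFDerivAt (fun q => G q ζ) (F' p ζ) p := by
    intro p hp ζ hζ
    have h1 := ((hG.contDiffAt (hU.mem_nhds (hsU p hp ζ hζ))).differentiableAt (by norm_num)).hasFDerivAt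
    exact h1.comp p (hasFDerivAt_prodMk_left (𝕜 := ℝ) p ζ)
  have hFc : ContinuousOn (fun p : V × ℂ => F' p.1 p.2) U :=
    (hG.continuousOn_fderiv_of_isOpen hU le_rfl).clm_comp continuousOn_const
  have hFl : ∀ p ∈ s, ∀ ζ : ℂ, ‖ζ‖ < ρ → ‖F' p ζ‖ ≤ L := by
    intro p hp ζ hζ
    refine (hd p hp ζ hζ).le_of_lip' hL0 ?_
    filter_upwards [hs.mem_nhds hp] with q hq using hL q hq p hp ζ hζ
  have hmap : ∀ p ∈ s, MapsTo (fun ζ : ℂ => (p, ζ)) (ball 0 ρ) U := fun p hp ζ hζ =>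
    hsU p hp ζ (by simpa using hζ)
  have hline : ∀ p : V, ContinuousOn (fun ζ : ℂ => (p, ζ)) (ball 0 ρ) := fun p => by fun_prop
  have hm1 : ∀ p ∈ s, AEStronglyMeasurable (fun ζ => κ ζ * G p ζ) (volume.restrict (ball (0:ℂ) ρ)) := by
    intro p hp
    exact hκ.1.mul ((hG.continuousOn.comp (hline p) (hmap p hp)).aestronglyMeasurable measurableSet_ball)
  have hm2 : ∀ p ∈ s, AEStronglyMeasurable (fun ζ => κ ζ • F' p ζ) (volume.restrict (ball (0:ℂ) ρ)) := by
    intro p hp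
    exact hκ.1.smul ((hFc.comp (hline p) (hmap p hp)).aestronglyMeasurable measurableSet_ball)
  have hbi : IntegrableOn (fun ζ => ‖κ ζ‖ * L) (ball 0 ρ) := hκ.norm.mul_const L
  have key : ∀ p ∈ s, IntegrableOn (fun ζ => κ ζ • F' p ζ) (ball 0 ρ) ∧
      HasFDerivAt (fun p => ∫ ζ in ball 0 ρ, κ ζ * G p ζ) (∫ ζ in ball 0 ρ, κ ζ • F' p ζ) p := by
    intro p hp
    refine hasFDerivAt_integral_of_dominated_loc_of_lip' (hs.mem_nhds hp) hm1 ?_ (hm2 p hp)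
      (bound := fun ζ => ‖κ ζ‖ * L) ?_ hbi ?_
    · refine (hκ.norm.mul_const B).mono' (hm1 p hp) ?_
      filter_upwards [hmem] with ζ hζ
      rw [norm_mul]; exact mul_le_mul_of_nonneg_left (hB p hp ζ hζ) (norm_nonneg _)
    · filter_upwards [hmem] with ζ hζ q hq
      rw [← mul_sub, norm_mul, mul_assoc]
      exact mul_le_mul_of_nonneg_left (hL q hq p hp ζ hζ) (norm_nonneg _)
    · filter_upwards [hmem] with ζ hζ
      exact (hd p hp ζ hζ).const_mul (κ ζ)
  refine ⟨?_, fun p hp ξ => ?_⟩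
  · rw [← zero_add (1 : WithTop ℕ∞), contDiffOn_succ_iff_hasFDerivWithinAt_of_uniqueDiffOn hs.uniqueDiffOn]
    refine ⟨by simp, fun p => ∫ ζ in ball 0 ρ, κ ζ • F' p ζ, ?_, fun p hp => (key p hp).2.hasFDerivWithinAt⟩
    rw [contDiffOn_zero]
    intro p hp
    refine continuousWithinAt_of_dominated (bound := fun ζ => ‖κ ζ‖ * L) ?_ ?_ hbi ?_
    · filter_upwards [self_mem_nhdsWithin] with q hq using hm2 q hq
    · filter_upwards [self_mem_nhdsWithin] with q hq
      filter_upwards [hmem] with ζ hζ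
      rw [norm_smul]; exact mul_le_mul_of_nonneg_left (hFl q hq ζ hζ) (norm_nonneg _)
    · filter_upwards [hmem] with ζ hζ
      have h1 : ContinuousAt (fun q : V => F' q ζ) p :=
        ContinuousAt.comp (f := fun q : V => (q, ζ)) (g := fun p : V × ℂ => F' p.1 p.2)
          (hFc.continuousAt (hU.mem_nhds (hsU p hp ζ hζ))) (by fun_prop)
      exact (h1.const_smul (κ ζ)).continuousWithinAt
  · rw [dbar_of_hasFDerivAt (key p hp).2, ContinuousLinearMap.integral_apply (key p hp).1,
      ContinuousLinearMap.integral_apply (key p hp).1, ← integral_const_mul, ← integral_add, ← integral_div]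
    · apply integral_congr_ae
      filter_upwards [hmem] with ζ hζ
      rw [dbar_of_hasFDerivAt (hd p hp ζ hζ)]
      simp only [ContinuousLinearMap.smul_apply, smul_eq_mul]; ring
    · exact (key p hp).1.apply_continuousLinearMap ξ
    · exact ((key p hp).1.apply_continuousLinearMap _).const_mul _

theorem cutmul {E : Type} [NormedAddCommGroup E] [NormedSpace ℝ E] {k g : E → ℂ} {W U : Set E}
    (hU : IsOpen U) (hk : ContDiff ℝ 1 k) (hg : ContDiffOn ℝ 1 g U)
    (h : ∀ p ∈ W, p ∈ U ∨ ∀ᶠ q in 𝓝 p, k q = 0) : ContDiffOn ℝ 1 (fun p => k p * g p) W := by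
  intro p hp
  apply ContDiffAt.contDiffWithinAt
  rcases h p hp with h1 | h1
  · exact hk.contDiffAt.mul (hg.contDiffAt (hU.mem_nhds h1))
  · refine (contDiffAt_const (c := (0:ℂ))).congr_of_eventuallyEq ?_
    filter_upwards [h1] with q hq
    simp [hq]

/-! ### structure of `l¹` -/
theorem l1_norm (z : L1) : ‖z‖ = ∑' i, ‖z i‖ := by
  have := lp.norm_eq_tsum_rpow (p := 1) (by simp) z
  simpa using this

theorem l1_summable (z : L1) : Summable fun i => ‖z i‖ := by
  have := (lp.memℓp z).summable (by simp)
  simpa using this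

theorem l1_mem {x : ℕ → ℂ} (h : Summable fun i => ‖x i‖) : Memℓp x 1 := by
  apply memℓp_gen; simpa using h

/-- zeroth coordinate -/
def c0 : L1 →L[ℂ] ℂ := lp.evalCLM ℂ (fun _ : ℕ => ℂ) 1 0
def e0 : L1 := lp.single 1 0 1

def Lft : L1 →L[ℂ] L1 := LinearMap.mkContinuous
  { toFun := fun z => ⟨fun i => z (i+1), l1_mem ((summable_nat_add_iff 1).2 (l1_summable z))⟩
    map_add' := fun z w => by ext i; rfl
    map_smul' := fun a w => by ext i; rfl } 1 (fun z => by
      rw [l1_norm, l1_norm z, (l1_summable z).tsum_eq_zero_add]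
      simp)

def shs (z : ℕ → ℂ) : ℕ → ℂ
  | 0 => 0
  | j+1 => z j

theorem shs_sum (z : L1) : Summable fun i : ℕ => ‖shs z i‖ :=
  (summable_nat_add_iff 1).1 (l1_summable z)

def Sft : L1 →L[ℂ] L1 := LinearMap.mkContinuous
  { toFun := fun z => ⟨shs z, l1_mem (shs_sum z)⟩
    map_add' := fun z w => by
      ext i
      cases i with
      | zero => exact (add_zero (0:ℂ)).symm
      | succ j => rfl
    map_smul' := fun a w => by
      ext i
      cases i with
      | zero => exact (mul_zero a).symm
      | succ j => rfl } 1 (fun z => by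
      rw [l1_norm, l1_norm z, one_mul]
      exact ((shs_sum z).tsum_eq_zero_add).trans_le (by simp [shs]))

theorem Lft_apply (z : L1) (i : ℕ) : Lft z i = z (i+1) := rfl
theorem Sft_zero (z : L1) : Sft z 0 = 0 := rfl
theorem Sft_succ (z : L1) (i : ℕ) : Sft z (i+1) = z i := rfl
theorem c0_apply (z : L1) : c0 z = z 0 := rfl
theorem e0_zero : e0 0 = 1 := by simp [e0]
theorem e0_succ (i : ℕ) : e0 (i+1) = 0 := by simp [e0]

theorem decomp (z : L1) : Sft (Lft z) + c0 z • e0 = z := by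
  ext i
  change Sft (Lft z) i + c0 z * e0 i = z i
  cases i with
  | zero => rw [Sft_zero, c0_apply, e0_zero]; ring
  | succ j => rw [Sft_succ, Lft_apply, e0_succ]; ring

theorem l1_split (z : L1) : ‖z‖ = ‖c0 z‖ + ‖Lft z‖ := by
  rw [l1_norm, l1_norm (Lft z), (l1_summable z).tsum_eq_zero_add]; rfl

theorem c0_e0 : c0 e0 = 1 := e0_zero
theorem Lft_e0 : Lft e0 = 0 := by ext i; simp [Lft_apply, e0_succ]
theorem c0_Sft (y : L1) : c0 (Sft y) = 0 := rfl
theorem Lft_Sft (y : L1) : Lft (Sft y) = y := by ext i; rfl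

theorem c0_cons (y : L1) (w : ℂ) : c0 (Sft y + w • e0) = w := by simp [c0_Sft, c0_e0]
theorem Lft_cons (y : L1) (w : ℂ) : Lft (Sft y + w • e0) = y := by simp [Lft_Sft, Lft_e0]
theorem norm_cons (y : L1) (w : ℂ) : ‖Sft y + w • e0‖ = ‖y‖ + ‖w‖ := by
  rw [l1_split, c0_cons, Lft_cons, add_comm]
theorem norm_Sft (y : L1) : ‖Sft y‖ = ‖y‖ := by simpa using norm_cons y 0
theorem norm_e0 : ‖e0‖ = 1 := by simpa using norm_cons 0 1
theorem Lft_le (z : L1) : ‖Lft z‖ ≤ ‖z‖ := by rw [l1_split z]; linarith [norm_nonneg (c0 z)]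
theorem c0_le (z : L1) : ‖c0 z‖ ≤ ‖z‖ := by rw [l1_split z]; linarith [norm_nonneg (Lft z)]

/-- truncation -/
def trn : ℕ → (L1 →L[ℂ] L1)
  | 0 => 0
  | n+1 => Sft.comp ((trn n).comp Lft) + c0.smulRight e0

theorem trn_succ (n : ℕ) (z : L1) : trn (n+1) z = Sft (trn n (Lft z)) + c0 z • e0 := by
  simp [trn]

theorem trn_le (n : ℕ) (z : L1) : ‖trn n z‖ ≤ ‖z‖ := by
  induction n generalizing z with
  | zero => simp [trn]
  | succ n ih => rw [trn_succ, norm_cons, l1_split z]; linarith [ih (Lft z)]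

theorem sub_trn (n : ℕ) (z : L1) : ‖z - trn n z‖ = ‖(Lft^[n]) z‖ := by
  induction n generalizing z with
  | zero => simp [trn]
  | succ n ih =>
    rw [Function.iterate_succ_apply, ← ih (Lft z), trn_succ]
    nth_rewrite 1 [← decomp z]
    rw [add_sub_add_right_eq_sub, ← map_sub, norm_Sft]

theorem trn_idem (n : ℕ) (z : L1) : trn n (trn n z) = trn n z := by
  induction n generalizing z with
  | zero => simp [trn]
  | succ n ih => rw [trn_succ, trn_succ, Lft_cons, c0_cons, ih]

theorem iter_apply (n : ℕ) (z : L1) (i : ℕ) : (Lft^[n]) z i = z (i + n) := by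
  induction n generalizing z with
  | zero => rfl
  | succ n ih => rw [Function.iterate_succ_apply, ih, Lft_apply]; rfl

theorem iter_tendsto (z : L1) : Tendsto (fun n => ‖(Lft^[n]) z‖) atTop (𝓝 0) := by
  have := tendsto_sum_nat_add (fun i => ‖z i‖)
  refine this.congr fun n => ?_
  rw [l1_norm]; simp only [iter_apply]

theorem trn_tendsto (z : L1) : Tendsto (fun n => trn n z) atTop (𝓝 z) := by
  rw [tendsto_iff_norm_sub_tendsto_zero]
  refine (iter_tendsto z).congr fun n => ?_
  rw [← sub_trn, norm_sub_rev]

theorem trn_mem_span (n : ℕ) (z : L1) :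
    trn n z ∈ Submodule.span ℂ (range fun i : ℕ => (Sft^[i]) e0) := by
  induction n generalizing z with
  | zero => simp [trn]
  | succ n ih =>
    rw [trn_succ]
    refine add_mem ?_ (Submodule.smul_mem _ _ (Submodule.subset_span ⟨0, rfl⟩))
    have h : Submodule.span ℂ (range fun i : ℕ => (Sft^[i]) e0) ≤
        (Submodule.span ℂ (range fun i : ℕ => (Sft^[i]) e0)).comap (Sft : L1 →ₗ[ℂ] L1) := by
      rw [Submodule.span_le]
      rintro _ ⟨i, rfl⟩
      refine Submodule.subset_span ⟨i+1, ?_⟩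
      simp only [Function.iterate_succ_apply']; rfl
    exact h (ih (Lft z))

instance l1_separable : TopologicalSpace.SeparableSpace L1 := by
  have h1 : TopologicalSpace.IsSeparable (range fun i : ℕ => (Sft^[i]) e0) :=
    (countable_range _).isSeparable
  have h2 := (h1.span (R := ℂ)).closure
  rw [← TopologicalSpace.isSeparable_univ_iff]
  refine h2.mono fun z _ => ?_
  exact mem_closure_of_tendsto (trn_tendsto z) (Eventually.of_forall fun n => trn_mem_span n z)
end PartH

section PartI
open MeasureTheory Metric Filter Topology

structure FC (R A : ℝ) (f : L1 → L1 → ℂ) : Prop where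
  form : IsForm01 1 (ball 0 R) f
  closed : DbarClosed (ball 0 R) f
  bd : ∀ z : L1, ‖z‖ < R → ∀ ξ, ‖f z ξ‖ ≤ A * ‖ξ‖
  lip : ∀ z w : L1, ‖z‖ < R → ‖w‖ < R → ∀ ξ, ‖f z ξ - f w ξ‖ ≤ A * ‖z - w‖ * ‖ξ‖

variable {R A ρ : ℝ} {f : L1 → L1 → ℂ} {κ : ℂ → ℂ}

theorem FC.A0 (h : FC R A f) (hR : 0 < R) : 0 ≤ A := by
  have := h.bd 0 (by simpa using hR) e0
  rw [norm_e0, mul_one] at this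
  exact (norm_nonneg _).trans this

theorem FC.sol (h : FC R A f) (ξ : L1) : Sol (ball 0 R) (fun w => f w ξ) (dbar fun w => f w ξ) := by
  refine ⟨?_, fun _ _ _ => rfl⟩
  exact h.form.2.2.comp (contDiff_id.prodMk contDiff_const).contDiffOn fun z hz => ⟨hz, mem_univ _⟩

theorem FC.mono {R' A' : ℝ} (h : FC R A f) (hR : R' ≤ R) (hA : A ≤ A') : FC R' A' f where
  form := ⟨fun z hz => h.form.1 z (ball_subset_ball hR hz), fun z hz => h.form.2.1 z (ball_subset_ball hR hz),
    h.form.2.2.mono (prod_mono (ball_subset_ball hR) subset_rfl)⟩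
  closed := fun z hz => h.closed z (ball_subset_ball hR hz)
  bd := fun z hz ξ => (h.bd z (by linarith) ξ).trans (by gcongr)
  lip := fun z w hz hw ξ => (h.lip z w (by linarith) (by linarith) ξ).trans (by gcongr)

theorem FC.comp (h : FC R A f) (hR : 0 < R) (L : L1 →L[ℂ] L1) (hL : ∀ z, ‖L z‖ ≤ ‖z‖) :
    FC R A (fun z ξ => f (L z) (L ξ)) where
  form := by
    have hm : ∀ z ∈ ball (0:L1) R, L z ∈ ball (0:L1) R := fun z hz => by
      simp only [mem_ball_zero_iff] at hz ⊢; exact (hL z).trans_lt hz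
    refine ⟨fun z hz ξ η => by beta_reduce; rw [map_add, h.form.1 _ (hm z hz)],
      fun z hz a ξ => by beta_reduce; rw [map_smul, h.form.2.1 _ (hm z hz)], ?_⟩
    have : ContDiff ℝ 1 (fun p : L1 × L1 => (L p.1, L p.2)) :=
      ((L.restrictScalars ℝ).contDiff.comp contDiff_fst).prodMk
        ((L.restrictScalars ℝ).contDiff.comp contDiff_snd)
    exact h.form.2.2.comp this.contDiffOn fun p hp => ⟨hm _ hp.1, mem_univ _⟩
  closed := by
    intro z hz ξ η
    have hz' : L z + 0 ∈ ball (0:L1) R := by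
      simp only [mem_ball_zero_iff, add_zero] at hz ⊢; exact (hL z).trans_lt hz
    have h1 := dbar_comp_affine L 0 z η ((h.sol (L ξ)).diffAt isOpen_ball hz')
    have h2 := dbar_comp_affine L 0 z ξ ((h.sol (L η)).diffAt isOpen_ball hz')
    simp only [add_zero] at h1 h2 hz'
    rw [h1, h2, h.closed _ hz']
  bd := fun z hz ξ => (h.bd _ ((hL z).trans_lt hz) _).trans
    (mul_le_mul_of_nonneg_left (hL ξ) (h.A0 hR))
  lip := fun z w hz hw ξ => by
    have hA := h.A0 hR
    refine (h.lip _ _ ((hL z).trans_lt hz) ((hL w).trans_lt hw) _).trans ?_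
    rw [← map_sub]
    have := hL (z - w); have := hL ξ
    gcongr

theorem cons_lt {y : L1} {w : ℂ} (hy : ‖y‖ < R - ρ) (hw : ‖w‖ ≤ ρ) : ‖Sft y + w • e0‖ < R := by
  rw [norm_cons]; linarith

theorem FC.contw (h : FC R A f) {y : L1} (hy : ‖y‖ < R - ρ) (ξ : L1) :
    ContinuousOn (fun w : ℂ => f (Sft y + w • e0) ξ) (ball 0 ρ) := by
  refine (h.sol ξ).1.continuousOn.comp (by fun_prop) fun w hw => ?_
  simp only [mem_ball_zero_iff] at hw ⊢
  exact cons_lt hy hw.le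

theorem FC.int (h : FC R A f) (hκ : IntegrableOn κ (ball 0 ρ)) {y : L1} (hy : ‖y‖ < R - ρ) (ξ : L1) :
    IntegrableOn (fun w => κ w * f (Sft y + w • e0) ξ) (ball 0 ρ) ∧
    ‖∫ w in ball 0 ρ, κ w * f (Sft y + w • e0) ξ‖ ≤ A * (∫ w in ball 0 ρ, ‖κ w‖) * ‖ξ‖ := by
  have hb : ∀ᵐ w ∂(volume.restrict (ball (0:ℂ) ρ)), ‖κ w * f (Sft y + w • e0) ξ‖ ≤ ‖κ w‖ * (A * ‖ξ‖) := by
    filter_upwards [ae_restrict_mem measurableSet_ball] with w hw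
    rw [norm_mul]
    exact mul_le_mul_of_nonneg_left (h.bd _ (cons_lt hy (by simpa using (mem_ball_zero_iff.1 hw).le)) ξ) (norm_nonneg _)
  refine ⟨(hκ.norm.mul_const _).mono' (hκ.1.mul ((h.contw hy ξ).aestronglyMeasurable measurableSet_ball)) hb, ?_⟩
  refine (norm_integral_le_of_norm_le (hκ.norm.mul_const _) hb).trans (le_of_eq ?_)
  rw [integral_mul_const]; ring

theorem isOpen_consU (R : ℝ) : IsOpen {p : L1 × ℂ | ‖Sft p.1 + p.2 • e0‖ < R} :=
  isOpen_lt (by fun_prop) continuous_const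

theorem FC.pi (h : FC R A f) (hA : 0 ≤ A) (hκ : IntegrableOn κ (ball 0 ρ)) (ξ : L1) :
    Sol (ball 0 (R - ρ)) (fun y => ∫ w in ball 0 ρ, κ w * f (Sft y + w • e0) ξ)
      (fun y η => ∫ w in ball 0 ρ, κ w * dbar (fun z => f z ξ) (Sft y + w • e0) (Sft η)) := by
  have h1 := pint (G := fun y w => f (Sft y + w • e0) ξ) (L := A * ‖ξ‖) (B := A * ‖ξ‖) (ρ := ρ) (κ := κ)
    (s := ball 0 (R - ρ)) isOpen_ball (isOpen_consU R) (fun p hp ζ hζ => cons_lt (by simpa using hp) hζ.le) ?_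
    (by positivity) ?_ ?_ hκ
  · refine h1.congr isOpen_ball (fun _ _ => rfl) fun y hy η => ?_
    refine setIntegral_congr_fun measurableSet_ball fun w hw => ?_
    rw [dbar_comp_affine (u := fun z => f z ξ) Sft (w • e0)]
    refine (h.sol ξ).diffAt isOpen_ball ?_
    simp only [mem_ball_zero_iff] at hy hw ⊢
    exact cons_lt hy hw.le
  · refine (h.sol ξ).1.comp (ContDiff.contDiffOn ?_) fun p hp => by simpa using hp
    exact ((Sft.restrictScalars ℝ).contDiff.comp contDiff_fst).add (contDiff_snd.smul contDiff_const)
  · intro p hp q hq ζ hζ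
    refine (h.lip _ _ (cons_lt (by simpa using hp) hζ.le) (cons_lt (by simpa using hq) hζ.le) ξ).trans (le_of_eq ?_)
    rw [add_sub_add_right_eq_sub, ← map_sub, norm_Sft]; ring
  · exact fun p hp ζ hζ => h.bd _ (cons_lt (by simpa using hp) hζ.le) ξ

def fk (κ : ℂ → ℂ) (ρ : ℝ) (f : L1 → L1 → ℂ) (y η : L1) : ℂ :=
  ∫ w in ball 0 ρ, κ w * f (Sft y + w • e0) (Sft η)

set_option maxHeartbeats 1000000 in
theorem FC.fk_smooth (h : FC R A f) (hA : 0 ≤ A) (hκ : IntegrableOn κ (ball 0 ρ)) :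
    ContDiffOn ℝ 1 (fun p : L1 × L1 => fk κ ρ f p.1 p.2) (ball 0 (R - ρ) ×ˢ univ) := by
  rintro ⟨y, η⟩ hp
  have hy : ‖y‖ < R - ρ := by simpa using hp.1
  set s : Set (L1 × L1) := {p | ‖p.1‖ < R - ρ ∧ ‖p.2‖ < ‖η‖ + 1} with hs
  have hso : IsOpen s := 
    (isOpen_lt (continuous_norm.comp continuous_fst) continuous_const).inter
      (isOpen_lt (continuous_norm.comp continuous_snd) continuous_const)
  have hUo : IsOpen {p : (L1 × L1) × ℂ | ‖Sft p.1.1 + p.2 • e0‖ < R} :=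
    (isOpen_consU R).preimage (f := fun p : (L1 × L1) × ℂ => (p.1.1, p.2))
      ((continuous_fst.comp continuous_fst).prodMk continuous_snd)
  have hcd : ContDiff ℝ 1 (fun p : (L1 × L1) × ℂ => (Sft p.1.1 + p.2 • e0, Sft p.1.2)) :=
    (((Sft.restrictScalars ℝ).contDiff.comp (contDiff_fst.comp contDiff_fst)).add
          (contDiff_snd.smul contDiff_const)).prodMk
          ((Sft.restrictScalars ℝ).contDiff.comp (contDiff_snd.comp contDiff_fst))
  have hGc : ContDiffOn ℝ 1 (fun p : (L1 × L1) × ℂ => f (Sft p.1.1 + p.2 • e0) (Sft p.1.2))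
      {p : (L1 × L1) × ℂ | ‖Sft p.1.1 + p.2 • e0‖ < R} :=
    ContDiffOn.comp (g := fun p : L1 × L1 => f p.1 p.2) (t := ball (0:L1) R ×ˢ univ) h.form.2.2 hcd.contDiffOn
      fun p hp => ⟨mem_ball_zero_iff.2 hp, mem_univ _⟩
  have h1 := pint (V := L1 × L1) (G := fun p w => f (Sft p.1 + w • e0) (Sft p.2)) (L := A * (‖η‖ + 2))
    (B := A * (‖η‖ + 1)) (ρ := ρ) (κ := κ) (s := s)
    (U := {p | ‖Sft p.1.1 + p.2 • e0‖ < R}) hso hUo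
    (fun p hp ζ hζ => cons_lt hp.1 hζ.le) ?_ (by positivity) ?_ ?_ hκ
  · exact (h1.1.contDiffAt (hso.mem_nhds ⟨hy, by simp⟩)).contDiffWithinAt
  · exact hGc
  · intro p hp q hq ζ hζ
    have e1 := h.lip _ _ (cons_lt hp.1 hζ.le) (cons_lt hq.1 hζ.le) (Sft p.2)
    have hqm : Sft q.1 + ζ • e0 ∈ ball (0:L1) R := by
      simpa using cons_lt hq.1 hζ.le
    have e2 := h.bd _ (cons_lt hq.1 hζ.le) (Sft (p.2 - q.2))
    have e3 : f (Sft q.1 + ζ • e0) (Sft p.2) =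
        f (Sft q.1 + ζ • e0) (Sft (p.2 - q.2)) + f (Sft q.1 + ζ • e0) (Sft q.2) := by
      rw [← h.form.1 _ hqm, ← map_add, sub_add_cancel]
    rw [add_sub_add_right_eq_sub, ← map_sub, norm_Sft, norm_Sft] at e1
    rw [norm_Sft] at e2
    have e4 : ‖p.1 - q.1‖ ≤ ‖p - q‖ := norm_fst_le (p - q)
    have e5 : ‖p.2 - q.2‖ ≤ ‖p - q‖ := norm_snd_le (p - q)
    calc _ = ‖(f (Sft p.1 + ζ • e0) (Sft p.2) - f (Sft q.1 + ζ • e0) (Sft p.2)) +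
          f (Sft q.1 + ζ • e0) (Sft (p.2 - q.2))‖ := by congr 1; rw [e3]; ring
      _ ≤ A * ‖p.1 - q.1‖ * ‖p.2‖ + A * ‖p.2 - q.2‖ := (norm_add_le _ _).trans (add_le_add e1 e2)
      _ ≤ A * ‖p - q‖ * (‖η‖ + 1) + A * ‖p - q‖ := by gcongr; exact hp.2.le
      _ = _ := by ring
  · intro p hp ζ hζ
    refine (h.bd _ (cons_lt hp.1 hζ.le) _).trans ?_
    rw [norm_Sft]; gcongr; exact hp.2.le

theorem FC.fk (h : FC R A f) (hA : 0 ≤ A) (hκ : IntegrableOn κ (ball 0 ρ)) {B : ℝ}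
    (hB : ∫ w in ball 0 ρ, ‖κ w‖ ≤ B) : FC (R - ρ) (A * B) (fk κ ρ f) where
  form := by
    have hm : ∀ y ∈ ball (0:L1) (R - ρ), ∀ w ∈ ball (0:ℂ) ρ, Sft y + w • e0 ∈ ball (0:L1) R := by
      intro y hy w hw
      simp only [mem_ball_zero_iff] at hy hw ⊢
      exact cons_lt hy hw.le
    refine ⟨fun y hy ξ η => ?_, fun y hy a ξ => ?_, ?_⟩
    · rw [_root_.fk, _root_.fk, _root_.fk, ← integral_add (h.int hκ (by simpa using hy) _).1
        (h.int hκ (by simpa using hy) _).1]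
      refine setIntegral_congr_fun measurableSet_ball fun w hw => ?_
      rw [map_add, h.form.1 _ (hm y hy w hw)]; ring
    · rw [_root_.fk, _root_.fk, ← integral_const_mul]
      refine setIntegral_congr_fun measurableSet_ball fun w hw => ?_
      rw [map_smul, h.form.2.1 _ (hm y hy w hw)]; ring
    · exact h.fk_smooth hA hκ
  closed := by
    intro y hy ξ η
    have e1 := (h.pi hA hκ (Sft ξ)).2 y hy η
    have e2 := (h.pi hA hκ (Sft η)).2 y hy ξ
    change dbar (fun y => ∫ w in ball 0 ρ, κ w * f (Sft y + w • e0) (Sft ξ)) y η =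
      dbar (fun y => ∫ w in ball 0 ρ, κ w * f (Sft y + w • e0) (Sft η)) y ξ
    rw [e1, e2]
    refine setIntegral_congr_fun measurableSet_ball fun w hw => ?_
    beta_reduce
    rw [h.closed]
    simp only [mem_ball_zero_iff] at hy hw ⊢
    exact cons_lt hy hw.le
  bd := fun y hy ξ => by
    refine (h.int hκ hy _).2.trans ?_
    rw [norm_Sft]; gcongr
  lip := fun y y' hy hy' ξ => by
    rw [_root_.fk, _root_.fk, ← integral_sub (h.int hκ hy _).1 (h.int hκ hy' _).1]
    have hb : ∀ᵐ w ∂(volume.restrict (ball (0:ℂ) ρ)), ‖κ w * f (Sft y + w • e0) (Sft ξ) -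
        κ w * f (Sft y' + w • e0) (Sft ξ)‖ ≤ ‖κ w‖ * (A * ‖y - y'‖ * ‖ξ‖) := by
      filter_upwards [ae_restrict_mem measurableSet_ball] with w hw
      have hw' : ‖w‖ ≤ ρ := by simpa using (mem_ball_zero_iff.1 hw).le
      have := h.lip _ _ (cons_lt hy hw') (cons_lt hy' hw') (Sft ξ)
      rw [add_sub_add_right_eq_sub, ← map_sub, norm_Sft, norm_Sft] at this
      rw [← mul_sub, norm_mul]
      exact mul_le_mul_of_nonneg_left this (norm_nonneg _)
    refine (norm_integral_le_of_norm_le (hκ.norm.mul_const _) hb).trans ?_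
    rw [integral_mul_const]
    calc _ ≤ B * (A * ‖y - y'‖ * ‖ξ‖) := by gcongr
      _ = _ := by ring

theorem set_of_zero {E : Type} [NormedAddCommGroup E] [NormedSpace ℝ E] {g : ℂ → E} (hg : ∀ w, ρ ≤ ‖w‖ → g w = 0) :
    ∫ w in ball 0 ρ, g w = ∫ w, g w := by
  refine setIntegral_eq_integral_of_forall_compl_eq_zero fun w hw => hg w ?_
  simpa using hw

theorem FC.ak (h : FC R A f) (hA : 0 ≤ A) {k : ℂ → ℂ} (hk : ContDiff ℝ 1 k) (hz : ∀ w, ρ ≤ ‖w‖ → k w = 0)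
    (hz' : ∀ w, ρ ≤ ‖w‖ → db k w = 0) (hki : IntegrableOn k (ball 0 ρ)) (hdi : IntegrableOn (db k) (ball 0 ρ)) :
    Sol (ball 0 (R - ρ)) (fun y => ∫ w in ball 0 ρ, k w * f (Sft y + w • e0) e0)
      (fun y η => - _root_.fk (db k) ρ f y η) := by
  refine (h.pi hA hki e0).congr isOpen_ball (fun _ _ => rfl) fun y hy η => ?_
  have hy' : ‖y‖ < R - ρ := by simpa using hy
  have e := cps_zero isOpen_ball (h.sol (Sft η)) hk hz (z := Sft y) (ξ := e0)
    (fun ζ hζ => by simpa using cons_lt hy' hζ)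
  replace e : ∫ w in ball 0 ρ, (db k w * f (Sft y + w • e0) (Sft η) +
      k w * dbar (fun z => f z (Sft η)) (Sft y + w • e0) e0) = 0 :=
    (set_of_zero (fun w hw => by rw [hz w hw, hz' w hw]; ring)).trans e
  rw [integral_add (h.int hdi hy' _).1] at e
  · have e2 : (∫ w in ball 0 ρ, k w * dbar (fun z => f z e0) (Sft y + w • e0) (Sft η)) =
        ∫ w in ball 0 ρ, k w * dbar (fun z => f z (Sft η)) (Sft y + w • e0) e0 := by
      refine setIntegral_congr_fun measurableSet_ball fun w hw => ?_
      beta_reduce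
      rw [h.closed]
      rw [mem_ball_zero_iff] at hw ⊢
      exact cons_lt hy' hw.le
    rw [e2, _root_.fk]
    linear_combination -e
  · have hc : ContinuousOn (fun w : ℂ => dbar (fun z => f z (Sft η)) (Sft y + w • e0) e0) (ball 0 ρ) := by
      refine (dbar_contOn isOpen_ball (h.sol (Sft η)).1 e0).comp (by fun_prop) fun w hw => ?_
      simp only [mem_ball_zero_iff] at hw ⊢
      exact cons_lt hy' hw.le
    refine (hki.norm.mul_const (A * ‖Sft η‖ * ‖e0‖)).mono' (hki.1.mul (hc.aestronglyMeasurable measurableSet_ball)) ?_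
    filter_upwards [ae_restrict_mem measurableSet_ball] with w hw
    rw [norm_mul]
    refine mul_le_mul_of_nonneg_left ((norm_dbar_le _ _ _).trans ?_) (norm_nonneg _)
    refine mul_le_mul_of_nonneg_right ?_ (norm_nonneg _)
    have hm : ‖Sft y + w • e0‖ < R := cons_lt hy' (by simpa using (mem_ball_zero_iff.1 hw).le)
    refine norm_fderiv_le_of_lip' ℝ (by positivity) ?_
    filter_upwards [isOpen_ball.mem_nhds (show Sft y + w • e0 ∈ ball (0:L1) R by simpa using hm)] with q hq
    refine (h.lip _ _ (by simpa using hq) hm _).trans (le_of_eq (by ring))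
end PartI

section PartJ
open MeasureTheory Metric Filter Topology

def Vs (R ρ : ℝ) : Set L1 := {z | ‖Lft z‖ < R - ρ}

theorem Vs_open (R ρ : ℝ) : IsOpen (Vs R ρ) := isOpen_lt (by fun_prop) continuous_const

section
variable {R A ρ a D : ℝ} {f : L1 → L1 → ℂ} {χ : ℂ → ℂ}

theorem out_zero (hχ : Cut a ρ D χ) {q : L1} (hq : q ∈ Vs R ρ) (hR : ¬ ‖q‖ < R) :
    χ (c0 q) = 0 ∧ db χ (c0 q) = 0 := by
  have h1 : ‖Lft q‖ < R - ρ := hq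
  have h2 := l1_split q
  have : ρ ≤ ‖c0 q‖ := by linarith
  exact ⟨hχ.zero _ this, hχ.d0 _ this⟩

theorem FC.cutF (h : FC R A f) (hχ : Cut a ρ D χ) :
    Sol (Vs R ρ) (fun z => χ (c0 z) * f z e0)
      (fun z ξ => db χ (c0 z) * (starRingEnd ℂ (c0 ξ) * f z e0) + χ (c0 z) * dbar (fun w => f w e0) z ξ) := by
  have ev : ∀ q ∈ Vs R ρ, ¬ ‖q‖ < R → ∀ᶠ p in 𝓝 q, χ (c0 p) = 0 := by
    intro q hq hR
    have h1 : ‖Lft q‖ < R - ρ := hq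
    have h2 := l1_split q
    have h3 : ρ < ‖c0 q‖ := by linarith
    have hc : Continuous fun p : L1 => ‖c0 p‖ := by fun_prop
    filter_upwards [hc.continuousAt.eventually (lt_mem_nhds h3)] with p hp using hχ.zero _ (le_of_lt hp)
  have hcd : ContDiff ℝ 1 (fun z : L1 => χ (c0 z)) := hχ.smooth.comp (c0.restrictScalars ℝ).contDiff
  refine ⟨cutmul isOpen_ball hcd (h.sol e0).1 fun p hp => ?_, fun z hz ξ => ?_⟩
  · by_cases hR : ‖p‖ < R
    · exact Or.inl (by simpa using hR)
    · exact Or.inr (ev p hp hR)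
  · by_cases hR : ‖z‖ < R
    · rw [dbar_mul (hcd.differentiable (by norm_num) z) ((h.sol e0).diffAt isOpen_ball (by simpa using hR))]
      have e1 : dbar (fun z : L1 => χ (c0 z)) z ξ = starRingEnd ℂ (c0 ξ) * db χ (c0 z) := by
        have := dbar_comp_affine (u := χ) c0 0 z ξ (hχ.smooth.differentiable (by norm_num) _)
        simp only [add_zero] at this
        rw [this, db, ← dbar_smul_right]; simp
      rw [e1]; ring
    · obtain ⟨o1, o2⟩ := out_zero hχ hz hR
      have e : (fun z => χ (c0 z) * f z e0) =ᶠ[𝓝 z] fun _ => 0 := by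
        filter_upwards [ev z hz hR] with p hp using by rw [hp, zero_mul]
      rw [dbar_congr e, dbar_const]; beta_reduce; rw [o1, o2]; ring

theorem FC.cutB (h : FC R A f) (hA : 0 ≤ A) (hχ : Cut a ρ D χ) {q : L1} (hq : q ∈ Vs R ρ) :
    ‖χ (c0 q) * f q e0‖ ≤ A := by
  by_cases hR : ‖q‖ < R
  · rw [norm_mul]
    have := h.bd q hR e0
    rw [norm_e0, mul_one] at this
    calc _ ≤ 1 * A := mul_le_mul (hχ.le _) this (norm_nonneg _) (by norm_num)
      _ = A := one_mul _
  · rw [(out_zero hχ hq hR).1]; simpa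

theorem FC.cutL (h : FC R A f) (hA : 0 ≤ A) (hχ : Cut a ρ D χ) {C : ℝ} (hC : 0 ≤ C)
    (hCl : ∀ w v, ‖χ w - χ v‖ ≤ C * ‖w - v‖) {q p : L1}
    (hq : q ∈ Vs R ρ) (hp : p ∈ Vs R ρ) :
    ‖χ (c0 q) * f q e0 - χ (c0 p) * f p e0‖ ≤ A * (C + 1) * ‖q - p‖ := by
  have h1 : ∀ q p : L1, ‖χ (c0 q) - χ (c0 p)‖ ≤ C * ‖q - p‖ := fun q p => by
    refine (hCl _ _).trans (mul_le_mul_of_nonneg_left ?_ hC)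
    rw [← map_sub]; exact c0_le _
  have key : ∀ q p : L1, q ∈ Vs R ρ → p ∈ Vs R ρ → ‖q‖ < R → 
      ‖χ (c0 q) * f q e0 - χ (c0 p) * f p e0‖ ≤ A * (C + 1) * ‖q - p‖ := by
    intro q p hq hp hqR
    have b1 := h.bd q hqR e0
    rw [norm_e0, mul_one] at b1
    have b2 : ‖χ (c0 p)‖ * ‖f q e0 - f p e0‖ ≤ A * ‖q - p‖ := by
      by_cases hR : ‖p‖ < R
      · have b3 := h.lip q p hqR hR e0
        rw [norm_e0, mul_one] at b3
        calc _ ≤ 1 * (A * ‖q - p‖) := mul_le_mul (hχ.le _) b3 (norm_nonneg _) (by norm_num)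
          _ = _ := one_mul _
      · rw [(out_zero hχ hp hR).1]; simp; positivity
    calc _ = ‖(χ (c0 q) - χ (c0 p)) * f q e0 + χ (c0 p) * (f q e0 - f p e0)‖ := by congr 1; ring
      _ ≤ _ := norm_add_le _ _
      _ ≤ C * ‖q - p‖ * A + A * ‖q - p‖ := by
        rw [norm_mul, norm_mul]
        exact add_le_add (mul_le_mul (h1 q p) b1 (norm_nonneg _) (by positivity)) b2
      _ = _ := by ring
  by_cases hqR : ‖q‖ < R
  · exact key q p hq hp hqR
  · by_cases hpR : ‖p‖ < R
    · rw [norm_sub_rev, norm_sub_rev q]; exact key p q hp hq hpR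
    · rw [(out_zero hχ hq hqR).1, (out_zero hχ hp hpR).1]; simp; positivity

def Tx (χ : ℂ → ℂ) (ρ : ℝ) (f : L1 → L1 → ℂ) (z : L1) : ℂ :=
  -(Real.pi : ℂ)⁻¹ * ∫ ζ in ball 0 (2 * ρ), ζ⁻¹ * (χ (c0 (z + ζ • e0)) * f (z + ζ • e0) e0)

def Ex (χ : ℂ → ℂ) (ρ : ℝ) (f : L1 → L1 → ℂ) (z ξ : L1) : ℂ :=
  (Real.pi : ℂ)⁻¹ * ∫ w in ball 0 ρ, (w - c0 z)⁻¹ * (db χ w * f (Sft (Lft z) + w • e0) (Sft (Lft ξ)))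

theorem line_eq (z : L1) (ζ : ℂ) : z + ζ • e0 = Sft (Lft z) + (c0 z + ζ) • e0 := by
  nth_rw 1 [← decomp z]; rw [add_smul]; abel

theorem inv_int (ρ : ℝ) : IntegrableOn (fun ζ : ℂ => ζ⁻¹) (ball 0 ρ) := by
  have := ka_int (α := 1) (by norm_num) ρ
  refine this.mono' measurable_inv.aestronglyMeasurable (Eventually.of_forall fun ζ => ?_)
  rw [Real.rpow_neg_one, norm_inv]

theorem mem_Vs_line {z : L1} (hz : z ∈ Vs R ρ) (ζ : ℂ) : z + ζ • e0 ∈ Vs R ρ := by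
  simp only [Vs, mem_ofPred_eq, map_add, map_smul, Lft_e0, smul_zero, add_zero] at hz ⊢; exact hz

theorem FC.Tform (h : FC R A f) (hχ : Cut a ρ D χ) {z : L1} (hz : z ∈ Vs R ρ) (hz2 : ‖c0 z‖ < ρ) (ξ : L1) :
    -(Real.pi : ℂ)⁻¹ * ∫ ζ in ball 0 (2 * ρ), ζ⁻¹ *
      (db χ (c0 (z + ζ • e0)) * (starRingEnd ℂ (c0 ξ) * f (z + ζ • e0) e0) +
        χ (c0 (z + ζ • e0)) * dbar (fun w => f w e0) (z + ζ • e0) ξ) = χ (c0 z) * f z ξ + Ex χ ρ f z ξ := by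
  have hy : ‖Lft z‖ < R - ρ := hz
  set y := Lft z with hyd
  set x := c0 z with hx
  have hin : ∀ w : ℂ, ‖w‖ ≤ ρ → Sft y + w • e0 ∈ ball (0:L1) R := fun w hw => by simpa using cons_lt hy hw
  set P : ℂ → ℂ := fun w => db χ w * f (Sft y + w • e0) ξ + χ w * dbar (fun q => f q ξ) (Sft y + w • e0) e0 with hP
  set Q : ℂ → ℂ := fun w => db χ w * f (Sft y + w • e0) (Sft (Lft ξ)) with hQ
  have hPz : ∀ w, ρ ≤ ‖w‖ → P w = 0 := fun w hw => by simp [hP, hχ.zero w hw, hχ.d0 w hw]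
  have hQz : ∀ w, ρ ≤ ‖w‖ → Q w = 0 := fun w hw => by simp [hQ, hχ.d0 w hw]
  have e1 : ∀ w : ℂ, db χ (c0 (Sft y + w • e0)) * (starRingEnd ℂ (c0 ξ) * f (Sft y + w • e0) e0) +
        χ (c0 (Sft y + w • e0)) * dbar (fun w => f w e0) (Sft y + w • e0) ξ = P w - Q w := by
    intro w
    rw [c0_cons]
    by_cases hw : ρ ≤ ‖w‖
    · rw [hPz w hw, hQz w hw, hχ.zero w hw, hχ.d0 w hw]; ring
    · have hm := hin w (not_le.1 hw).le
      have e2 : f (Sft y + w • e0) ξ = f (Sft y + w • e0) (Sft (Lft ξ)) + 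
          starRingEnd ℂ (c0 ξ) * f (Sft y + w • e0) e0 := by
        rw [← h.form.2.1 _ hm, ← h.form.1 _ hm, decomp]
      simp only [hP, hQ]
      rw [e2, h.closed _ hm]; ring
  have hUo : IsOpen ((fun w : ℂ => Sft y + w • e0) ⁻¹' ball (0:L1) R) := isOpen_ball.preimage (by fun_prop)
  have hc : ∀ η, ContinuousOn (fun w : ℂ => f (Sft y + w • e0) η) ((fun w : ℂ => Sft y + w • e0) ⁻¹' ball (0:L1) R) :=
    fun η => (h.sol η).1.continuousOn.comp (by fun_prop) fun w hw => hw
  have hc2 : ContinuousOn (fun w : ℂ => dbar (fun q => f q ξ) (Sft y + w • e0) e0)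
      ((fun w : ℂ => Sft y + w • e0) ⁻¹' ball (0:L1) R) :=
    (dbar_contOn isOpen_ball (h.sol ξ).1 e0).comp (by fun_prop) fun w hw => hw
  have iQ := kernel_cont_integrable x (cut_continuous hχ.dcont hχ.d0 hUo hin (hc (Sft (Lft ξ)))) (ρ := ρ)
    (fun w hw => by simp [hχ.d0 w hw])
  have iP := kernel_cont_integrable x ((cut_continuous hχ.dcont hχ.d0 hUo hin (hc ξ)).add
    (cut_continuous hχ.cont hχ.zero hUo hin hc2)) (ρ := ρ)
    (fun w hw => by simp [hχ.d0 w hw, hχ.zero w hw])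
  have e3 := cps isOpen_ball (h.sol ξ) hχ.smooth hχ.zero (z := Sft y) (ξ := e0) hin x
  have e4 : ∀ ζ : ℂ, ζ⁻¹ * (db χ (c0 (z + ζ • e0)) * (starRingEnd ℂ (c0 ξ) * f (z + ζ • e0) e0) +
        χ (c0 (z + ζ • e0)) * dbar (fun w => f w e0) (z + ζ • e0) ξ) =
      (fun w => (w - x)⁻¹ * P w - (w - x)⁻¹ * Q w) (x + ζ) := by
    intro ζ
    beta_reduce
    rw [line_eq, e1, add_sub_cancel_left, mul_sub]
  rw [set_of_zero]
  · simp_rw [e4]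
    rw [integral_add_left_eq_self (fun w => (w - x)⁻¹ * P w - (w - x)⁻¹ * Q w) x]
    have e5 : ∫ w, ((w - x)⁻¹ * P w - (w - x)⁻¹ * Q w) = (∫ w, (w - x)⁻¹ * P w) - ∫ w, (w - x)⁻¹ * Q w :=
      integral_sub iP iQ
    rw [e5, e3, decomp, Ex, set_of_zero (fun w hw => by rw [hχ.d0 w hw]; ring)]
    have := Complex.ofReal_ne_zero.2 Real.pi_ne_zero
    field_simp
    ring
  · intro ζ hζ
    have : ρ ≤ ‖x + ζ‖ := by
      have := norm_sub_le (x + ζ) x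
      rw [add_sub_cancel_left] at this; linarith
    rw [e4]; beta_reduce
    rw [hPz _ this, hQz _ this]; ring

theorem kitT (hχ : Cut a ρ D χ) : ∃ K, 0 ≤ K ∧ ∀ R A f, 0 ≤ A → FC R A f →
    Sol {z | ‖Lft z‖ < R - ρ ∧ ‖c0 z‖ < ρ} (Tx χ ρ f) (fun z ξ => χ (c0 z) * f z ξ + Ex χ ρ f z ξ) ∧
    (∀ z, ‖Lft z‖ < R - ρ → ‖Tx χ ρ f z‖ ≤ K * A) ∧
    ∀ z, ‖Lft z‖ < R - ρ → ‖Tx χ ρ f z - Tx χ ρ f (Sft (Lft z))‖ ≤ K * A * ‖c0 z‖ := by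
  obtain ⟨C, hC⟩ := ContDiff.lipschitzWith_of_hasCompactSupport hχ.compact hχ.smooth one_ne_zero
  have hC' : ∀ w v, ‖χ w - χ v‖ ≤ C * ‖w - v‖ := fun w v => by simpa [dist_eq_norm] using hC.dist_le_mul w v
  set I := ∫ ζ in ball (0:ℂ) (2 * ρ), ‖ζ⁻¹‖ with hI
  have hI0 : 0 ≤ I := integral_nonneg fun _ => norm_nonneg _
  have hpi : ‖-(Real.pi : ℂ)⁻¹‖ = Real.pi⁻¹ := by simp [abs_of_pos Real.pi_pos]
  have hpp := Real.pi_pos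
  refine ⟨Real.pi⁻¹ * (C + 1) * I, by positivity, fun R A f hA h => ?_⟩
  have hF := h.cutF hχ
  have hcd : ContDiff ℝ 1 (fun p : L1 × ℂ => p.1 + p.2 • e0) := contDiff_fst.add (contDiff_snd.smul contDiff_const)
  have hso : IsOpen {z : L1 | ‖Lft z‖ < R - ρ ∧ ‖c0 z‖ < ρ} :=
    (Vs_open R ρ).inter (isOpen_lt (continuous_norm.comp c0.continuous) continuous_const)
  have hint : ∀ z ∈ Vs R ρ, IntegrableOn (fun ζ : ℂ => ζ⁻¹ * (χ (c0 (z + ζ • e0)) * f (z + ζ • e0) e0)) (ball 0 (2 * ρ)) := by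
    intro z hz
    have hc : Continuous (fun ζ : ℂ => χ (c0 (z + ζ • e0)) * f (z + ζ • e0) e0) :=
      continuousOn_univ.1 (hF.1.continuousOn.comp (by fun_prop) fun ζ _ => mem_Vs_line hz ζ)
    refine ((inv_int _).norm.mul_const A).mono' ((inv_int _).1.mul hc.aestronglyMeasurable)
      (Eventually.of_forall fun ζ => ?_)
    rw [norm_mul]
    exact mul_le_mul_of_nonneg_left (h.cutB hA hχ (mem_Vs_line hz ζ)) (norm_nonneg _)
  refine ⟨?_, fun z hz => ?_, fun z hz => ?_⟩
  · have hp := pint (G := fun z ζ => χ (c0 (z + ζ • e0)) * f (z + ζ • e0) e0) (L := A * (C + 1)) (B := A)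
      (κ := fun ζ => ζ⁻¹) (ρ := 2 * ρ) (U := {p : L1 × ℂ | p.1 + p.2 • e0 ∈ Vs R ρ}) hso
      ((Vs_open R ρ).preimage hcd.continuous) (fun p hp ζ _ => mem_Vs_line hp.1 ζ)
      (hF.1.comp hcd.contDiffOn fun p hp => hp) (by positivity)
      (fun p hp q hq ζ _ => (h.cutL hA hχ (NNReal.coe_nonneg C) hC' (mem_Vs_line hp.1 ζ) (mem_Vs_line hq.1 ζ)).trans
        (le_of_eq (by rw [add_sub_add_right_eq_sub])))
      (fun p hp ζ _ => h.cutB hA hχ (mem_Vs_line hp.1 ζ)) (inv_int _)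
    refine (hp.const_mul hso (-(Real.pi : ℂ)⁻¹)).congr hso (fun _ _ => rfl) fun z hz ξ => ?_
    rw [← h.Tform hχ hz.1 hz.2 ξ]
    congr 1
    refine integral_congr_ae (Eventually.of_forall fun ζ => ?_)
    beta_reduce
    have := dbar_comp_affine (u := fun z => χ (c0 z) * f z e0) (ContinuousLinearMap.id ℂ L1) (ζ • e0) z ξ
      (hF.diffAt (Vs_open R ρ) (mem_Vs_line hz.1 ζ))
    simp only [ContinuousLinearMap.id_apply] at this
    exact congrArg (ζ⁻¹ * ·) ((hF.2 _ (mem_Vs_line hz.1 ζ) ξ).symm.trans this.symm)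
  · rw [Tx, norm_mul, hpi]
    have : ‖∫ ζ in ball 0 (2 * ρ), ζ⁻¹ * (χ (c0 (z + ζ • e0)) * f (z + ζ • e0) e0)‖ ≤ I * A := by
      rw [hI, ← integral_mul_const]
      refine norm_integral_le_of_norm_le ((inv_int _).norm.mul_const A) (Eventually.of_forall fun ζ => ?_)
      rw [norm_mul]
      exact mul_le_mul_of_nonneg_left (h.cutB hA hχ (mem_Vs_line hz ζ)) (norm_nonneg _)
    calc _ ≤ Real.pi⁻¹ * (I * A) := mul_le_mul_of_nonneg_left this (by positivity)
      _ = Real.pi⁻¹ * 1 * I * A := by ring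
      _ ≤ _ := by gcongr; simp
  · have hz' : Sft (Lft z) ∈ Vs R ρ := by simpa [Vs, Lft_Sft] using hz
    rw [Tx, Tx, ← mul_sub, norm_mul, hpi, ← integral_sub (hint z hz) (hint _ hz')]
    have : ‖∫ ζ in ball 0 (2 * ρ), (ζ⁻¹ * (χ (c0 (z + ζ • e0)) * f (z + ζ • e0) e0) - 
        ζ⁻¹ * (χ (c0 (Sft (Lft z) + ζ • e0)) * f (Sft (Lft z) + ζ • e0) e0))‖ ≤ I * (A * (C + 1) * ‖c0 z‖) := by
      rw [hI, ← integral_mul_const]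
      refine norm_integral_le_of_norm_le ((inv_int _).norm.mul_const _) (Eventually.of_forall fun ζ => ?_)
      rw [← mul_sub, norm_mul]
      refine mul_le_mul_of_nonneg_left ((h.cutL hA hχ (NNReal.coe_nonneg C) hC' (mem_Vs_line hz ζ) (mem_Vs_line hz' ζ)).trans 
        (le_of_eq ?_)) (norm_nonneg _)
      congr 1
      rw [add_sub_add_right_eq_sub]
      nth_rw 1 [← decomp z]
      rw [add_sub_cancel_left, norm_smul, norm_e0, mul_one]
    calc _ ≤ Real.pi⁻¹ * (I * (A * (C + 1) * ‖c0 z‖)) := mul_le_mul_of_nonneg_left this (by positivity)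
      _ = _ := by ring

end
end PartJ

section PartK
open MeasureTheory Metric Filter Topology

section
variable {R A ρ a D ρ' a' D' : ℝ} {f : L1 → L1 → ℂ} {χ χ' : ℂ → ℂ}

def kap (χ : ℂ → ℂ) (j : ℕ) (w : ℂ) : ℂ := (Real.pi : ℂ)⁻¹ * (db χ w * (w ^ (j + 1))⁻¹)

theorem norm_pi_inv : ‖(Real.pi : ℂ)⁻¹‖ = Real.pi⁻¹ := by simp [abs_of_pos Real.pi_pos]

theorem ball_int {κ : ℂ → ℂ} {M : ℝ} (hρ : 0 ≤ ρ) (hm : Measurable κ)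
    (hb : ∀ w, ‖κ w‖ ≤ Real.pi⁻¹ * M) :
    IntegrableOn κ (ball 0 ρ) ∧ ∫ w in ball 0 ρ, ‖κ w‖ ≤ ρ ^ 2 * M := by
  have h1 : IntegrableOn κ (ball 0 ρ) := 
    Measure.integrableOn_of_bounded (M := Real.pi⁻¹ * M) measure_ball_lt_top.ne
      hm.aestronglyMeasurable (Eventually.of_forall hb)
  refine ⟨h1, ?_⟩
  have h2 := setIntegral_mono_on h1.norm (integrableOn_const (C := Real.pi⁻¹ * M) measure_ball_lt_top.ne)
    measurableSet_ball (fun w _ => hb w)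
  refine h2.trans (le_of_eq ?_)
  rw [setIntegral_const, Measure.real, Complex.volume_ball]
  have := Real.pi_ne_zero
  simp [ENNReal.toReal_ofReal hρ]
  field_simp

theorem kap_bd (hχ : Cut a ρ D χ) (ha : 0 < a) (j : ℕ) (w : ℂ) :
    ‖kap χ j w‖ ≤ Real.pi⁻¹ * (D * (a ^ (j + 1))⁻¹) := by
  have hp := Real.pi_pos
  have hD := hχ.Dnonneg
  rw [kap, norm_mul, norm_pi_inv, norm_mul]
  refine mul_le_mul_of_nonneg_left ?_ (by positivity)
  by_cases hw : ‖w‖ ≤ a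
  · rw [hχ.d1 w hw]; simp; positivity
  · rw [norm_inv, norm_pow]
    have := (not_le.1 hw).le
    have := hχ.dle w
    gcongr

theorem kap_meas (hχ : Cut a ρ D χ) (j : ℕ) : Measurable (kap χ j) := by
  have := hχ.dcont.measurable
  unfold kap; fun_prop

theorem kap_int (hχ : Cut a ρ D χ) (ha : 0 < a) (j : ℕ) {r : ℝ} (hr : 0 ≤ r) :
    IntegrableOn (kap χ j) (ball 0 r) ∧ ∫ w in ball 0 r, ‖kap χ j w‖ ≤ r ^ 2 * (D * (a ^ (j + 1))⁻¹) :=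
  ball_int hr (kap_meas hχ j) (kap_bd hχ ha j)

theorem geo_inv {w x : ℂ} (hw0 : w ≠ 0) (hwx : w - x ≠ 0) (s : ℕ) :
    (w - x)⁻¹ = ∑ j ∈ Finset.range s, x ^ j * (w ^ (j + 1))⁻¹ + x ^ s * ((w ^ s)⁻¹ * (w - x)⁻¹) := by
  induction s with
  | zero => simp
  | succ n ih =>
    rw [Finset.sum_range_succ]
    nth_rw 1 [ih]
    field_simp
    ring

theorem expand (hχ : Cut a ρ D χ) (ha : 0 < a) (hρ : 0 ≤ ρ) (hA : 0 ≤ A) (h : FC R A f) {z : L1} (hz : ‖Lft z‖ < R - ρ)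
    (hx : ‖c0 z‖ < a) (s : ℕ) (ξ : L1) :
    ‖Ex χ ρ f z ξ - ∑ j ∈ Finset.range s, c0 z ^ j * fk (kap χ j) ρ f (Lft z) (Lft ξ)‖ ≤
      A * (ρ ^ 2 * D * (a - ‖c0 z‖)⁻¹) * (‖c0 z‖ / a) ^ s * ‖ξ‖ := by
  set x := c0 z with hxd
  have hD := hχ.Dnonneg
  have hp := Real.pi_pos
  have hax : 0 < a - ‖x‖ := by linarith
  set κ : ℂ → ℂ := fun w => (Real.pi : ℂ)⁻¹ * (x ^ s * ((w ^ s)⁻¹ * ((w - x)⁻¹ * db χ w))) with hκ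
  have hκb : ∀ w, ‖κ w‖ ≤ Real.pi⁻¹ * (D * (a - ‖x‖)⁻¹ * (‖x‖ / a) ^ s) := by
    intro w
    simp only [hκ]
    rw [norm_mul, norm_pi_inv]
    refine mul_le_mul_of_nonneg_left ?_ (by positivity)
    by_cases hw : ‖w‖ ≤ a
    · rw [hχ.d1 w hw]; simp; positivity
    · have h1 := (not_le.1 hw).le
      have h2 := hχ.dle w
      have h3 : a - ‖x‖ ≤ ‖w - x‖ := by have := norm_sub_norm_le w x; linarith
      rw [norm_mul, norm_mul, norm_mul, norm_inv, norm_inv, norm_pow, norm_pow]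
      calc _ ≤ ‖x‖ ^ s * ((a ^ s)⁻¹ * ((a - ‖x‖)⁻¹ * D)) := by gcongr
        _ = _ := by rw [div_pow]; field_simp
  have hκm : Measurable κ := by
    have := hχ.dcont.measurable
    simp only [hκ]; fun_prop
  obtain ⟨i1, i2⟩ := ball_int hρ hκm hκb
  have e1 : Ex χ ρ f z ξ = ∑ j ∈ Finset.range s, x ^ j * fk (kap χ j) ρ f (Lft z) (Lft ξ) + fk κ ρ f (Lft z) (Lft ξ) := by
    have i3 : ∀ j ∈ Finset.range s, IntegrableOn (fun w => x ^ j * (kap χ j w * f (Sft (Lft z) + w • e0) (Sft (Lft ξ)))) (ball 0 ρ) :=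
      fun j _ => ((h.int (kap_int hχ ha j hρ).1 hz _).1.const_mul (x ^ j))
    have i4 := (h.int i1 hz (Sft (Lft ξ))).1
    unfold Ex fk
    simp_rw [← integral_const_mul]
    rw [← integral_finsetSum _ i3, ← integral_add (integrable_finsetSum _ i3) i4]
    refine integral_congr_ae (Eventually.of_forall fun w => ?_)
    beta_reduce
    simp only [kap, hκ]
    by_cases hw : ‖w‖ ≤ a
    · simp [hχ.d1 w hw]
    · have hw0 : w ≠ 0 := fun h => hw (by simp [h, ha.le])
      have hwx : w - x ≠ 0 := fun h => hw (by rw [sub_eq_zero.1 h]; exact hx.le)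
      have e2 := geo_inv hw0 hwx s
      have e3 : (w - c0 z)⁻¹ = (w - x)⁻¹ := rfl
      rw [e3]
      nth_rw 1 [e2]
      rw [add_mul, Finset.sum_mul, mul_add, Finset.mul_sum]
      congr 1
      · refine Finset.sum_congr rfl fun j _ => by ring
      · ring
  rw [e1, add_sub_cancel_left]
  refine (h.int i1 hz (Sft (Lft ξ))).2.trans ?_
  rw [norm_Sft]
  have h4 := Lft_le ξ
  calc _ ≤ A * (ρ ^ 2 * (D * (a - ‖x‖)⁻¹ * (‖x‖ / a) ^ s)) * ‖ξ‖ := by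
        refine mul_le_mul (mul_le_mul_of_nonneg_left i2 hA) h4 (norm_nonneg _) (by positivity)
    _ = _ := by ring

theorem fk_shrink {κ : ℂ → ℂ} (hρ : ρ' ≤ ρ) (hκ : ∀ w, ρ' ≤ ‖w‖ → κ w = 0) (y η : L1) :
    fk κ ρ f y η = fk κ ρ' f y η := by
  rw [fk, fk, set_of_zero (fun w hw => by rw [hκ w (hρ.trans hw), zero_mul]),
    set_of_zero (fun w hw => by rw [hκ w hw, zero_mul])]

theorem kap_zero (hχ : Cut a ρ D χ) (j : ℕ) (w : ℂ) (hw : ρ ≤ ‖w‖) : kap χ j w = 0 := by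
  simp [kap, hχ.d0 w hw]

theorem aj_ex (hχ : Cut a ρ D χ) (hχ' : Cut a' ρ' D' χ') (ha : 0 < a') (haa : a' ≤ a) (hρ : ρ' ≤ ρ) (hρ0 : 0 ≤ ρ')
    (hA : 0 ≤ A) (h : FC R A f) (j : ℕ) : ∃ u : L1 → ℂ,
    Sol (ball 0 (R - ρ)) u (fun y η => fk (kap χ' j) ρ' f y η - fk (kap χ j) ρ f y η) ∧
    ∀ y : L1, ‖y‖ < R - ρ → ‖u y‖ ≤ A * (2 * Real.pi⁻¹ * (∫ w in ball (0:ℂ) ρ, ‖w⁻¹‖) * (a' ^ j)⁻¹) := by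
  have hp := Real.pi_pos
  set g : ℂ → ℂ := fun w => (Real.pi : ℂ)⁻¹ * (w ^ (j + 1))⁻¹ with hg
  have hgd : ∀ w ≠ 0, DifferentiableAt ℂ g w := fun w hw => by
    simp only [hg]
    exact ((differentiableAt_id.pow _).inv (pow_ne_zero _ hw)).const_mul _
  have hgc : ContDiffOn ℝ 1 g {0}ᶜ := fun w hw => by
    have : ContDiffAt ℂ 1 g w := contDiffAt_const.mul ((contDiffAt_id.pow _).inv (pow_ne_zero _ hw))
    exact (this.restrict_scalars ℝ).contDiffWithinAt
  set k : ℂ → ℂ := fun w => (χ w - χ' w) * g w with hk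
  have hz1 : ∀ w, ‖w‖ ≤ a' → χ w - χ' w = 0 := fun w hw => by
    rw [hχ.one w (hw.trans haa), hχ'.one w hw, sub_self]
  have hev : ∀ᶠ w in 𝓝 (0:ℂ), k w = 0 := by
    filter_upwards [ball_mem_nhds (0:ℂ) ha] with w hw
    simp only [hk]; rw [hz1 w (by simpa using (mem_ball_zero_iff.1 hw).le), zero_mul]
  have hkc : ContDiff ℝ 1 k := by
    rw [← contDiffOn_univ]
    refine cutmul isOpen_compl_singleton (hχ.smooth.sub hχ'.smooth) hgc fun w _ => ?_
    by_cases hw : w = 0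
    · right; rw [hw]
      filter_upwards [ball_mem_nhds (0:ℂ) ha] with w hw
      exact hz1 w (by simpa using (mem_ball_zero_iff.1 hw).le)
    · exact Or.inl hw
  have hdb : ∀ w, db k w = kap χ j w - kap χ' j w := by
    intro w
    by_cases hw : w = 0
    · rw [hw, db_zero_of_eventually (c := 0) hev, kap, kap, hχ.d1 0 (by simpa using ha.le.trans haa), hχ'.d1 0 (by simpa using ha.le)]
      ring
    · have d1 := hχ.smooth.differentiable (by norm_num) w
      have d2 := hχ'.smooth.differentiable (by norm_num) w
      have e2 : dbar g w 1 = 0 := dbar_eq_zero_of_complex (hgd w hw) 1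
      rw [db, hk, dbar_mul (u := fun w => χ w - χ' w) (d1.sub d2) ((hgd w hw).restrictScalars ℝ), e2, dbar_sub d1 d2]
      simp only [kap, hg, db]; ring
  have hkz : ∀ w, ρ ≤ ‖w‖ → k w = 0 := fun w hw => by
    simp only [hk]; rw [hχ.zero w hw, hχ'.zero w (hρ.trans hw)]; ring
  have hdz : ∀ w, ρ ≤ ‖w‖ → db k w = 0 := fun w hw => by
    rw [hdb, kap_zero hχ j w hw, kap_zero hχ' j w (hρ.trans hw), sub_zero]
  have hρ1 := hρ0.trans hρ
  have i1 := (kap_int hχ (ha.trans_le haa) j hρ1).1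
  have i2 := (kap_int hχ' ha j hρ1).1
  have hdi : IntegrableOn (db k) (ball 0 ρ) := by
    have : db k = fun w => kap χ j w - kap χ' j w := funext hdb
    rw [this]; exact i1.sub i2
  have hkb : ∀ w, ‖k w‖ ≤ ‖w⁻¹‖ * (2 * Real.pi⁻¹ * (a' ^ j)⁻¹) := by
    intro w
    by_cases hw : ‖w‖ ≤ a'
    · simp only [hk]; rw [hz1 w hw]; simp; positivity
    · have h1 := (not_le.1 hw).le
      have h2 : ‖χ w - χ' w‖ ≤ 2 := (norm_sub_le _ _).trans (by linarith [hχ.le w, hχ'.le w])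
      simp only [hk, hg]
      rw [norm_mul, norm_mul, norm_pi_inv, norm_inv, norm_pow, pow_succ, mul_inv, norm_inv]
      calc _ ≤ 2 * (Real.pi⁻¹ * ((a' ^ j)⁻¹ * ‖w‖⁻¹)) := by gcongr
        _ = _ := by ring
  have hi := (inv_int ρ).norm.mul_const (2 * Real.pi⁻¹ * (a' ^ j)⁻¹)
  have hki : IntegrableOn k (ball 0 ρ) :=
    hi.mono' hkc.continuous.aestronglyMeasurable (Eventually.of_forall hkb)
  refine ⟨_, (h.ak hA hkc hkz hdz hki hdi).congr isOpen_ball (fun _ _ => rfl) fun y hy η => ?_, fun y hy => ?_⟩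
  · have hy' : ‖y‖ < R - ρ := by simpa using hy
    beta_reduce
    rw [← fk_shrink hρ (kap_zero hχ' j), fk, fk, fk, neg_eq_iff_eq_neg.2, ]
    rw [neg_sub, ← integral_sub (h.int i1 hy' _).1 (h.int i2 hy' _).1]
    refine integral_congr_ae (Eventually.of_forall fun w => ?_)
    beta_reduce
    rw [hdb]; ring
  · refine (h.int hki hy e0).2.trans ?_
    rw [norm_e0, mul_one]
    refine mul_le_mul_of_nonneg_left ?_ hA
    refine (integral_mono hki.norm hi hkb).trans (le_of_eq ?_)
    rw [integral_mul_const]; ring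

end
end PartK

section PartL
open MeasureTheory Metric Filter Topology

def CB : ℝ := 4 * (1 + D0)

theorem CB_four : 4 ≤ CB := by have := D0_nonneg; unfold CB; linarith

theorem nb1 {x ε : ℝ} (hx : 0 ≤ x) (hε : 0 < ε) {j : ℕ} (hj : 1 ≤ j) :
    x ^ j * (2 / (j * ε)) ^ j ≤ (2 * x / ε) ^ j / j.factorial := by
  have hj0 : (0:ℝ) < j := by exact_mod_cast hj
  have h1 : ((j.factorial : ℕ) : ℝ) ≤ (j:ℝ) ^ j := by exact_mod_cast Nat.factorial_le_pow j
  have h2 : (0:ℝ) < j.factorial := by exact_mod_cast j.factorial_pos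
  rw [← mul_pow]
  calc _ = (2 * x / ε) ^ j / (j:ℝ) ^ j := by rw [← div_pow]; congr 1; field_simp
    _ ≤ _ := by gcongr

theorem nb2 {j : ℕ} (hj : 1 ≤ j) : 2 * D0 * 2 ^ j ≤ CB ^ j := by
  obtain ⟨i, rfl⟩ := Nat.exists_eq_add_of_le' hj
  have h1 : (2:ℝ) ^ i ≤ CB ^ i := by have := CB_four; gcongr; linarith
  have h2 : 4 * D0 ≤ CB := by unfold CB; linarith
  have h3 := D0_nonneg
  have h4 := CB_four
  calc 2 * D0 * 2 ^ (i + 1) = 2 ^ i * (4 * D0) := by ring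
    _ ≤ CB ^ i * CB := by gcongr
    _ = _ := by ring

theorem nb3 {x ε : ℝ} (hx : 0 ≤ x) (hε : 0 < ε) {j s : ℕ} (hj : 1 ≤ j) (hjs : j ≤ s) :
    x ^ j * (2 * D0 * (2 / (j * ε)) ^ j) * CB ^ (s - j) ≤ CB ^ s * ((x / ε) ^ j / j.factorial) := by
  have h1 := nb1 hx hε hj
  have h2 := nb2 hj
  have h3 := D0_nonneg
  have h4 := CB_four
  have h5 : CB ^ s = CB ^ j * CB ^ (s - j) := by rw [← pow_add]; congr 1; omega
  calc _ = 2 * D0 * (x ^ j * (2 / (j * ε)) ^ j) * CB ^ (s - j) := by ring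
    _ ≤ 2 * D0 * ((2 * x / ε) ^ j / j.factorial) * CB ^ (s - j) := by
      have : 0 ≤ CB := by linarith
      gcongr
    _ = 2 * D0 * 2 ^ j * ((x / ε) ^ j / j.factorial) * CB ^ (s - j) := by
      rw [mul_div_assoc, mul_pow]; ring
    _ ≤ CB ^ j * ((x / ε) ^ j / j.factorial) * CB ^ (s - j) := by
      have : 0 ≤ CB := by linarith
      gcongr
    _ = _ := by rw [h5]; ring

theorem nb_binom (X Y : ℝ) (s : ℕ) : ∑ j ∈ Finset.range (s + 1), X ^ j / j.factorial * (Y ^ (s - j) / (s - j).factorial) =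
    (X + Y) ^ s / s.factorial := by
  rw [add_pow, Finset.sum_div]
  refine Finset.sum_congr rfl fun j hj => ?_
  have hj' : j ≤ s := by simp at hj; omega
  rw [Nat.cast_choose ℝ hj']
  have := s.factorial_ne_zero
  have := j.factorial_ne_zero
  have := (s-j).factorial_ne_zero
  field_simp

theorem nb_exp {a : ℝ} (ha : 0 ≤ a) (t : ℕ) :
    ∑ i ∈ Finset.range t, a ^ (i + 1) / (i + 1).factorial ≤ a * Real.exp a := by
  have h1 := Real.sum_le_exp_of_nonneg ha (t + 1)
  rw [Finset.sum_range_succ'] at h1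
  simp only [pow_zero, Nat.factorial_zero, Nat.cast_one, div_one] at h1
  have h2 := Real.add_one_le_exp (-a)
  have h3 : Real.exp a * Real.exp (-a) = 1 := by rw [← Real.exp_add]; simp
  nlinarith [Real.exp_pos a]

def Dep (N : ℕ) (f : L1 → L1 → ℂ) : Prop := ∀ z ξ, f z ξ = f (trn N z) (trn N ξ)

theorem Dep.fk {N : ℕ} {f} (h : Dep (N + 1) f) (κ : ℂ → ℂ) (ρ : ℝ) : Dep N (fk κ ρ f) := by
  intro y η
  rw [_root_.fk, _root_.fk]
  refine integral_congr_ae (Eventually.of_forall fun w => ?_)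
  beta_reduce
  rw [h, h (Sft (trn N y) + w • e0)]
  simp only [trn_succ, c0_cons, Lft_cons, Lft_Sft, c0_Sft, trn_idem]

theorem Dep.sft {N : ℕ} {f} (h : Dep (N + 1) f) : Dep N (fun y η => f (Sft y) (Sft η)) := by
  intro y η
  beta_reduce
  rw [h, h (Sft (trn N y))]
  simp only [trn_succ, Lft_Sft, c0_Sft, trn_idem]

def BCl (b K : ℝ) (N s : ℕ) : Prop := ∀ (ε A : ℝ) (f : L1 → L1 → ℂ), 0 < ε → s * ε ≤ b → 0 ≤ A → FC (s * ε + 5 * b) A f → Dep N f →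
  ∃ (U : L1 → ℂ) (g : L1 → L1 → ℂ), Sol (ball 0 b) U (fun z ξ => f z ξ - g z ξ) ∧
    (∀ z : L1, ‖z‖ < b → ∀ ξ, ‖g z ξ‖ ≤ A * CB ^ s * ((‖z‖ / ε) ^ s / s.factorial) * ‖ξ‖) ∧
    ∀ z : L1, ‖z‖ < b → ‖U z‖ ≤ A * (K / ε) * CB ^ s * ‖z‖ * Real.exp (2 * ‖z‖ / ε)

theorem BCl_zero {b K : ℝ} (hb : 0 < b) (hK : 0 ≤ K) (N : ℕ) : BCl b K N 0 := by
  intro ε A f hε hs hA h hd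
  refine ⟨fun _ => 0, f, (Sol.const 0).congr isOpen_ball (fun _ _ => rfl) (fun z hz ξ => sub_self _), ?_, ?_⟩
  · intro z hz ξ
    simpa using h.bd z (by push_cast; linarith) ξ
  · intro z hz; simp; positivity

theorem BCl_dep0 {b K : ℝ} (hb : 0 < b) (hK : 0 ≤ K) (s : ℕ) : BCl b K 0 s := by
  intro ε A f hε hs hA h hd
  have hc := CB_four
  have hc0 : 0 ≤ CB := by linarith
  have hf : ∀ z ξ, f z ξ = 0 := by
    intro z ξ
    rw [hd, show trn 0 ξ = 0 from rfl]
    have := h.form.2.1 (trn 0 z) ?_ 0 0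
    · simpa using this
    · rw [show trn 0 z = 0 from rfl]; exact mem_ball_self (by positivity)
  refine ⟨fun _ => 0, fun _ _ => 0, (Sol.const 0).congr isOpen_ball (fun _ _ => rfl) (fun z hz ξ => by rw [hf]; simp [zf]), ?_, ?_⟩
  · intro z hz ξ; simp; positivity
  · intro z hz; simp; positivity

theorem coord_sol {Ω : Set L1} (n : ℕ) : Sol Ω (fun z : L1 => c0 z ^ n) (fun _ _ => 0) :=
  Sol.of_complex (fun z => (c0.differentiableAt.pow n)) ((c0.restrictScalars ℝ).contDiff.pow n)

theorem stepj {b K : ℝ} {χ : ℂ → ℂ} (hb : 0 < b) (hχ : Cut (4 * b / 2) (4 * b) (D0 / (4 * b)) χ)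
    {N s j : ℕ} (hj : 1 ≤ j) (hjs : j ≤ s) (ih : BCl b K N (s - j)) {ε A : ℝ} {f : L1 → L1 → ℂ} (hε : 0 < ε)
    (hs : s * ε ≤ b) (hA : 0 ≤ A) (h : FC (s * ε + 5 * b) A f) (hd : Dep (N + 1) f) :
    ∃ (W : L1 → ℂ) (g : L1 → L1 → ℂ), Sol (ball 0 b) W (fun y η => g y η - fk (kap χ j) (4 * b) f y η) ∧
      (∀ y : L1, ‖y‖ < b → ∀ ξ, ‖g y ξ‖ ≤ A * (2 * D0 * (2 / (j * ε)) ^ j) * CB ^ (s - j) *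
        ((‖y‖ / ε) ^ (s - j) / (s - j).factorial) * ‖ξ‖) ∧
      ∀ y : L1, ‖y‖ < b → ‖W y‖ ≤ A * (2 * Real.pi⁻¹ * (∫ w in ball (0:ℂ) (4 * b), ‖w⁻¹‖)) * (2 / (j * ε)) ^ j +
        A * (2 * D0 * (2 / (j * ε)) ^ j) * (K / ε) * CB ^ (s - j) * ‖y‖ * Real.exp (2 * ‖y‖ / ε) := by
  have hj0 : (0:ℝ) < j := by exact_mod_cast hj
  have hjs' : (j:ℝ) ≤ s := by exact_mod_cast hjs
  have hjε : 0 < j * ε := by positivity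
  have hjε2 : j * ε ≤ s * ε := by gcongr
  have hD := D0_nonneg
  obtain ⟨χ', hχ'⟩ := exists_cut_half hjε
  obtain ⟨u, hu, hub⟩ := aj_ex hχ hχ' (by positivity) (by linarith) (by linarith) hjε.le hA h j
  obtain ⟨i1, i2⟩ := kap_int hχ' (by positivity) j hjε.le
  have hcs : ((s - j : ℕ) : ℝ) * ε = s * ε - j * ε := by rw [Nat.cast_sub hjs]; ring
  have hB : (j * ε) ^ 2 * (D0 / (j * ε) * ((j * ε / 2) ^ (j + 1))⁻¹) = 2 * D0 * (2 / (j * ε)) ^ j := by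
    rw [pow_succ, div_pow, div_pow]; field_simp; ring
  rw [hB] at i2
  have hf := h.fk hA i1 i2
  obtain ⟨U, g, h1, h2, h3⟩ := ih ε (A * (2 * D0 * (2 / (j * ε)) ^ j)) (fk (kap χ' j) (j * ε) f) hε
    (by rw [hcs]; linarith) (by positivity) (hf.mono (by rw [hcs]; linarith) le_rfl) (hd.fk _ _)
  have hsub : ball (0:L1) b ⊆ ball 0 (s * ε + 5 * b - 4 * b) := ball_subset_ball (by linarith)
  refine ⟨fun y => u y - U y, g, ((hu.mono hsub).sub isOpen_ball h1).congr isOpen_ball (fun _ _ => rfl) 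
    (fun y _ η => by ring), h2, fun y hy => (norm_sub_le _ _).trans (add_le_add ((hub y (by linarith)).trans (le_of_eq ?_)) (h3 y hy))⟩
  rw [← inv_pow, inv_div]; ring

theorem stepB {b : ℝ} (hb : 0 < b) : ∃ K, 0 ≤ K ∧ ∀ N s, BCl b K N s := by
  obtain ⟨χ, hχ⟩ := exists_cut_half (ρ := 4 * b) (by positivity)
  obtain ⟨K0, hK0, hT⟩ := kitT hχ
  set K1 := 2 * Real.pi⁻¹ * (∫ w in ball (0:ℂ) (4 * b), ‖w⁻¹‖) with hK1
  have hpp := Real.pi_pos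
  have hK1' : 0 ≤ K1 := by
    have : 0 ≤ ∫ w in ball (0:ℂ) (4 * b), ‖w⁻¹‖ := integral_nonneg fun _ => norm_nonneg _
    positivity
  set K := K0 * b + 2 * K1 with hKd
  have hK : 0 ≤ K := by positivity
  have hD := D0_nonneg
  have hC := CB_four
  have hC0 : 0 ≤ CB := by linarith
  refine ⟨K, hK, fun N => ?_⟩
  induction N with
  | zero => exact BCl_dep0 hb hK
  | succ N ih =>
    rintro (_ | t)
    · exact BCl_zero hb hK _
    intro ε A f hε hs hA h hd
    set s := t + 1 with hst
    have hsε : ε ≤ s * ε := by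
      have : (1:ℝ) ≤ s := by exact_mod_cast Nat.le_add_left 1 t
      nlinarith
    have hs0 : (0:ℝ) < s := by positivity
    have hf0 := h.comp (by positivity) Sft (fun z => (norm_Sft z).le)
    obtain ⟨U0, g0, a1, a2, a3⟩ := ih s ε A _ hε hs hA hf0 hd.sft
    have hex := fun i : Fin t => stepj hb hχ (N := N) (s := s) (j := i + 1) (Nat.le_add_left 1 i) (by omega) (ih _) hε hs hA h hd
    choose W G b1 b2 b3 using hex
    obtain ⟨t1, t2, t3⟩ := hT _ A f hA h
    have hsubT : ball (0:L1) b ⊆ {z | ‖Lft z‖ < s * ε + 5 * b - 4 * b ∧ ‖c0 z‖ < 4 * b} := fun z hz => by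
      have hz' : ‖z‖ < b := by simpa using hz
      exact ⟨by linarith [Lft_le z], by linarith [c0_le z]⟩
    have hTo : IsOpen {z : L1 | ‖Lft z‖ < s * ε + 5 * b - 4 * b ∧ ‖c0 z‖ < 4 * b} :=
      (Vs_open _ _).inter (isOpen_lt (continuous_norm.comp c0.continuous) continuous_const)
    have hL : ∀ z ∈ ball (0:L1) b, Lft z ∈ ball (0:L1) b := fun z hz => by
      have hz' : ‖z‖ < b := by simpa using hz
      simpa using (Lft_le z).trans_lt hz'
    have hSL : ∀ z ∈ ball (0:L1) b, (Sft.comp Lft) z ∈ ball (0:L1) b := fun z hz => by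
      simpa [norm_Sft] using hL z hz
    have S1 := (t1.mono hsubT).sub isOpen_ball ((t1.mono hsubT).comp isOpen_ball (Sft.comp Lft) hSL)
    have S2 := a1.comp isOpen_ball Lft hL
    have S3 := Sol.sum isOpen_ball Finset.univ fun (i : Fin t) _ =>
      (coord_sol (i + 1 : ℕ)).mul isOpen_ball ((b1 i).comp isOpen_ball Lft hL)
    have S := (S1.add isOpen_ball S2).add isOpen_ball S3
    refine ⟨_, fun z ξ => g0 (Lft z) (Lft ξ) - ∑ i : Fin t, c0 z ^ (i + 1 : ℕ) * G i (Lft z) (Lft ξ) - 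
      (Ex χ (4 * b) f z ξ - ∑ j ∈ Finset.range s, c0 z ^ j * fk (kap χ j) (4 * b) f (Lft z) (Lft ξ)), 
      S.congr isOpen_ball (fun _ _ => rfl) fun z hz ξ => ?_, ?_, ?_⟩
    · have hz' : ‖z‖ < b := by simpa using hz
      have e1 : Ex χ (4 * b) f ((Sft.comp Lft) z) ((Sft.comp Lft) ξ) = fk (kap χ 0) (4 * b) f (Lft z) (Lft ξ) := by
        simp only [Ex, fk, kap, ContinuousLinearMap.comp_apply, Lft_Sft, c0_Sft, sub_zero]
        rw [← integral_const_mul]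
        refine integral_congr_ae (Eventually.of_forall fun w => ?_)
        beta_reduce
        rw [zero_add, pow_one]; ring
      beta_reduce
      rw [e1, hχ.one (c0 z) (by linarith [c0_le z]), hχ.one _ (by simp [c0_Sft]; positivity), hst, Finset.sum_range_succ']
      have e2 : ∀ i : Fin t, (0:ℂ) * W i (Lft z) + c0 z ^ (i + 1 : ℕ) * (G i (Lft z) (Lft ξ) - fk (kap χ (i + 1)) (4 * b) f (Lft z) (Lft ξ)) =
         c0 z ^ (i + 1 : ℕ) * G i (Lft z) (Lft ξ) - c0 z ^ (i + 1 : ℕ) * fk (kap χ (i + 1)) (4 * b) f (Lft z) (Lft ξ) := fun i => by ring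
      rw [Finset.sum_congr rfl fun i _ => e2 i, Finset.sum_sub_distrib,
        Finset.sum_range (fun i => c0 z ^ (i + 1 : ℕ) * fk (kap χ (i + 1)) (4 * b) f (Lft z) (Lft ξ))]
      simp only [ContinuousLinearMap.comp_apply]
      ring
    · intro z hz ξ
      have hz2 := l1_split z
      set x := ‖c0 z‖ with hx
      set y := ‖Lft z‖ with hy
      have hx0 : 0 ≤ x := norm_nonneg _
      have hy0 : 0 ≤ y := norm_nonneg _
      have hLξ := Lft_le ξ
      have r0 : ‖g0 (Lft z) (Lft ξ)‖ ≤ A * CB ^ s * ((x / ε) ^ 0 / (0:ℕ).factorial * ((y / ε) ^ (s - 0) / (s - 0).factorial)) * ‖ξ‖ := by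
        refine (a2 _ (by linarith) _).trans ?_
        simp only [pow_zero, Nat.factorial_zero, Nat.cast_one, div_one, one_mul, Nat.sub_zero]
        gcongr
      have r1 : ∀ i : Fin t, ‖c0 z ^ (i + 1 : ℕ) * G i (Lft z) (Lft ξ)‖ ≤ A * CB ^ s * ((x / ε) ^ (i + 1 : ℕ) / (i + 1 : ℕ).factorial *
          ((y / ε) ^ (s - (i + 1)) / (s - (i + 1)).factorial)) * ‖ξ‖ := by
        intro i
        rw [norm_mul, norm_pow]
        have q1 := b2 i (Lft z) (by linarith) (Lft ξ)
        have q2 := nb3 hx0 hε (j := i + 1) (s := s) (Nat.le_add_left 1 i) (by omega)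
        calc _ ≤ x ^ (i + 1 : ℕ) * (A * (2 * D0 * (2 / ((i + 1 : ℕ) * ε)) ^ (i + 1 : ℕ)) * CB ^ (s - (i + 1)) *
                ((y / ε) ^ (s - (i + 1)) / (s - (i + 1)).factorial) * ‖Lft ξ‖) := by gcongr
          _ = (x ^ (i + 1 : ℕ) * (2 * D0 * (2 / ((i + 1 : ℕ) * ε)) ^ (i + 1 : ℕ)) * CB ^ (s - (i + 1))) * (A *
                ((y / ε) ^ (s - (i + 1)) / (s - (i + 1)).factorial) * ‖Lft ξ‖) := by ring
          _ ≤ (CB ^ s * ((x / ε) ^ (i + 1 : ℕ) / (i + 1 : ℕ).factorial)) * (A *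
                ((y / ε) ^ (s - (i + 1)) / (s - (i + 1)).factorial) * ‖ξ‖) := by gcongr
          _ = _ := by ring
      have r2 : ‖Ex χ (4 * b) f z ξ - ∑ j ∈ Finset.range s, c0 z ^ j * fk (kap χ j) (4 * b) f (Lft z) (Lft ξ)‖ ≤
          A * CB ^ s * ((x / ε) ^ s / s.factorial * ((y / ε) ^ (s - s) / (s - s).factorial)) * ‖ξ‖ := by
        refine (expand hχ (by positivity) (by positivity) hA h (by linarith) (by linarith) s ξ).trans ?_
        simp only [Nat.sub_self, pow_zero, Nat.factorial_zero, Nat.cast_one, div_one, mul_one]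
        have q1 : (4 * b) ^ 2 * (D0 / (4 * b)) * (4 * b / 2 - x)⁻¹ ≤ 4 * D0 := by
          have : b ≤ 4 * b / 2 - x := by linarith
          calc _ ≤ (4 * b) ^ 2 * (D0 / (4 * b)) * b⁻¹ := by gcongr
            _ = _ := by field_simp
        have q2 : (x / (4 * b / 2)) ^ s ≤ (x / ε) ^ s / s.factorial := by
          have := nb1 hx0 hε (j := s) (Nat.le_add_left 1 t)
          calc (x / (4 * b / 2)) ^ s ≤ (x / (2 * (s * ε))) ^ s := by gcongr; linarith
            _ = x ^ s * (2 / (s * ε)) ^ s / 4 ^ s := by rw [← mul_pow, ← div_pow]; congr 1; field_simp; norm_num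
            _ ≤ ((2 * x / ε) ^ s / s.factorial) / 2 ^ s := by
              gcongr; norm_num
            _ = _ := by rw [div_right_comm, ← div_pow]; congr 2; field_simp
        have q3 : 4 * D0 ≤ CB ^ s := by
          have : CB ≤ CB ^ s := le_self_pow₀ (by linarith) (by omega)
          have : 4 * D0 ≤ CB := by unfold CB; linarith
          linarith
        calc _ ≤ A * (4 * D0) * ((x / ε) ^ s / s.factorial) * ‖ξ‖ := by gcongr
          _ ≤ _ := by gcongr
      have hbin := nb_binom (x / ε) (y / ε) s
      rw [Finset.sum_range_succ, hst, Finset.sum_range_succ', ← hst] at hbin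
      have r3 := Finset.sum_le_sum fun (i : Fin t) (_ : i ∈ Finset.univ) => r1 i
      rw [← Finset.sum_mul, ← Finset.mul_sum, ← Finset.sum_range (fun i => (x / ε) ^ (i + 1 : ℕ) / (i + 1 : ℕ).factorial *
          ((y / ε) ^ (s - (i + 1)) / (s - (i + 1)).factorial))] at r3
      refine (norm_sub_le _ _).trans ((add_le_add ((norm_sub_le _ _).trans (add_le_add r0 ((norm_sum_le _ _).trans r3))) r2).trans (le_of_eq ?_))
      rw [hz2, add_div, ← hbin]
      ring
    · intro z hz
      have hz2 := l1_split z
      set x := ‖c0 z‖ with hx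
      set y := ‖Lft z‖ with hy
      have hx0 : 0 ≤ x := norm_nonneg _
      have hy0 : 0 ≤ y := norm_nonneg _
      have hone : 1 ≤ CB ^ s := one_le_pow₀ (by linarith)
      have r0 := t3 z (by linarith)
      have r1 := a3 (Lft z) (by linarith)
      have r2 : ∀ i : Fin t, ‖c0 z ^ (i + 1 : ℕ) * W i (Lft z)‖ ≤ A * K1 * ((2 * x / ε) ^ (i + 1 : ℕ) / (i + 1 : ℕ).factorial) +
          A * (K / ε) * CB ^ s * y * Real.exp (2 * y / ε) * ((x / ε) ^ (i + 1 : ℕ) / (i + 1 : ℕ).factorial) := by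
        intro i
        rw [norm_mul, norm_pow]
        have q1 := b3 i (Lft z) (by linarith)
        have q2 := nb3 hx0 hε (j := i + 1) (s := s) (Nat.le_add_left 1 i) (by omega)
        have q3 := nb1 hx0 hε (j := i + 1) (Nat.le_add_left 1 i)
        calc _ ≤ x ^ (i + 1 : ℕ) * (A * K1 * (2 / ((i + 1 : ℕ) * ε)) ^ (i + 1 : ℕ) + A * (2 * D0 * (2 / ((i + 1 : ℕ) * ε)) ^ (i + 1 : ℕ)) *
                (K / ε) * CB ^ (s - (i + 1)) * y * Real.exp (2 * y / ε)) := by gcongr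
          _ = A * K1 * (x ^ (i + 1 : ℕ) * (2 / ((i + 1 : ℕ) * ε)) ^ (i + 1 : ℕ)) + 
              (x ^ (i + 1 : ℕ) * (2 * D0 * (2 / ((i + 1 : ℕ) * ε)) ^ (i + 1 : ℕ)) * CB ^ (s - (i + 1))) * (A * (K / ε) * y * Real.exp (2 * y / ε)) := by ring
          _ ≤ A * K1 * ((2 * x / ε) ^ (i + 1 : ℕ) / (i + 1 : ℕ).factorial) + 
              (CB ^ s * ((x / ε) ^ (i + 1 : ℕ) / (i + 1 : ℕ).factorial)) * (A * (K / ε) * y * Real.exp (2 * y / ε)) := by gcongr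
          _ = _ := by ring
      have r3 := Finset.sum_le_sum fun (i : Fin t) (_ : i ∈ Finset.univ) => r2 i
      rw [Finset.sum_add_distrib, ← Finset.mul_sum, ← Finset.mul_sum, 
        ← Finset.sum_range (fun i => (2 * x / ε) ^ (i + 1 : ℕ) / (i + 1 : ℕ).factorial),
        ← Finset.sum_range (fun i => (x / ε) ^ (i + 1 : ℕ) / (i + 1 : ℕ).factorial)] at r3
      have s1 := nb_exp (a := 2 * x / ε) (by positivity) t
      have s2 : 1 + ∑ i ∈ Finset.range t, (x / ε) ^ (i + 1 : ℕ) / (i + 1 : ℕ).factorial ≤ Real.exp (2 * x / ε) := by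
        have := Real.sum_le_exp_of_nonneg (x := x / ε) (by positivity) (t + 1)
        rw [Finset.sum_range_succ'] at this
        simp only [pow_zero, Nat.factorial_zero, Nat.cast_one, div_one] at this
        have h5 : Real.exp (x / ε) ≤ Real.exp (2 * x / ε) := Real.exp_le_exp.2 (by gcongr; linarith)
        linarith
      have hE : Real.exp (2 * ‖z‖ / ε) = Real.exp (2 * x / ε) * Real.exp (2 * y / ε) := by
        rw [← Real.exp_add, hz2]; congr 1; ring
      set E := Real.exp (2 * x / ε) with hEd
      set F := Real.exp (2 * y / ε) with hFd
      have hE1 : 1 ≤ E := Real.one_le_exp (by positivity)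
      have hF1 : 1 ≤ F := Real.one_le_exp (by positivity)
      refine (norm_add_le _ _).trans ((add_le_add ((norm_add_le _ _).trans (add_le_add r0 r1)) ((norm_sum_le _ _).trans r3)).trans ?_)
      rw [hE, hz2]
      have hKb : K0 * b + 2 * K1 = K := rfl
      have u1 : K0 * A * x + A * K1 * (2 * x / ε * E) ≤ A * (K / ε) * x * E := by
        have : K0 ≤ K0 * b / ε := by rw [mul_div_assoc]; exact le_mul_of_one_le_right hK0 ((one_le_div hε).2 (by linarith))
        calc _ ≤ (K0 * b / ε) * A * x * E + A * K1 * (2 * x / ε * E) := by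
              refine add_le_add ((mul_le_mul_of_nonneg_right (mul_le_mul_of_nonneg_right this hA) hx0).trans (le_mul_of_one_le_right (by positivity) hE1)) le_rfl
          _ = A * ((K0 * b + 2 * K1) / ε) * x * E := by ring
          _ = _ := by rw [hKb]
      have u2 : A * (K / ε) * x * E ≤ A * (K / ε) * CB ^ s * x * (E * F) := by
        calc A * (K / ε) * x * E = A * (K / ε) * 1 * x * (E * 1) := by ring
          _ ≤ _ := by gcongr
      have u3 : A * (K / ε) * CB ^ s * y * F * (1 + ∑ i ∈ Finset.range t, (x / ε) ^ (i + 1 : ℕ) / (i + 1 : ℕ).factorial) ≤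
          A * (K / ε) * CB ^ s * y * F * E := by gcongr
      have u4 : A * K1 * ∑ i ∈ Finset.range t, (2 * x / ε) ^ (i + 1 : ℕ) / (i + 1 : ℕ).factorial ≤ A * K1 * (2 * x / ε * E) := by gcongr
      calc _ = (K0 * A * x + A * K1 * ∑ i ∈ Finset.range t, (2 * x / ε) ^ (i + 1 : ℕ) / (i + 1 : ℕ).factorial) +
            A * (K / ε) * CB ^ s * y * F * (1 + ∑ i ∈ Finset.range t, (x / ε) ^ (i + 1 : ℕ) / (i + 1 : ℕ).factorial) := by ring
        _ ≤ A * (K / ε) * CB ^ s * x * (E * F) + A * (K / ε) * CB ^ s * y * F * E := by linarith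
        _ = _ := by ring
end PartL

section PartM
open MeasureTheory Metric Filter Topology
def PB : ℝ := 2 * CB * Real.exp 2

theorem PB_one : 1 ≤ PB := by
  have := CB_four; have := Real.add_one_le_exp (2:ℝ); unfold PB; nlinarith

theorem cq_nonneg {Λ : ℝ} (h : 0 ≤ Λ) : 0 ≤ cq Λ := by
  have := D0_nonneg; have := Real.pi_pos
  have := ka_nonneg 1 (Λ + 1)
  unfold cq; positivity

theorem IsForm01.mono {n : ℕ} {Ω Ω' : Set L1} {f : L1 → L1 → ℂ} (h : IsForm01 n Ω f) (hs : Ω' ⊆ Ω) : IsForm01 n Ω' f :=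
  ⟨fun z hz => h.1 z (hs hz), fun z hz => h.2.1 z (hs hz), h.2.2.mono (prod_mono hs subset_rfl)⟩

theorem asm1 {b K A : ℝ} (hb : 0 < b) (hK : 0 ≤ K) {N s : ℕ} (h : BCl b K N s) (hs : 1 ≤ s) {f : L1 → L1 → ℂ}
    (hA : 0 ≤ A) (hf : FC (6 * b) A f) (hd : Dep N f) :
    ∃ (U : L1 → ℂ) (g : L1 → L1 → ℂ), Sol (ball 0 b) U (fun z ξ => f z ξ - g z ξ) ∧
    (∀ z : L1, ‖z‖ < b → ∀ ξ, ‖g z ξ‖ ≤ A * (PB * (‖z‖ / b)) ^ s * ‖ξ‖) ∧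
    ∀ z : L1, ‖z‖ < b → ‖U z‖ ≤ A * K * PB ^ s := by
  have hs0 : (0:ℝ) < s := by exact_mod_cast hs
  have hC := CB_four
  have hC0 : 0 ≤ CB := by linarith
  have e1 : s * (b / s) = b := by field_simp
  obtain ⟨U, g, h1, h2, h3⟩ := h (b / s) A f (by positivity) e1.le hA (by rw [e1]; convert hf using 1; ring) hd
  have hf0 : (0:ℝ) < s.factorial := by exact_mod_cast s.factorial_pos
  refine ⟨U, g, h1, fun z hz ξ => (h2 z hz ξ).trans ?_, fun z hz => (h3 z hz).trans ?_⟩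
  · have k1 : (s:ℝ) ^ s / s.factorial ≤ Real.exp s := Real.pow_div_factorial_le_exp _ hs0.le _
    have k2 : Real.exp s ≤ (2 * Real.exp 2) ^ s := by
      rw [mul_pow, ← Real.exp_nat_mul]
      exact (Real.exp_le_exp.2 (by linarith)).trans (le_mul_of_one_le_left (Real.exp_pos _).le (one_le_pow₀ (by norm_num)))
    have e : ‖z‖ / (b / s) = s * (‖z‖ / b) := by field_simp
    rw [e]
    calc _ = A * (CB ^ s * ((s:ℝ) ^ s / s.factorial) * (‖z‖ / b) ^ s) * ‖ξ‖ := by rw [mul_pow]; ring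
      _ ≤ A * (CB ^ s * (2 * Real.exp 2) ^ s * (‖z‖ / b) ^ s) * ‖ξ‖ := by have := k1.trans k2; gcongr
      _ = _ := by rw [← mul_pow, ← mul_pow, PB]; ring_nf
  · have k1 : (s:ℝ) ≤ 2 ^ s := by exact_mod_cast s.lt_two_pow_self.le
    have k3 : ‖z‖ / b ≤ 1 := (div_le_one hb).2 hz.le
    have k2 : Real.exp (2 * ‖z‖ / (b / s)) ≤ Real.exp 2 ^ s := by
      rw [← Real.exp_nat_mul, Real.exp_le_exp]
      calc 2 * ‖z‖ / (b / s) = s * (2 * (‖z‖ / b)) := by field_simp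
        _ ≤ s * (2 * 1) := by gcongr
        _ = _ := by ring
    calc _ = A * (K * s) * CB ^ s * (‖z‖ / b) * Real.exp (2 * ‖z‖ / (b / s)) := by field_simp
      _ ≤ A * (K * 2 ^ s) * CB ^ s * 1 * Real.exp 2 ^ s := by gcongr
      _ = _ := by rw [PB, mul_pow, mul_pow]; ring

theorem asm2 {b K A : ℝ} (hb : 0 < b) (hK : 0 ≤ K) {N : ℕ} (h : ∀ s, BCl b K N s) {f : L1 → L1 → ℂ}
    (hA : 0 ≤ A) (hf : FC (6 * b) A f) (hd : Dep N f) (n : ℕ) :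
    ∃ (u : L1 → ℂ) (g : L1 → L1 → ℂ), Sol (ball 0 (b / (4 * PB))) u (fun z ξ => f z ξ - g z ξ) ∧
    (∀ z : L1, z ∈ ball 0 (b / (4 * PB)) → ∀ ξ, ‖g z ξ‖ ≤ A * (1 / 2) ^ n * ‖ξ‖) ∧
    ∀ z : L1, z ∈ ball 0 (b / (4 * PB)) → ‖u z‖ ≤ (K * PB + 2 * (cq (4 * PB) * ((1 + PB) * (K + b)))) * A := by
  have hP := PB_one
  have hc := cq_nonneg (Λ := 4 * PB) (by positivity)
  choose U g h1 h2 h3 using fun s => asm1 hb hK (h (s + 1)) (Nat.succ_le_succ (Nat.zero_le s)) hA hf hd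
  have hsm : ball (0:L1) (b / (4 * PB)) ⊆ ball 0 b := ball_subset_ball (div_le_self hb.le (by linarith))
  have hq : ∀ z ∈ ball (0:L1) (b / (4 * PB)), ‖z‖ < b ∧ PB * (‖z‖ / b) ≤ 1 / 2 := by
    intro z hz
    refine ⟨by simpa using hsm hz, ?_⟩
    rw [mem_ball_zero_iff, lt_div_iff₀ (by positivity)] at hz
    rw [← mul_div_assoc, div_le_div_iff₀ hb (by norm_num)]; nlinarith [norm_nonneg z]
  have hQ : ∀ s, ∃ Q : L1 → ℂ, Sol (ball 0 (b / (4 * PB))) Q zf ∧ ∀ z ∈ ball (0:L1) (b / (4 * PB)),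
      ‖U (s + 1) z - U s z - Q z‖ ≤ cq (4 * PB) * ((1 + PB) * (K + b)) * A * (1 / 2) ^ s := by
    intro s
    have hDb : ∀ z ∈ ball (0:L1) b, ‖U (s + 1) z - U s z‖ ≤ A * K * PB ^ (s + 1) * (1 + PB) := by
      intro z hz
      rw [mem_ball_zero_iff] at hz
      calc _ ≤ A * K * PB ^ (s + 1 + 1) + A * K * PB ^ (s + 1) := (norm_sub_le _ _).trans (add_le_add (h3 _ z hz) (h3 _ z hz))
        _ = _ := by ring
    have hgb : ∀ z ∈ ball (0:L1) b, ∀ ξ, ‖f z ξ - g (s + 1) z ξ - (f z ξ - g s z ξ)‖ ≤ A * (PB / b) ^ (s + 1) * (1 + PB) * ‖z‖ ^ (s + 1) * ‖ξ‖ := by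
      intro z hz ξ
      rw [mem_ball_zero_iff] at hz
      have k3 : ‖z‖ / b ≤ 1 := (div_le_one hb).2 hz.le
      calc _ = ‖g s z ξ - g (s + 1) z ξ‖ := by congr 1; ring
        _ ≤ A * (PB * (‖z‖ / b)) ^ (s + 1) * ‖ξ‖ + A * (PB * (‖z‖ / b)) ^ (s + 1 + 1) * ‖ξ‖ :=
          (norm_sub_le _ _).trans (add_le_add (h2 _ z hz ξ) (h2 _ z hz ξ))
        _ = A * (PB * (‖z‖ / b)) ^ (s + 1) * ‖ξ‖ * (1 + PB * (‖z‖ / b)) := by ring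
        _ ≤ A * (PB * (‖z‖ / b)) ^ (s + 1) * ‖ξ‖ * (1 + PB * 1) := by gcongr
        _ = _ := by rw [mul_pow, div_pow, div_pow]; ring
    obtain ⟨Q, q1, q2⟩ := q_lemma (Λ := 4 * PB) (s := s + 1) (M := A * K * PB ^ (s + 1) * (1 + PB)) (H := A * (PB / b) ^ (s + 1) * (1 + PB))
      hb (by linarith) ((h1 (s + 1)).sub isOpen_ball (h1 s)) (by positivity) (by positivity) hDb hgb
    · refine ⟨Q, q1, fun z hz => (q2 z hz).trans ?_⟩
      have := hq z hz
      have k : 2 / (4 * PB) = 1 / (2 * PB) := by field_simp; norm_num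
      calc _ = cq (4 * PB) * A * (1 + PB) * (K * (PB * (2 / (4 * PB))) ^ (s + 1) + (PB * (‖z‖ / b)) ^ (s + 1) * ‖z‖) := by
            rw [mul_pow, mul_pow, div_pow ‖z‖, div_pow PB]; ring
        _ = cq (4 * PB) * A * (1 + PB) * (K * (1 / 2) ^ (s + 1) + (PB * (‖z‖ / b)) ^ (s + 1) * ‖z‖) := by
            rw [show PB * (2 / (4 * PB)) = 1 / 2 by field_simp; norm_num]
        _ ≤ cq (4 * PB) * A * (1 + PB) * (K * (1 / 2) ^ s + (1 / 2) ^ s * b) := by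
            have e : ((1:ℝ) / 2) ^ (s + 1) ≤ (1 / 2) ^ s := pow_le_pow_of_le_one (by norm_num) (by norm_num) (Nat.le_succ s)
            have : (PB * (‖z‖ / b)) ^ (s + 1) ≤ (1 / 2) ^ s := (pow_le_pow_left₀ (by positivity) this.2 _).trans e
            gcongr; exact (hq z hz).1.le
        _ = _ := by ring
  choose Q q1 q2 using hQ
  refine ⟨fun z => U n z - ∑ s ∈ Finset.range n, Q s z, g n, ?_, fun z hz ξ => (h2 n z (hq z hz).1 ξ).trans ?_, fun z hz => ?_⟩
  · refine (((h1 n).mono hsm).sub isOpen_ball (Sol.sum isOpen_ball (Finset.range n) fun s _ => q1 s)).congr isOpen_ball (fun _ _ => rfl) fun z _ ξ => ?_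
    simp [zf]
  · have := pow_le_pow_of_le_one (by norm_num) (by norm_num : (1:ℝ) / 2 ≤ 1) (Nat.le_succ n)
    have := (pow_le_pow_left₀ (by positivity) (hq z hz).2 (n + 1)).trans this
    gcongr
  · have e : U n z - ∑ s ∈ Finset.range n, Q s z = U 0 z + ∑ s ∈ Finset.range n, (U (s + 1) z - U s z - Q s z) := by
      rw [Finset.sum_sub_distrib, Finset.sum_range_sub (fun s => U s z)]; ring
    beta_reduce
    rw [e]
    have i1 := h3 0 z (hq z hz).1
    have i2 : ‖∑ s ∈ Finset.range n, (U (s + 1) z - U s z - Q s z)‖ ≤ ∑ s ∈ Finset.range n, cq (4 * PB) * ((1 + PB) * (K + b)) * A * (1 / 2) ^ s :=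
      norm_sum_le_of_le _ fun s _ => q2 s z hz
    rw [← Finset.mul_sum] at i2
    have i3 : ∑ s ∈ Finset.range n, ((1:ℝ) / 2) ^ s ≤ 2 := sum_geometric_two_le n
    have i4 := mul_le_mul_of_nonneg_left i3 (show 0 ≤ cq (4 * PB) * ((1 + PB) * (K + b)) * A by positivity)
    have i5 := norm_add_le (U 0 z) (∑ s ∈ Finset.range n, (U (s + 1) z - U s z - Q s z))
    rw [zero_add, pow_one] at i1
    linarith

theorem solB {b : ℝ} (hb : 0 < b) : ∃ K, 0 ≤ K ∧ ∀ A f, FC (6 * b) A f →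
    ∃ u, Sol (ball 0 (b / (4 * PB))) u f ∧ ∀ z ∈ ball 0 (b / (4 * PB)), ‖u z‖ ≤ K * A := by
  obtain ⟨K, hK, hB⟩ := stepB hb
  have hP := PB_one
  have hc := cq_nonneg (Λ := 4 * PB) (by positivity)
  refine ⟨(K * PB + 2 * (cq (4 * PB) * ((1 + PB) * (K + b)))) + 2, by positivity, fun A f hf => ?_⟩
  have hA := hf.A0 (by positivity)
  have hsm : ball (0:L1) (b / (4 * PB)) ⊆ ball 0 (6 * b) :=
    ball_subset_ball ((div_le_self hb.le (by linarith)).trans (by linarith))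
  choose u g h1 h2 h3 using fun n => asm2 hb hK (hB n) hA (hf.comp (by positivity) (trn n) (trn_le n))
    (fun z ξ => by beta_reduce; rw [trn_idem, trn_idem]) n
  refine comp_sol isOpen_ball (by positivity) h1 (fun n z hz => (h3 n z hz).trans (by nlinarith)) (fun n z hz ξ => ?_) (fun z hz ξ => ?_)
    (hf.form.mono hsm)
  · have hz' := hsm hz
    rw [mem_ball_zero_iff] at hz'
    have i1 := hf.bd (trn n z) ((trn_le n z).trans_lt hz') (trn n ξ)
    have i2 : A * ‖trn n ξ‖ ≤ A * ‖ξ‖ := by gcongr; exact trn_le n ξ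
    have i3 : A * (1 / 2) ^ n * ‖ξ‖ ≤ A * ‖ξ‖ := by
      rw [mul_assoc]; gcongr; exact mul_le_of_le_one_left (norm_nonneg _) (pow_le_one₀ (by norm_num) (by norm_num))
    have i4 : 0 ≤ (K * PB + 2 * (cq (4 * PB) * ((1 + PB) * (K + b)))) * A * ‖ξ‖ := by positivity
    linarith [norm_sub_le (f (trn n z) (trn n ξ)) (g n z ξ), h2 n z hz ξ]
  · have t1 : Tendsto (fun n => f (trn n z) (trn n ξ)) atTop (𝓝 (f z ξ)) := by
      have c : ContinuousAt (fun p : L1 × L1 => f p.1 p.2) (z, ξ) :=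
        hf.form.2.2.continuousOn.continuousAt ((isOpen_ball.prod isOpen_univ).mem_nhds (mk_mem_prod (hsm hz) (mem_univ ξ)))
      exact c.tendsto.comp ((trn_tendsto z).prodMk_nhds (trn_tendsto ξ))
    have t2 : Tendsto (fun n => g n z ξ) atTop (𝓝 0) := by
      refine squeeze_zero_norm (fun n => h2 n z hz ξ) ?_
      have t3 : Tendsto (fun n : ℕ => ((1:ℝ) / 2) ^ n) atTop (𝓝 0) := tendsto_pow_atTop_nhds_zero_of_lt_one (by norm_num) (by norm_num)
      simpa only [mul_zero, zero_mul] using (t3.const_mul A).mul_const ‖ξ‖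
    simpa using t1.sub t2
end PartM

section PartN
open MeasureTheory Metric Filter Topology

structure PN (p : L1 → ℝ) : Prop where
  cont : Continuous p
  hom : ∀ (ζ : ℂ) z, p (ζ • z) = ‖ζ‖ * p z
  le : ∀ z, ‖z‖ ≤ p z

def Solv (p : L1 → ℝ) : Prop := ∀ r r' : ℝ, 0 < r → r < r' → ∃ K, 0 ≤ K ∧ ∀ A f, FC r' A f →
  ∃ u, Sol {z | p z < r} u f ∧ ∀ z, p z < r → ‖u z‖ ≤ K * A

def Cst : ℝ := 24 * PB

theorem solv_base : Solv fun z => Cst * ‖z‖ := by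
  intro r r' hr hrr
  have hP := PB_one
  obtain ⟨K, hK, h⟩ := solB (b := r' / 6) (by linarith)
  have hs : ∀ z : L1, Cst * ‖z‖ < r → z ∈ ball (0:L1) (r' / 6 / (4 * PB)) := by
    intro z hz
    rw [mem_ball_zero_iff, div_div, lt_div_iff₀ (by positivity)]
    unfold Cst at hz; linarith
  refine ⟨K, hK, fun A f hf => ?_⟩
  obtain ⟨u, h1, h2⟩ := h A f (by convert hf using 1; ring)
  exact ⟨u, h1.mono fun z hz => hs z hz, fun z hz => h2 z (hs z hz)⟩

theorem pr_open {p : L1 → ℝ} (hp : PN p) (ρ σ : ℝ) : IsOpen {z : L1 | ‖c0 z‖ < ρ ∧ p (Lft z) < σ} :=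
  (isOpen_lt c0.continuous.norm continuous_const).inter (isOpen_lt (hp.cont.comp Lft.continuous) continuous_const)

theorem prodS {p : L1 → ℝ} (hp : PN p) (hS : Solv p) {ρ σ r' : ℝ} (hρ : 0 < ρ) (hσ : 0 < σ) (hr : ρ + σ < r') :
    ∃ K, 0 ≤ K ∧ ∀ A f, FC r' A f → ∃ u, Sol {z | ‖c0 z‖ < ρ ∧ p (Lft z) < σ} u f ∧
      ∀ z, ‖c0 z‖ < ρ → p (Lft z) < σ → ‖u z‖ ≤ K * A := by
  obtain ⟨d, hd, hd4⟩ : ∃ d > 0, ρ + σ + 4 * d = r' := ⟨(r' - ρ - σ) / 4, by linarith, by ring⟩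
  set a := ρ + d with ha
  set b := ρ + 2 * d with hb
  have ha0 : 0 < a := by positivity
  have hb0 : 0 < b := by positivity
  obtain ⟨D, χ, hχ, -⟩ := exists_cut ha0 (show a < b by linarith)
  have hD := hχ.Dnonneg
  obtain ⟨K0, hK0, hT⟩ := kitT hχ
  obtain ⟨K1, hK1, hU⟩ := hS σ (r' - b) hσ (by linarith)
  set q := ρ / a with hq
  have hq1 : q < 1 := (div_lt_one ha0).2 (by linarith)
  have hq0 : 0 ≤ q := by positivity
  refine ⟨K0 + K1 * (b ^ 2 * (D * a⁻¹)) * (1 - q)⁻¹, by have := sub_pos.2 hq1; positivity, fun A f hf => ?_⟩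
  have hA := hf.A0 (by linarith)
  obtain ⟨t1, t2, -⟩ := hT r' A f hA hf
  have hj := fun j => hf.fk hA (kap_int hχ ha0 j hb0.le).1 (kap_int hχ ha0 j hb0.le).2
  choose U u1 u2 using fun j => hU _ _ (hj j)
  set P := {z : L1 | ‖c0 z‖ < ρ ∧ p (Lft z) < σ} with hP
  have hPo : IsOpen P := pr_open hp ρ σ
  have hL : ∀ z ∈ P, ‖Lft z‖ < r' - b := fun z hz => ((hp.le _).trans_lt hz.2).trans (by linarith)
  have hterm : ∀ z ∈ P, ∀ j, ‖c0 z ^ j * U j (Lft z)‖ ≤ K1 * A * (b ^ 2 * (D * a⁻¹)) * q ^ j := by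
    intro z hz j
    rw [norm_mul, norm_pow]
    have h1 := hz.1.le
    calc _ ≤ ρ ^ j * (K1 * (A * (b ^ 2 * (D * (a ^ (j + 1))⁻¹)))) :=
          mul_le_mul (pow_le_pow_left₀ (norm_nonneg _) h1 _) (u2 j _ hz.2) (norm_nonneg _) (by positivity)
      _ = _ := by rw [hq, div_pow, pow_succ a, mul_inv]; ring
  have hgs := (hasSum_geometric_of_lt_one hq0 hq1).mul_left (K1 * A * (b ^ 2 * (D * a⁻¹)))
  have hsm : ∀ z ∈ P, Summable fun j => c0 z ^ j * U j (Lft z) := fun z hz => Summable.of_norm_bounded hgs.summable (hterm z hz)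
  have hpart : ∀ z ∈ P, ∀ n, ‖∑ j ∈ Finset.range n, c0 z ^ j * U j (Lft z)‖ ≤ K1 * A * (b ^ 2 * (D * a⁻¹)) * (1 - q)⁻¹ := fun z hz n =>
    (norm_sum_le_of_le _ fun j _ => hterm z hz j).trans (sum_le_hasSum _ (fun j _ => by positivity) hgs)
  have hX : ∀ z ∈ P, ∀ n ξ, ‖Ex χ b f z ξ - ∑ j ∈ Finset.range n, c0 z ^ j * fk (kap χ j) b f (Lft z) (Lft ξ)‖ ≤
      A * (b ^ 2 * D * d⁻¹) * q ^ n * ‖ξ‖ := by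
    intro z hz n ξ
    have h1 := hz.1
    refine (expand hχ ha0 hb0.le hA hf (hL z hz) (by linarith) n ξ).trans ?_
    have : (a - ‖c0 z‖)⁻¹ ≤ d⁻¹ := inv_anti₀ hd (by linarith)
    have : ‖c0 z‖ / a ≤ q := by rw [hq]; gcongr
    have : (0:ℝ) ≤ (a - ‖c0 z‖)⁻¹ := inv_nonneg.2 (by linarith)
    gcongr
  have hPb : P ⊆ ball 0 r' := fun z hz => by
    rw [mem_ball_zero_iff, l1_split]; linarith [hz.1, hz.2, hp.le (Lft z)]
  refine ⟨fun z => Tx χ b f z - ∑' j, c0 z ^ j * U j (Lft z), lim_sol (un := fun n z => Tx χ b f z - ∑ j ∈ Finset.range n, c0 z ^ j * U j (Lft z))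
    (fn := fun n z ξ => f z ξ + (Ex χ b f z ξ - ∑ j ∈ Finset.range n, c0 z ^ j * fk (kap χ j) b f (Lft z) (Lft ξ))) hPo (fun n => ?_)
    (fun z hz => ⟨1, one_pos, max (K0 * A + K1 * A * (b ^ 2 * (D * a⁻¹)) * (1 - q)⁻¹) (A + A * (b ^ 2 * D * d⁻¹)), fun z _ hz n => ⟨?_, fun ξ => ?_⟩⟩)
    (fun z hz => ?_) (fun z hz ξ => ?_) (hf.form.mono hPb), fun z h1 h2 => ?_⟩
  · refine ((t1.mono fun z hz => ⟨hL z hz, ?_⟩).sub hPo (Sol.sum hPo (Finset.range n) fun j _ => (coord_sol j).mul hPo ((u1 j).comp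
      (isOpen_lt hp.cont continuous_const) Lft fun z hz => hz.2))).congr hPo (fun _ _ => rfl) fun z hz ξ => ?_
    · have := hz.1; linarith
    · rw [hχ.one _ (by have := hz.1; linarith)]; simp; ring
  · exact le_max_of_le_left ((norm_sub_le _ _).trans (add_le_add (t2 z (hL z hz)) (hpart z hz n)))
  · have i1 := hf.bd z (by simpa using hPb hz) ξ
    have i2 := hX z hz n ξ
    have i3 : A * (b ^ 2 * D * d⁻¹) * q ^ n * ‖ξ‖ ≤ A * (b ^ 2 * D * d⁻¹) * 1 * ‖ξ‖ := by
      gcongr; exact pow_le_one₀ hq0 hq1.le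
    refine ((norm_add_le _ _).trans (by linarith)).trans (mul_le_mul_of_nonneg_right (le_max_right _ _) (norm_nonneg ξ))
  · exact tendsto_const_nhds.sub (hsm z hz).hasSum.tendsto_sum_nat
  · have : Tendsto (fun n => Ex χ b f z ξ - ∑ j ∈ Finset.range n, c0 z ^ j * fk (kap χ j) b f (Lft z) (Lft ξ)) atTop (𝓝 0) := by
      refine squeeze_zero_norm (fun n => hX z hz n ξ) ?_
      simpa only [mul_zero, zero_mul] using ((tendsto_pow_atTop_nhds_zero_of_lt_one hq0 hq1).const_mul (A * (b ^ 2 * D * d⁻¹))).mul_const ‖ξ‖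
    simpa using this.const_add (f z ξ)
  · have i2 : ‖∑' j, c0 z ^ j * U j (Lft z)‖ ≤ K1 * A * (b ^ 2 * (D * a⁻¹)) * (1 - q)⁻¹ :=
      (hsm z ⟨h1, h2⟩).hasSum.norm_le_of_bounded hgs (hterm z ⟨h1, h2⟩)
    refine (norm_sub_le _ _).trans ((add_le_add (t2 z (hL z ⟨h1, h2⟩)) i2).trans (le_of_eq (by ring)))
end PartN

section PartO
open MeasureTheory Metric Filter Topology

def al : L1 →L[ℂ] L1 := Sft.comp Lft
def be : L1 →L[ℂ] L1 := c0.smulRight e0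

theorem c0_ab (z : L1) (ζ : ℂ) : c0 (al z + ζ • be z) = ζ * c0 z := by simp [al, be, c0_Sft, c0_e0]
theorem Lft_ab (z : L1) (ζ : ℂ) : Lft (al z + ζ • be z) = Lft z := by simp [al, be, Lft_Sft, Lft_e0]
theorem c0_ba (z : L1) (ζ : ℂ) : c0 (be z + ζ • al z) = c0 z := by simp [al, be, c0_Sft, c0_e0]
theorem Lft_ba (z : L1) (ζ : ℂ) : Lft (be z + ζ • al z) = ζ • Lft z := by simp [al, be, Lft_Sft, Lft_e0]
theorem ab_one (z : L1) : al z + (1:ℂ) • be z = z := by simpa [al, be] using decomp z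
theorem ba_one (z : L1) : be z + (1:ℂ) • al z = z := by rw [one_smul, add_comm]; simpa using ab_one z

theorem PN.nn {p : L1 → ℝ} (hp : PN p) (z : L1) : 0 ≤ p z := (norm_nonneg z).trans (hp.le z)

theorem scl {X x ρ : ℝ} (hX : 0 < X) (hx : x < X * ρ) (h0 : 0 ≤ x) {ζ : ℂ} (hζ : ‖ζ‖ ≤ X⁻¹) : ‖ζ‖ * x < ρ := by
  calc _ ≤ X⁻¹ * x := by gcongr
    _ < ρ := by rw [inv_mul_lt_iff₀ hX]; exact hx

theorem lt_ex {x ρ : ℝ} (h0 : 0 ≤ x) (h : x < ρ) : ∃ X, 0 < X ∧ X < 1 ∧ x < X * ρ := by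
  have hρ : 0 < ρ := h0.trans_lt h
  refine ⟨(x / ρ + 1) / 2, by positivity, by have := (div_lt_one hρ).2 h; linarith, ?_⟩
  rw [div_mul_eq_mul_div, add_mul, div_mul_cancel₀ _ hρ.ne']; linarith

theorem bigr {p : L1 → ℝ} (hp : PN p) {ρ σ M : ℝ} (hρ : 0 < ρ) (hσ : 0 < σ) {h : L1 → ℂ}
    (hh : Sol {z | ‖c0 z‖ < ρ ∧ p (Lft z) < σ} h zf) (hM : ∀ z, ‖c0 z‖ < ρ → p (Lft z) < σ → ‖h z‖ ≤ M) :
    ∃ H : ℕ × ℕ → L1 → ℂ, (∀ k, Sol univ (H k) zf) ∧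
      (∀ k z X Y, 0 < X → 0 < Y → ‖c0 z‖ < X * ρ → p (Lft z) < Y * σ → ‖H k z‖ ≤ M * (X ^ k.1 * Y ^ k.2)) ∧
      ∀ z, ‖c0 z‖ < ρ → p (Lft z) < σ → HasSum (fun k => H k z) (h z) := by
  have hPo := pr_open hp ρ σ
  have hG : IsOpen {z : L1 | p (Lft z) < σ} := isOpen_lt (hp.cont.comp Lft.continuous) continuous_const
  have a1 : ∀ z X, 0 < X → ‖c0 z‖ < X * ρ → p (Lft z) < σ → ∀ ζ : ℂ, ‖ζ‖ ≤ X⁻¹ →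
      al z + ζ • be z ∈ {z | ‖c0 z‖ < ρ ∧ p (Lft z) < σ} := by
    intro z X hX hx hy ζ hζ
    exact ⟨by rw [c0_ab, norm_mul]; exact scl hX hx (norm_nonneg _) hζ, by rw [Lft_ab]; exact hy⟩
  set T := fun j => tc h al be j with hT
  have T1 : ∀ j z X, 0 < X → ‖c0 z‖ < X * ρ → p (Lft z) < σ → ‖T j z‖ ≤ M * X ^ j := by
    intro j z X hX hx hy
    have := tc_le hPo hh (inv_pos.2 hX) (a1 z X hX hx hy) (fun ζ hζ => hM _ (a1 z X hX hx hy ζ hζ).1 (a1 z X hX hx hy ζ hζ).2) j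
    simpa [div_eq_mul_inv] using this
  have T2 : ∀ j, Sol {z : L1 | p (Lft z) < σ} (T j) zf := by
    refine tc_hol hG hPo hh fun a ha => ⟨1, one_pos, ((‖c0 a‖ + 1) / ρ)⁻¹, by positivity, M, fun z hz hz' ζ hζ => ?_⟩
    have := a1 z _ (by positivity) ?_ hz' ζ hζ
    · exact ⟨this, hM _ this.1 this.2⟩
    · rw [div_mul_cancel₀ _ hρ.ne']
      have h1 := c0_le (z - a)
      rw [map_sub] at h1
      rw [mem_ball, dist_eq_norm] at hz
      linarith [norm_sub_norm_le (c0 z) (c0 a)]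
  have b1 : ∀ z Y, 0 < Y → p (Lft z) < Y * σ → ∀ ζ : ℂ, ‖ζ‖ ≤ Y⁻¹ → p (Lft (be z + ζ • al z)) < σ := by
    intro z Y hY hy ζ hζ
    rw [Lft_ba, hp.hom]; exact scl hY hy (hp.nn _) hζ
  have H1 : ∀ j l z X Y, 0 < X → 0 < Y → ‖c0 z‖ < X * ρ → p (Lft z) < Y * σ → ‖tc (T j) be al l z‖ ≤ M * (X ^ j * Y ^ l) := by
    intro j l z X Y hX hY hx hy
    have := tc_le hG (T2 j) (inv_pos.2 hY) (b1 z Y hY hy) (fun ζ hζ => T1 j _ X hX (by rw [c0_ba]; exact hx) (b1 z Y hY hy ζ hζ)) l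
    simpa [div_eq_mul_inv, mul_assoc] using this
  refine ⟨fun k => tc (T k.1) be al k.2, fun k => ?_, fun k => H1 k.1 k.2, fun z hx hy => ?_⟩
  · refine tc_hol isOpen_univ hG (T2 k.1) (fun a _ => ?_) k.2
    obtain ⟨s, hs, hs'⟩ := Metric.isOpen_iff.1 (isOpen_lt (hp.cont.comp Lft.continuous) (continuous_const (y := p (Lft a) + 1))) a
      (lt_add_one (p (Lft a)))
    have hB : 0 < (p (Lft a) + 1) / σ := by have := hp.nn (Lft a); positivity
    refine ⟨min s 1, lt_min hs one_pos, ((p (Lft a) + 1) / σ)⁻¹, inv_pos.2 hB, M * ((‖c0 a‖ + 1) / ρ) ^ k.1, fun z hz _ ζ hζ => ?_⟩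
    have h2 := b1 z _ hB (by rw [div_mul_cancel₀ _ hσ.ne']; exact hs' (ball_subset_ball (min_le_left _ _) hz)) ζ hζ
    refine ⟨h2, T1 k.1 _ _ (by positivity) ?_ h2⟩
    rw [div_mul_cancel₀ _ hρ.ne', c0_ba]
    have h1 := c0_le (z - a)
    rw [map_sub] at h1
    have hz := ball_subset_ball (min_le_right _ _) hz
    rw [mem_ball, dist_eq_norm] at hz
    linarith [norm_sub_norm_le (c0 z) (c0 a)]
  · obtain ⟨X, hX, hX1, hx'⟩ := lt_ex (norm_nonneg _) hx
    obtain ⟨Y, hY, hY1, hy'⟩ := lt_ex (hp.nn _) hy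
    have s1 : HasSum (fun j => T j z) (h z) := by
      have := tc_hasSum hPo hh (inv_pos.2 hX) (a1 z X hX hx' hy) (t := 1) (by rw [norm_one]; exact (one_lt_inv₀ hX).2 hX1)
      rw [ab_one] at this
      simpa using this
    have s2 : ∀ j, HasSum (fun l => tc (T j) be al l z) (T j z) := by
      intro j
      have := tc_hasSum hG (T2 j) (inv_pos.2 hY) (b1 z Y hY hy') (t := 1) (by rw [norm_one]; exact (one_lt_inv₀ hY).2 hY1)
      rw [ba_one] at this
      simpa using this
    have s3 : Summable fun k : ℕ × ℕ => tc (T k.1) be al k.2 z := by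
      refine Summable.of_norm_bounded ?_ fun k => H1 k.1 k.2 z X Y hX hY hx' hy'
      exact ((summable_geometric_of_lt_one hX.le hX1).mul_of_nonneg (summable_geometric_of_lt_one hY.le hY1)
        (fun j => by positivity) (fun j => by positivity)).mul_left M
    have := s3.hasSum.prod_fiberwise s2
    rw [s1.unique this]
    exact s3.hasSum

theorem hsum {H : ℕ × ℕ → L1 → ℂ} {G : Set L1} (hG : IsOpen G) (hH : ∀ k, Sol univ (H k) zf) {S : Set (ℕ × ℕ)} {M θ : ℝ}
    (h0 : 0 ≤ θ) (h1 : θ < 1) (hM : 0 ≤ M) (hb : ∀ z ∈ G, ∀ k ∈ S, ‖H k z‖ ≤ M * (θ ^ k.1 * θ ^ k.2)) :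
    Sol G (fun z => ∑' k, S.indicator (fun k => H k z) k) zf ∧ ∀ z ∈ G, Summable (S.indicator fun k => H k z) ∧
      ‖∑' k, S.indicator (fun k => H k z) k‖ ≤ M * ((1 - θ)⁻¹ * (1 - θ)⁻¹) := by
  have g1 := hasSum_geometric_of_lt_one h0 h1
  have g2 : HasSum (fun k : ℕ × ℕ => M * (θ ^ k.1 * θ ^ k.2)) (M * ((1 - θ)⁻¹ * (1 - θ)⁻¹)) :=
    (g1.mul g1 (g1.summable.mul_of_nonneg g1.summable (fun j => by positivity) (fun j => by positivity))).mul_left M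
  have hb' : ∀ z ∈ G, ∀ k, ‖S.indicator (fun k => H k z) k‖ ≤ M * (θ ^ k.1 * θ ^ k.2) := by
    intro z hz k
    by_cases hk : k ∈ S
    · rw [indicator_of_mem hk]; exact hb z hz k hk
    · rw [indicator_of_notMem hk, norm_zero]; positivity
  have hs : ∀ z ∈ G, Summable (S.indicator fun k => H k z) := fun z hz => Summable.of_norm_bounded g2.summable (hb' z hz)
  refine ⟨?_, fun z hz => ⟨hs z hz, (hs z hz).hasSum.norm_le_of_bounded g2 (hb' z hz)⟩⟩
  have ht : Tendsto (fun n : ℕ => Finset.range n ×ˢ Finset.range n) atTop atTop := by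
    refine tendsto_atTop_finset_of_monotone (fun a b hab => Finset.product_subset_product (Finset.range_mono hab) (Finset.range_mono hab))
      fun k => ⟨k.1 + k.2 + 1, ?_⟩
    simp
  refine lim_sol (un := fun n z => ∑ k ∈ Finset.range n ×ˢ Finset.range n, S.indicator (fun k => H k z) k) (fn := fun _ => zf) hG (fun n => ?_)
    (fun a _ => ⟨1, one_pos, M * ((1 - θ)⁻¹ * (1 - θ)⁻¹), fun z _ hz n => ⟨?_, fun ξ => ?_⟩⟩)
    (fun z hz => (hs z hz).hasSum.comp ht) (fun _ _ _ => tendsto_const_nhds) (form_zero 1)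
  · refine (Sol.sum hG _ (f := fun _ => zf) fun k _ => ?_).congr hG (fun _ _ => rfl) fun _ _ _ => by simp
    by_cases hk : k ∈ S
    · simp only [indicator_of_mem hk]; exact (hH k).mono (subset_univ _)
    · simp only [indicator_of_notMem hk]; exact Sol.const 0
  · exact (norm_sum_le_of_le _ fun k _ => hb' z hz k).trans (sum_le_hasSum _ (fun k _ => by positivity) g2)
  · have : 0 ≤ (1 - θ)⁻¹ := inv_nonneg.2 (by linarith)
    simp only [norm_zero]; positivity
end PartO

section PartP
open MeasureTheory Metric Filter Topology

theorem exp_cmp {a b a' b' : ℝ} (ha : 0 < a) (hb : 0 < b) (ha' : 0 < a') (hb' : 0 < b') (he : a' + b' = a + b) {j l : ℕ}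
    (h : (a' - a) * (j * b - l * a) ≤ 0) : (a' / a) ^ j * (b' / b) ^ l ≤ 1 := by
  have e1 : a' / a ≤ Real.exp ((a' - a) / a) := by
    have := Real.add_one_le_exp (a' / a - 1)
    rwa [sub_add_cancel, ← div_self ha.ne', ← sub_div] at this
  have e2 : b' / b ≤ Real.exp (-(a' - a) / b) := by
    have := Real.add_one_le_exp (b' / b - 1)
    rwa [sub_add_cancel, ← div_self hb.ne', ← sub_div, show b' - b = -(a' - a) by linarith] at this
  calc _ ≤ Real.exp ((a' - a) / a) ^ j * Real.exp (-(a' - a) / b) ^ l := by gcongr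
    _ = Real.exp ((a' - a) * (j * b - l * a) / (a * b)) := by
      rw [← Real.exp_nat_mul, ← Real.exp_nat_mul, ← Real.exp_add]; congr 1; field_simp; ring
    _ ≤ 1 := by rw [Real.exp_le_one_iff]; exact div_nonpos_of_nonpos_of_nonneg h (by positivity)

theorem split1 {p : L1 → ℝ} (hp : PN p) {ρ σ σ' M l θ : ℝ} (hρ : 0 < ρ) (hσ : 0 < σ) (hσ' : 0 < σ') (hM0 : 0 ≤ M) {h : L1 → ℂ}
    (hl : 0 < l) (hl1 : l ≤ θ) (hl2 : l * σ ≤ θ * σ') (hθ : θ < 1)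
    (hh : Sol {z | ‖c0 z‖ < ρ ∧ p (Lft z) < σ'} h zf) (hM : ∀ z, ‖c0 z‖ < ρ → p (Lft z) < σ' → ‖h z‖ ≤ M) :
    ∃ a b : L1 → ℂ, (∀ z, ‖c0 z‖ < ρ → p (Lft z) < σ' → h z = a z + b z) ∧
      ∀ ρ₁ σ₁, 0 < ρ₁ → 0 < σ₁ → ρ₁ + σ₁ = ρ + σ →
      (ρ₁ ≤ ρ → Sol {z | ‖c0 z‖ < l * ρ₁ ∧ p (Lft z) < l * σ₁} a zf ∧
        ∀ z, ‖c0 z‖ < l * ρ₁ → p (Lft z) < l * σ₁ → ‖a z‖ ≤ M * ((1 - θ)⁻¹ * (1 - θ)⁻¹)) ∧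
      (ρ ≤ ρ₁ → Sol {z | ‖c0 z‖ < l * ρ₁ ∧ p (Lft z) < l * σ₁} b zf ∧
        ∀ z, ‖c0 z‖ < l * ρ₁ → p (Lft z) < l * σ₁ → ‖b z‖ ≤ M * ((1 - θ)⁻¹ * (1 - θ)⁻¹)) := by
  obtain ⟨H, H1, H2, H3⟩ := bigr hp hρ hσ' hh hM
  have hθ0 : 0 < θ := by linarith
  set S : Set (ℕ × ℕ) := {k | k.2 * ρ ≤ k.1 * σ} with hS
  have key : ∀ ρ₁ σ₁, 0 < ρ₁ → 0 < σ₁ → ρ₁ + σ₁ = ρ + σ → ∀ z, ‖c0 z‖ < l * ρ₁ → p (Lft z) < l * σ₁ → ∀ k : ℕ × ℕ,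
      (ρ₁ - ρ) * (k.1 * σ - k.2 * ρ) ≤ 0 → ‖H k z‖ ≤ M * (θ ^ k.1 * θ ^ k.2) := by
    intro ρ₁ σ₁ h1 h2 he z hx hy k hk
    refine (H2 k z (l * ρ₁ / ρ) (l * σ₁ / σ') (by positivity) (by positivity) (by rwa [div_mul_cancel₀ _ hρ.ne'])
      (by rwa [div_mul_cancel₀ _ hσ'.ne'])).trans ?_
    refine mul_le_mul_of_nonneg_left ?_ hM0
    have i1 : l * ρ₁ / ρ ≤ θ * (ρ₁ / ρ) := by rw [mul_div_assoc]; gcongr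
    have i2 : l * σ₁ / σ' ≤ θ * (σ₁ / σ) := by
      rw [← mul_div_assoc, div_le_div_iff₀ hσ' hσ]; nlinarith
    calc _ ≤ (θ * (ρ₁ / ρ)) ^ k.1 * (θ * (σ₁ / σ)) ^ k.2 := by gcongr
      _ = θ ^ k.1 * θ ^ k.2 * ((ρ₁ / ρ) ^ k.1 * (σ₁ / σ) ^ k.2) := by rw [mul_pow, mul_pow]; ring
      _ ≤ θ ^ k.1 * θ ^ k.2 * 1 := by gcongr; exact exp_cmp hρ hσ h1 h2 he hk
      _ = _ := mul_one _
  refine ⟨fun z => ∑' k, S.indicator (fun k => H k z) k, fun z => ∑' k, Sᶜ.indicator (fun k => H k z) k, fun z hx hy => ?_,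
    fun ρ₁ σ₁ h1 h2 he => ⟨fun hle => ?_, fun hle => ?_⟩⟩
  · have s := H3 z hx hy
    rw [← (s.summable.indicator S).tsum_add (s.summable.indicator Sᶜ), ← s.tsum_eq]
    exact tsum_congr fun k => (congrFun (indicator_self_add_compl S fun k => H k z) k).symm
  · have := hsum (pr_open hp (l * ρ₁) (l * σ₁)) H1 (S := S) hθ0.le hθ hM0 fun z hz k hk =>
      key ρ₁ σ₁ h1 h2 he z hz.1 hz.2 k (mul_nonpos_of_nonpos_of_nonneg (by linarith) (by have : k.2 * ρ ≤ k.1 * σ := hk; linarith))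
    exact ⟨this.1, fun z hx hy => (this.2 z ⟨hx, hy⟩).2⟩
  · have := hsum (pr_open hp (l * ρ₁) (l * σ₁)) H1 (S := Sᶜ) hθ0.le hθ hM0 fun z hz k hk =>
      key ρ₁ σ₁ h1 h2 he z hz.1 hz.2 k (mul_nonpos_of_nonneg_of_nonpos (by linarith) (by have : ¬ (k.2 * ρ ≤ k.1 * σ) := hk; linarith))
    exact ⟨this.1, fun z hx hy => (this.2 z ⟨hx, hy⟩).2⟩

theorem solv_plus {p : L1 → ℝ} (hp : PN p) (hS : Solv p) : Solv fun z => ‖c0 z‖ + p (Lft z) := by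
  intro r r' hr hrr
  obtain ⟨g, hg, hg8⟩ : ∃ g > 0, r + 8 * g = r' := ⟨(r' - r) / 8, by linarith, by ring⟩
  set r1 := r + 4 * g with hr1
  have hr10 : 0 < r1 := by positivity
  obtain ⟨τ, hτ, hτ1, hτr⟩ : ∃ τ > 0, τ ≤ 1 ∧ 2 * (τ * r1) = g :=
    ⟨g / (2 * r1), by positivity, (div_le_one (by positivity)).2 (by linarith), by field_simp⟩
  obtain ⟨N, hN0, hN⟩ : ∃ N : ℕ, (0:ℝ) < N ∧ (r1 - 2 * g) / N ≤ τ * g := by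
    obtain ⟨N, hN⟩ := exists_nat_gt ((r1 - 2 * g) / (τ * g))
    have h0 : 0 < (r1 - 2 * g) / (τ * g) := div_pos (by linarith) (by positivity)
    have hN' := h0.trans hN
    refine ⟨N, hN', ?_⟩
    rw [div_lt_iff₀ (by positivity)] at hN
    rw [div_le_iff₀ hN']; linarith
  set δ := (r1 - 2 * g) / N with hδ
  have hδ0 : 0 < δ := div_pos (by linarith) hN0
  have hNδ : N * δ = r1 - 2 * g := by rw [hδ]; field_simp
  have hδg : δ ≤ g := hN.trans (mul_le_of_le_one_left hg.le hτ1)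
  set ρ : ℕ → ℝ := fun m => g + m * δ with hρ
  set σ : ℕ → ℝ := fun m => r1 - ρ m with hσ
  have hρs : ∀ m, ρ (m + 1) = ρ m + δ := fun m => by simp only [hρ]; push_cast; ring
  have hρm : ∀ i j, i ≤ j → ρ i ≤ ρ j := fun i j hij => by simp only [hρ]; gcongr
  have hσm : ∀ i j, i ≤ j → σ j ≤ σ i := fun i j hij => sub_le_sub_left (hρm i j hij) _
  have hρ0 : ∀ m, 0 < ρ m := fun m => by simp only [hρ]; positivity
  have hρN : ρ N = r1 - g := by simp only [hρ]; linarith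
  have hσg : ∀ m ≤ N, g ≤ σ m := fun m hm => by simp only [hσ]; linarith [hρm m N hm]
  have hσ0 : ∀ m ≤ N, 0 < σ m := fun m hm => hg.trans_le (hσg m hm)
  set l := 1 - τ with hl
  set θ := 1 - τ ^ 2 with hθ
  have hτ2 : τ ≤ 1 / 2 := by nlinarith
  have hl0 : 0 < l := by linarith
  have hl1 : l ≤ θ := by nlinarith
  have hθ1 : θ < 1 := by have := pow_pos hτ 2; linarith
  set C := (1 - θ)⁻¹ * (1 - θ)⁻¹ with hC
  have hC0 : 0 ≤ C := mul_self_nonneg _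
  have hKe : ∀ m, ∃ K, 0 ≤ K ∧ (m ≤ N → ∀ A f, FC r' A f → ∃ u, Sol {z | ‖c0 z‖ < ρ m ∧ p (Lft z) < σ m} u f ∧
      ∀ z, ‖c0 z‖ < ρ m → p (Lft z) < σ m → ‖u z‖ ≤ K * A) := by
    intro m
    by_cases hm : m ≤ N
    · obtain ⟨K, h1, h2⟩ := prodS hp hS (hρ0 m) (hσ0 m hm) (r' := r') (by simp only [hσ]; linarith)
      exact ⟨K, h1, fun _ => h2⟩
    · exact ⟨0, le_rfl, fun h => absurd h hm⟩
  choose K0 hK0 hu using hKe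
  set K := ∑ m ∈ Finset.range (N + 1), K0 m with hKd
  have hK : 0 ≤ K := Finset.sum_nonneg fun m _ => hK0 m
  refine ⟨K + N * (2 * K * C) + N * (2 * K * C), by positivity, fun A f hf => ?_⟩
  have hA := hf.A0 (by linarith)
  have hue : ∀ m, ∃ u, m ≤ N → Sol {z | ‖c0 z‖ < ρ m ∧ p (Lft z) < σ m} u f ∧
      ∀ z, ‖c0 z‖ < ρ m → p (Lft z) < σ m → ‖u z‖ ≤ K * A := by
    intro m
    by_cases hm : m ≤ N
    · obtain ⟨u, h1, h2⟩ := hu m hm A f hf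
      refine ⟨u, fun _ => ⟨h1, fun z hx hy => (h2 z hx hy).trans (mul_le_mul_of_nonneg_right ?_ hA)⟩⟩
      exact Finset.single_le_sum (fun m _ => hK0 m) (Finset.mem_range.2 (by omega))
    · exact ⟨0, fun h => absurd h hm⟩
  choose u hu using hue
  have hse : ∀ i, ∃ a b : L1 → ℂ, i < N → (∀ z, ‖c0 z‖ < ρ i → p (Lft z) < σ (i + 1) → u (i + 1) z - u i z = a z + b z) ∧
      ∀ m ≤ N, (m ≤ i → Sol {z | ‖c0 z‖ < l * ρ m ∧ p (Lft z) < l * σ m} a zf ∧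
        ∀ z, ‖c0 z‖ < l * ρ m → p (Lft z) < l * σ m → ‖a z‖ ≤ 2 * K * A * C) ∧
      (i ≤ m → Sol {z | ‖c0 z‖ < l * ρ m ∧ p (Lft z) < l * σ m} b zf ∧
        ∀ z, ‖c0 z‖ < l * ρ m → p (Lft z) < l * σ m → ‖b z‖ ≤ 2 * K * A * C) := by
    intro i
    by_cases hi : i < N
    · have o := pr_open hp (ρ i) (σ (i + 1))
      have m1 := hρm i (i + 1) (Nat.le_succ i)
      have m2 := hσm i (i + 1) (Nat.le_succ i)
      have s1 : l * σ i ≤ θ * σ (i + 1) := by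
        have e : σ i = σ (i + 1) + δ := by simp only [hσ, hρs]; ring
        have := hσg (i + 1) hi
        rw [e, show θ = l * (1 + τ) by rw [hθ, hl]; ring]
        have : δ ≤ τ * σ (i + 1) := hN.trans (by gcongr)
        nlinarith
      have s2 : ∀ z, ‖c0 z‖ < ρ i → p (Lft z) < σ (i + 1) → ‖u (i + 1) z - u i z‖ ≤ 2 * K * A := by
        intro z hx hy
        linarith [norm_sub_le (u (i + 1) z) (u i z), (hu (i + 1) hi).2 z (hx.trans_le m1) hy, (hu i hi.le).2 z hx (hy.trans_le m2)]
      obtain ⟨a, b, h1, h2⟩ := split1 hp (M := 2 * K * A) (l := l) (θ := θ) (hρ0 i) (hσ0 i hi.le) (hσ0 (i + 1) hi) (by positivity) hl0 hl1 s1 hθ1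
        (((hu (i + 1) hi).1.mono fun z hz => ⟨hz.1.trans_le m1, hz.2⟩).sub o ((hu i hi.le).1.mono fun z hz => ⟨hz.1, hz.2.trans_le m2⟩) |>.congr o
          (fun _ _ => rfl) fun z _ ξ => (sub_self _).symm) s2
      · refine ⟨a, b, fun _ => ⟨h1, fun m hm => ?_⟩⟩
        have := h2 (ρ m) (σ m) (hρ0 m) (hσ0 m hm) (by simp only [hσ]; ring)
        exact ⟨fun h => this.1 (hρm _ _ h), fun h => this.2 (hρm _ _ h)⟩
    · exact ⟨0, 0, fun h => absurd h hi⟩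
  choose a b hab using hse
  set v : ℕ → L1 → ℂ := fun m z => u m z + ∑ i ∈ Finset.Ico m N, a i z - ∑ i ∈ Finset.range m, b i z with hv
  have hl_le : ∀ {x : ℝ}, 0 < x → l * x ≤ x := fun hx => mul_le_of_le_one_left hx.le (by linarith)
  have v1 : ∀ m ≤ N, Sol {z | ‖c0 z‖ < l * ρ m ∧ p (Lft z) < l * σ m} (v m) f := by
    intro m hm
    have o := pr_open hp (l * ρ m) (l * σ m)
    refine ((((hu m hm).1.mono fun z hz => ⟨hz.1.trans_le (hl_le (hρ0 m)), hz.2.trans_le (hl_le (hσ0 m hm))⟩).add o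
      (Sol.sum o (Finset.Ico m N) (f := fun _ => zf) fun i hi => ?_)).sub o (Sol.sum o (Finset.range m) (f := fun _ => zf) fun i hi => ?_)).congr o
      (fun _ _ => rfl) fun z _ ξ => by simp
    · rw [Finset.mem_Ico] at hi; exact (((hab i hi.2).2 m hm).1 hi.1).1
    · rw [Finset.mem_range] at hi; exact (((hab i (by omega)).2 m hm).2 hi.le).1
  have v2 : ∀ m ≤ N, ∀ z, ‖c0 z‖ < l * ρ m → p (Lft z) < l * σ m → ‖v m z‖ ≤ (K + N * (2 * K * C) + N * (2 * K * C)) * A := by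
    intro m hm z hx hy
    have j1 := (hu m hm).2 z (hx.trans_le (hl_le (hρ0 m))) (hy.trans_le (hl_le (hσ0 m hm)))
    have j2 : ‖∑ i ∈ Finset.Ico m N, a i z‖ ≤ ∑ i ∈ Finset.range N, 2 * K * A * C :=
      (norm_sum_le_of_le _ fun i hi => by rw [Finset.mem_Ico] at hi; exact (((hab i hi.2).2 m hm).1 hi.1).2 z hx hy).trans
        (Finset.sum_le_sum_of_subset_of_nonneg (fun i hi => by simp at hi ⊢; exact hi.2) fun _ _ _ => by positivity)
    have j3 : ‖∑ i ∈ Finset.range m, b i z‖ ≤ ∑ i ∈ Finset.range N, 2 * K * A * C :=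
      (norm_sum_le_of_le _ fun i hi => by rw [Finset.mem_range] at hi; exact (((hab i (by omega)).2 m hm).2 hi.le).2 z hx hy).trans
        (Finset.sum_le_sum_of_subset_of_nonneg (fun i hi => by simp at hi ⊢; omega) fun _ _ _ => by positivity)
    rw [Finset.sum_const, Finset.card_range, nsmul_eq_mul] at j2 j3
    have := norm_sub_le (u m z + ∑ i ∈ Finset.Ico m N, a i z) (∑ i ∈ Finset.range m, b i z)
    have := norm_add_le (u m z) (∑ i ∈ Finset.Ico m N, a i z)
    simp only [hv]; linarith
  have agree : ∀ m m', m ≤ m' → m' ≤ N → ∀ z, ‖c0 z‖ < l * ρ m → p (Lft z) < l * σ m' → ∀ n, m ≤ n → n ≤ m' → v n z = v m z := by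
    intro m m' hm hm' z hx hy n hn
    induction n, hn using Nat.le_induction with
    | base => exact fun _ => rfl
    | succ n hn ih =>
      intro h
      rw [← ih (by omega)]
      have := (hab n (by omega)).1 z (hx.trans_le ((hl_le (hρ0 m)).trans (hρm _ _ hn))) (hy.trans_le ((hl_le (hσ0 m' hm')).trans (hσm _ _ h)))
      simp only [hv]
      rw [Finset.sum_range_succ, Finset.sum_eq_sum_Ico_succ_bot (by omega : n < N)]
      linear_combination this
  have cover : ∀ z, ‖c0 z‖ + p (Lft z) < r → ∃ m ≤ N, ‖c0 z‖ < l * ρ m ∧ p (Lft z) < l * σ m := by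
    classical
    intro z hz
    have q1 := hp.nn (Lft z)
    have q2 := norm_nonneg (c0 z)
    have hex : ∃ m, ‖c0 z‖ < l * ρ m := ⟨N, by rw [hρN, hl]; nlinarith⟩
    have hle : Nat.find hex ≤ N := Nat.find_min' hex (by rw [hρN, hl]; nlinarith)
    refine ⟨Nat.find hex, hle, Nat.find_spec hex, ?_⟩
    rcases hk : Nat.find hex with _ | k
    · simp only [hσ, hρ, Nat.cast_zero, zero_mul, add_zero, hl]; nlinarith
    · have := Nat.find_min hex (m := k) (by omega)
      simp only [hσ, hρs]
      push Not at this
      nlinarith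
  choose! μ μ1 μ2 μ3 using cover
  have hPo : IsOpen {z : L1 | ‖c0 z‖ + p (Lft z) < r} :=
    isOpen_lt (c0.continuous.norm.add (hp.cont.comp Lft.continuous)) continuous_const
  refine ⟨fun z => v (μ z) z, Sol.of_local fun c hc => ?_, fun z hz => v2 _ (μ1 z hz) z (μ2 z hz) (μ3 z hz)⟩
  obtain ⟨s, hs, hs'⟩ := Metric.isOpen_iff.1 (hPo.inter (pr_open hp (l * ρ (μ c)) (l * σ (μ c)))) c ⟨hc, μ2 c hc, μ3 c hc⟩
  refine ⟨s, hs, ((v1 _ (μ1 c hc)).mono fun z hz => (hs' hz).2).congr isOpen_ball (fun z hz => ?_) fun _ _ _ => rfl⟩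
  obtain ⟨h1, h2, h3⟩ := hs' hz
  rcases le_total (μ z) (μ c) with h | h
  · exact (agree _ _ h (μ1 c hc) z (μ2 z h1) h3 _ h le_rfl).symm
  · exact agree _ _ h (μ1 z h1) z h2 (μ3 z h1) _ h le_rfl
end PartP

section PartQ
open MeasureTheory Metric Filter Topology

theorem Cst_one : 1 ≤ Cst := by have := PB_one; rw [Cst]; linarith

def pn : ℕ → L1 → ℝ
  | 0 => fun z => Cst * ‖z‖
  | n+1 => fun z => ‖c0 z‖ + pn n (Lft z)

theorem pn_PN (n : ℕ) : PN (pn n) := by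
  have hC := Cst_one
  induction n with
  | zero =>
    refine ⟨continuous_const.mul continuous_norm, fun ζ z => ?_, fun z => ?_⟩
    · simp only [pn, norm_smul]; ring
    · simp only [pn]; nlinarith [norm_nonneg z]
  | succ n ih =>
    refine ⟨c0.continuous.norm.add (ih.cont.comp Lft.continuous), fun ζ z => ?_, fun z => ?_⟩
    · simp only [pn, map_smul, ih.hom, norm_smul]; ring
    · simp only [pn]; rw [l1_split z]; linarith [ih.le (Lft z)]

theorem pn_solv (n : ℕ) : Solv (pn n) := by
  induction n with
  | zero => exact solv_base
  | succ n ih => exact solv_plus (pn_PN n) ih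

theorem pn_eq (n : ℕ) (z : L1) : pn n z = ‖z‖ + (Cst - 1) * ‖(Lft^[n]) z‖ := by
  induction n generalizing z with
  | zero => simp only [pn, Function.iterate_zero, id]; ring
  | succ n ih => simp only [pn, ih, Function.iterate_succ_apply]; rw [l1_split z]; ring

theorem pn_anti (n : ℕ) (z : L1) : pn (n+1) z ≤ pn n z := by
  rw [pn_eq, pn_eq, Function.iterate_succ_apply']
  have := mul_le_mul_of_nonneg_left (Lft_le ((Lft^[n]) z)) (sub_nonneg.2 Cst_one)
  linarith

theorem pn_le (n : ℕ) (z : L1) : pn n z ≤ Cst * ‖z‖ := by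
  induction n with
  | zero => exact le_rfl
  | succ n ih => exact (pn_anti n z).trans ih

theorem pn_lim (z : L1) : Tendsto (fun n => pn n z) atTop (𝓝 ‖z‖) := by
  have := ((iter_tendsto z).const_mul (Cst - 1)).const_add ‖z‖
  rw [mul_zero, add_zero] at this
  exact this.congr fun n => (pn_eq n z).symm

theorem pn_isOpen (n : ℕ) (r : ℝ) : IsOpen {z | pn n z < r} := isOpen_lt (pn_PN n).cont continuous_const

theorem appr (n : ℕ) {h : L1 → ℂ} {r r1 M ε : ℝ} (hr : 0 < r) (hr1 : r < r1) (hε : 0 < ε)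
    (hh : Sol {z | pn n z < r1} h zf) (hM : ∀ z, pn n z < r1 → ‖h z‖ ≤ M) :
    ∃ P : L1 → ℂ, Sol univ P zf ∧ (∀ S, ∃ B, ∀ z, ‖z‖ < S → ‖P z‖ ≤ B) ∧ ∀ z, pn n z < r → ‖h z - P z‖ ≤ ε := by
  have hp := pn_PN n
  have hC := Cst_one
  have hr0 : 0 < r1 := hr.trans hr1
  have sm : ∀ S : ℝ, ∃ ρ > 0, ∀ z : L1, ‖z‖ < S → ∀ ζ : ℂ, ‖ζ‖ ≤ ρ → pn n ((0 : L1 →L[ℂ] L1) z + ζ • (ContinuousLinearMap.id ℂ L1) z) < r1 := by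
    intro S
    by_cases hS : 0 < S
    · refine ⟨r1 / (Cst * S), by positivity, fun z hz ζ hζ => ?_⟩
      simp only [ContinuousLinearMap.zero_apply, ContinuousLinearMap.id_apply, zero_add, hp.hom]
      have h1 : pn n z < Cst * S := (pn_le n z).trans_lt (by nlinarith)
      calc ‖ζ‖ * pn n z ≤ r1 / (Cst * S) * pn n z := mul_le_mul_of_nonneg_right hζ (hp.nn z)
        _ < r1 / (Cst * S) * (Cst * S) := by gcongr
        _ = r1 := by field_simp
    · exact ⟨1, one_pos, fun z hz => absurd ((norm_nonneg z).trans_lt hz) hS⟩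
  have ho := pn_isOpen n r1
  have hq : 1 < r1 / r := (one_lt_div hr).2 hr1
  have hθ : 1 / (r1 / r) < 1 := (div_lt_one (by linarith)).2 hq
  have hθ0 : 0 ≤ 1 / (r1 / r) := by positivity
  have hl : Tendsto (fun l : ℕ => M * (1 / (r1/r)) ^ l * (1 - 1/(r1/r))⁻¹) atTop (𝓝 0) := by
    simpa using ((tendsto_pow_atTop_nhds_zero_of_lt_one hθ0 hθ).const_mul M).mul_const ((1 - 1/(r1/r))⁻¹)
  obtain ⟨L, hL⟩ := (hl.eventually (gt_mem_nhds hε)).exists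
  refine ⟨fun z => ∑ i ∈ Finset.range L, tc h 0 (ContinuousLinearMap.id ℂ L1) i z, ?_, fun S => ?_, fun z hz => ?_⟩
  · refine (Sol.sum isOpen_univ (Finset.range L) (f := fun _ => zf) fun i _ => tc_hol isOpen_univ ho hh (fun a _ => ?_) i).congr
      isOpen_univ (fun _ _ => rfl) fun z _ ξ => by simp
    obtain ⟨ρ, hρ, h2⟩ := sm (‖a‖ + 1)
    refine ⟨1, one_pos, ρ, hρ, M, fun z hz _ ζ hζ => ?_⟩
    have : ‖z‖ < ‖a‖ + 1 := by
      have := norm_sub_norm_le z a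
      rw [mem_ball_iff_norm] at hz; linarith
    exact ⟨h2 z this ζ hζ, hM _ (h2 z this ζ hζ)⟩
  · obtain ⟨ρ, hρ, h2⟩ := sm S
    exact ⟨∑ i ∈ Finset.range L, M / ρ ^ i, fun z hz => norm_sum_le_of_le _ fun i _ =>
      tc_le ho hh hρ (h2 z hz) (fun ζ hζ => hM _ (h2 z hz ζ hζ)) i⟩
  · have h2 : ∀ ζ : ℂ, ‖ζ‖ ≤ r1 / r → pn n ((0 : L1 →L[ℂ] L1) z + ζ • (ContinuousLinearMap.id ℂ L1) z) < r1 := by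
      intro ζ hζ
      simp only [ContinuousLinearMap.zero_apply, ContinuousLinearMap.id_apply, zero_add, hp.hom]
      calc ‖ζ‖ * pn n z ≤ r1 / r * pn n z := mul_le_mul_of_nonneg_right hζ (hp.nn z)
        _ < r1 / r * r := by gcongr
        _ = r1 := by field_simp
    have h3 := tc_rem ho hh (by positivity) h2 (fun ζ hζ => hM _ (h2 ζ hζ)) (t := 1) (by simpa using hq) L
    simp only [norm_one, one_pow, one_mul, one_smul, ContinuousLinearMap.zero_apply, ContinuousLinearMap.id_apply, zero_add] at h3
    exact h3.trans hL.le

theorem mkFC {R : ℝ≥0∞} {f : L1 → L1 → ℂ} (hform : IsForm01 1 {z : L1 | (‖z‖₊ : ℝ≥0∞) < R} f)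
    (hclosed : DbarClosed {z : L1 | (‖z‖₊ : ℝ≥0∞) < R} f) {r : ℝ} (hrR : ENNReal.ofReal r < R)
    (hl : LipschitzForm f {z : L1 | ‖z‖ < r}) : ∃ A, FC r A f := by
  have hsub : ∀ z : L1, ‖z‖ < r → (‖z‖₊ : ℝ≥0∞) < R := fun z hz => by
    refine lt_of_le_of_lt ?_ hrR
    rw [← ENNReal.ofReal_coe_nnreal, coe_nnnorm]
    exact ENNReal.ofReal_le_ofReal hz.le
  obtain ⟨⟨A, hA⟩, B, hB⟩ := hl
  have sc : ∀ g : L1 → ℂ, (∀ (a : ℂ) ξ, g (a • ξ) = (starRingEnd ℂ) a * g ξ) → ∀ C, (∀ ξ, ‖ξ‖ ≤ 1 → ‖g ξ‖ ≤ C) → ∀ ξ, ‖g ξ‖ ≤ C * ‖ξ‖ := by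
    intro g hg C hC ξ
    have h0 : g 0 = 0 := by simpa using hg 0 0
    by_cases h : ξ = 0
    · simp [h, h0]
    have hn : 0 < ‖ξ‖ := norm_pos_iff.2 h
    have h1 := hC (((‖ξ‖⁻¹ : ℝ) : ℂ) • ξ) (by rw [norm_smul]; simp [hn.ne'])
    rw [hg] at h1
    simp only [norm_mul, Complex.conj_ofReal, Complex.norm_real, norm_inv, norm_norm] at h1
    rw [inv_mul_eq_div, div_le_iff₀ hn] at h1
    exact h1
  have hA' : ∀ z : L1, ‖z‖ < r → ∀ ξ, ‖f z ξ‖ ≤ A * ‖ξ‖ := fun z hz =>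
    sc (f z) (hform.2.1 z (hsub z hz)) A fun ξ hξ => hA ⟨z, hz, ξ, hξ, rfl⟩
  have hB' : ∀ z w : L1, ‖z‖ < r → ‖w‖ < r → ∀ ξ, ‖f z ξ - f w ξ‖ ≤ B * ‖z - w‖ * ‖ξ‖ := fun z w hz hw => by
    by_cases h : z = w
    · intro ξ; simp [h]
    have hn : 0 < ‖z - w‖ := norm_pos_iff.2 (sub_ne_zero.2 h)
    refine sc (fun ξ => f z ξ - f w ξ) (fun a ξ => ?_) _ fun ξ hξ => ?_
    · rw [hform.2.1 z (hsub z hz), hform.2.1 w (hsub w hw)]; ring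
    · rw [← div_le_iff₀ hn]; exact hB ⟨z, hz, w, hw, h, ξ, hξ, rfl⟩
  have hbs : ball (0:L1) r ⊆ {z : L1 | (‖z‖₊ : ℝ≥0∞) < R} := fun z hz => hsub z (by simpa using hz)
  refine ⟨max A B, hform.mono hbs, fun z hz => hclosed z (hbs hz), fun z hz ξ => (hA' z hz ξ).trans ?_,
    fun z w hz hw ξ => (hB' z w hz hw ξ).trans ?_⟩
  · gcongr; exact le_max_left _ _
  · gcongr; exact le_max_right _ _

theorem rseq {R : ℝ≥0∞} (hR : 0 < R) : ∃ r : ℕ → ℝ, StrictMono r ∧ (∀ n, 0 < r n) ∧ (∀ n, ENNReal.ofReal (r n) < R) ∧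
    ∀ z : L1, (‖z‖₊ : ℝ≥0∞) < R → ∃ n, ‖z‖ < r n := by
  obtain ⟨u, hu, hm, ht⟩ := exists_seq_strictMono_tendsto' hR
  have hf : ∀ n, u n ≠ ⊤ := fun n => ((hm n).2.trans_le le_top).ne
  refine ⟨fun n => (u n).toReal, fun a b h => (ENNReal.toReal_lt_toReal (hf a) (hf b)).2 (hu h),
    fun n => ENNReal.toReal_pos (hm n).1.ne' (hf n), fun n => ?_, fun z hz => ?_⟩
  · rw [ENNReal.ofReal_toReal (hf n)]; exact (hm n).2
  · obtain ⟨n, hn⟩ := (ht.eventually (lt_mem_nhds hz)).exists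
    exact ⟨n, by simpa using (ENNReal.toReal_lt_toReal (by simp) (hf n)).2 hn⟩

theorem sol_ball {R : ℝ≥0∞} (hR : 0 < R) {f : L1 → L1 → ℂ} (hform : IsForm01 1 {z : L1 | (‖z‖₊ : ℝ≥0∞) < R} f)
    (hlip : ∀ r : ℝ, 0 < r → ENNReal.ofReal r < R → LipschitzForm f {z : L1 | ‖z‖ < r})
    (hclosed : DbarClosed {z : L1 | (‖z‖₊ : ℝ≥0∞) < R} f) : ∃ u, Sol {z : L1 | (‖z‖₊ : ℝ≥0∞) < R} u f := by
  obtain ⟨r, hrm, hr0, hrR, hrz⟩ := rseq hR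
  have hFC : ∀ n, ∃ A, FC (r n) A f := fun n => mkFC hform hclosed (hrR n) (hlip _ (hr0 n) (hrR n))
  choose A hA using hFC
  let Good : ℕ → (L1 → ℂ) → Prop := fun n v => Sol {z | pn n z < r (n+1)} v f ∧ ∃ B, ∀ z, pn n z < r (n+1) → ‖v z‖ ≤ B
  have hex : ∀ n, ∃ v, Good n v := fun n => by
    obtain ⟨K, _, h⟩ := pn_solv n (r (n+1)) (r (n+2)) (hr0 _) (hrm (by omega))
    obtain ⟨u, h1, h2⟩ := h _ f (hA (n+2))
    exact ⟨u, h1, _, h2⟩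
  have hst : ∀ n v, Good n v → ∃ v', Good (n+1) v' ∧ ∀ z, pn n z < r n → ‖v z - v' z‖ ≤ 1 / 2 ^ n := by
    rintro n v ⟨hv, B, hB⟩
    obtain ⟨u, hu, B', hB'⟩ := hex (n+1)
    have o := pn_isOpen n (r (n+1))
    have o' := pn_isOpen (n+1) (r (n+1+1))
    have hss : ∀ z, pn n z < r (n+1) → pn (n+1) z < r (n+1+1) := fun z hz => ((pn_anti n z).trans_lt hz).trans (hrm (by omega))
    have hh : Sol {z | pn n z < r (n+1)} (fun z => u z - v z) zf :=
      ((hu.mono hss).sub o hv).congr o (fun _ _ => rfl) fun z _ ξ => by simp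
    have hb : ∀ z, pn n z < r (n+1) → ‖u z - v z‖ ≤ B' + B := fun z hz =>
      (norm_sub_le _ _).trans (add_le_add (hB' z (hss z hz)) (hB z hz))
    obtain ⟨P, hP, hP2, hP3⟩ := appr n (hr0 n) (hrm (by omega : n < n+1)) (ε := 1 / 2^n) (by positivity) hh hb
    obtain ⟨C, hC⟩ := hP2 (r (n+1+1))
    refine ⟨fun z => u z - P z, ⟨(hu.sub o' (hP.mono (subset_univ _))).congr o' (fun _ _ => rfl) fun z _ ξ => by simp,
      B' + C, fun z hz => (norm_sub_le _ _).trans (add_le_add (hB' z hz) (hC z (((pn_PN _).le z).trans_lt hz)))⟩, fun z hz => ?_⟩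
    have := hP3 z hz
    rwa [← norm_neg, show -(v z - (u z - P z)) = u z - v z - P z by ring]
  choose! nx hn1 hn2 using hst
  obtain ⟨v0, hv0⟩ := hex 0
  let v : ℕ → L1 → ℂ := fun n => Nat.rec v0 (fun n w => nx n w) n
  have hG : ∀ n, Good n (v n) := fun n => by
    induction n with
    | zero => exact hv0
    | succ n ih => exact hn1 n _ ih
  have hd : ∀ n z, pn n z < r n → ‖v n z - v (n+1) z‖ ≤ 1 / 2 ^ n := fun n => hn2 n _ (hG n)
  have hmono : ∀ n k z, pn n z < r n → pn (n+k) z < r (n+k) := fun n k z hz => by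
    induction k with
    | zero => exact hz
    | succ k ih => exact ((pn_anti _ z).trans_lt ih).trans (hrm (by omega))
  refine ⟨fun z => limUnder atTop fun n => v n z, Sol.of_local fun a ha => ?_⟩
  obtain ⟨n1, h1⟩ := hrz a ha
  obtain ⟨n0, h2, h3⟩ := (((pn_lim a).eventually (gt_mem_nhds h1)).and (eventually_ge_atTop n1)).exists
  have h4 : a ∈ {z | pn n0 z < r n0} := lt_of_lt_of_le h2 (hrm.monotone h3)
  obtain ⟨s, hs, hs'⟩ := Metric.isOpen_iff.1 (pn_isOpen n0 (r n0)) a h4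
  obtain ⟨B, hB⟩ := (hG n0).2
  have hdz : ∀ z ∈ ball a s, ∀ k, dist (v (k+n0) z) (v (k+1+n0) z) ≤ 2 / 2 / 2 ^ k := fun z hz k => by
    rw [dist_eq_norm, show k + 1 + n0 = n0 + k + 1 by omega, show k + n0 = n0 + k by omega]
    refine (hd (n0+k) z (hmono n0 k z (hs' hz))).trans ?_
    rw [div_self two_ne_zero]
    gcongr
    · norm_num
    · omega
  have hbz : ∀ z ∈ ball a s, ∀ k, ‖v (k+n0) z‖ ≤ B + 2 := fun z hz k => by
    have e0 : ‖v n0 z‖ ≤ B := hB z (lt_trans (hs' hz) (hrm (by omega)))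
    have e : ‖v (k+n0) z‖ ≤ B + 2 - 2 * (1/2)^k := by
      induction k with
      | zero => simpa using e0
      | succ k ih =>
        have := hdz z hz k
        rw [dist_comm, dist_eq_norm] at this
        have t := norm_sub_norm_le (v (k+1+n0) z) (v (k+n0) z)
        rw [show (2:ℝ) / 2 / 2^k = (1/2)^k by rw [div_self two_ne_zero, one_div_pow]] at this
        rw [pow_succ]; linarith
    have : (0:ℝ) ≤ (1/2)^k := by positivity
    linarith
  refine ⟨s, hs, lim_sol (un := fun k => v (k+n0)) (fn := fun _ => f) isOpen_ball (fun k => ?_) (fun b hb => ?_) (fun z hz => ?_)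
    (fun z hz ξ => tendsto_const_nhds) (hform.mono fun z hz => ?_)⟩
  · refine (hG (k+n0)).1.mono fun z hz => ?_
    have := hmono n0 k z (hs' hz)
    rw [add_comm] at this
    exact this.trans (hrm (by omega))
  · refine ⟨1, one_pos, max (B+2) (A n0), fun z _ hz k => ⟨(hbz z hz k).trans (le_max_left _ _), fun ξ => ?_⟩⟩
    refine ((hA n0).bd z (((pn_PN n0).le z).trans_lt (hs' hz)) ξ).trans ?_
    gcongr; exact le_max_right _ _
  · have hc : CauchySeq fun k => v (k+n0) z := cauchySeq_of_le_geometric_two (C := 2) (hdz z hz)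
    obtain ⟨y, hy⟩ := cauchySeq_tendsto_of_complete hc
    have hy' := (tendsto_add_atTop_iff_nat (f := fun n => v n z) n0).1 hy
    rw [hy'.limUnder_eq]; exact hy
  · refine lt_of_le_of_lt ?_ (hrR n0)
    rw [← ENNReal.ofReal_coe_nnreal, coe_nnnorm]
    exact ENNReal.ofReal_le_ofReal (((pn_PN n0).le z).trans (hs' hz).le)

theorem final (R : ℝ≥0∞) (hR : 0 < R) (m : ℕ) (hm : 1 ≤ m) (f : L1 → L1 → ℂ)
    (hform : IsForm01 m {z : L1 | (‖z‖₊ : ℝ≥0∞) < R} f)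
    (hlip : ∀ r : ℝ, 0 < r → ENNReal.ofReal r < R →
      LipschitzForm f {z : L1 | ‖z‖ < r})
    (hclosed : DbarClosed {z : L1 | (‖z‖₊ : ℝ≥0∞) < R} f) :
    ∃ u : L1 → ℂ,
      ContDiffOn ℝ m u {z : L1 | (‖z‖₊ : ℝ≥0∞) < R} ∧
      ∀ z : L1, (‖z‖₊ : ℝ≥0∞) < R → ∀ ξ : L1, dbar u z ξ = f z ξ := by
  obtain ⟨u, hu⟩ := sol_ball hR ⟨hform.1, hform.2.1, hform.2.2.of_le (by exact_mod_cast hm)⟩ hlip hclosed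
  have ho : IsOpen {z : L1 | (‖z‖₊ : ℝ≥0∞) < R} := isOpen_lt (by fun_prop) continuous_const
  refine ⟨u, ?_, hu.2⟩
  obtain ⟨n, rfl⟩ : ∃ n, m = n + 1 := ⟨m - 1, by omega⟩
  have := reg n ho hform.jf hu.1.continuousOn fun a ha => by
    obtain ⟨ε, hε, h⟩ := Metric.isOpen_iff.1 ho a ha
    have h' : ball a (2 * (ε/2)) ⊆ {z : L1 | (‖z‖₊ : ℝ≥0∞) < R} := by rwa [mul_div_cancel₀ _ (two_ne_zero)]
    exact ⟨ε/2, by positivity, h', hu.wp ho h'⟩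
  exact_mod_cast this
end PartQ

/-- Let `0 < R ≤ ∞`, `m ≥ 1`, and let `f` be a `(0,1)`-form of class `C^m` on
`B(R) ⊆ l¹` which is Lipschitz continuous on every ball `B(r)`, `0 < r < R`. If `f` is
`∂̄`-closed, then there is an `m` times continuously (real Fréchet) differentiable
`u : B(R) → ℂ` with `∂̄u = f` on `B(R)`. -/
theorem statement1 (R : ℝ≥0∞) (hR : 0 < R) (m : ℕ) (hm : 1 ≤ m) (f : L1 → L1 → ℂ)
    (hform : IsForm01 m {z : L1 | (‖z‖₊ : ℝ≥0∞) < R} f)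
    (hlip : ∀ r : ℝ, 0 < r → ENNReal.ofReal r < R →
      LipschitzForm f {z : L1 | ‖z‖ < r})
    (hclosed : DbarClosed {z : L1 | (‖z‖₊ : ℝ≥0∞) < R} f) :
    ∃ u : L1 → ℂ,
      ContDiffOn ℝ m u {z : L1 | (‖z‖₊ : ℝ≥0∞) < R} ∧
      ∀ z : L1, (‖z‖₊ : ℝ≥0∞) < R → ∀ ξ : L1, dbar u z ξ = f z ξ := by
  exact final R hR m hm f hform hlip hclosed
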